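/- arXiv:2504.20229 — 9 statements merged into one kernel-verified Lean document; each statement's English description precedes it below -/
import Mathlib

section
/- For every test function ψ, the Rayleigh quotient satisfies E(φ,ψ) > inf { max(B₁(ν̃,Δ), B₂(ν̃,Δ)) : ν̃ ∈ [0,1], Δ ∈ (0,π/2) }. (Hence the lowest eigenvalue λ_Γ of the Schrödinger operator −d²/ds² + κ(s)² with periodic boundary conditions exceeds this infimum.) -/
open Real

/-- `G(Δ) = (1 + cot(Δ/4))⁻²`. -/
noncomputable def G (Δ : ℝ) : ℝ := ((1 + Real.cot (Δ / 4)) ^ 2)⁻¹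

/-- `B₁(ν̃,Δ) = (1 + 2 ν̃ G(Δ))⁻²`. -/
noncomputable def B₁ (ν Δ : ℝ) : ℝ := ((1 + 2 * ν * G Δ) ^ 2)⁻¹

/-- `B₂(ν̃,Δ) = 1 − (2 − sec²(Δ/2))·(1 − (2 + 2 ν̃ G(Δ) − ν̃)⁻²)`. -/
noncomputable def B₂ (ν Δ : ℝ) : ℝ :=
  1 - (2 - ((Real.cos (Δ / 2))⁻¹) ^ 2) * (1 - ((2 + 2 * ν * G Δ - ν) ^ 2)⁻¹)

/-- Wirtinger's inequality for a function vanishing at both ends of an interval, with a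
subcritical constant. -/
lemma sq_mul_integral_sq_le_of_mul_lt_pi {a b k : ℝ} (hab : a < b) (hk : 0 ≤ k)
    (hkπ : k * (b - a) < π) {u u' : ℝ → ℝ} (hu : ∀ x, HasDerivAt u (u' x) x)
    (hu' : Continuous u') (ha : u a = 0) (hb : u b = 0) :
    k ^ 2 * ∫ x in a..b, u x ^ 2 ≤ ∫ x in a..b, u' x ^ 2 := by
  have hc : Continuous u := continuous_iff_continuousAt.2 fun x => (hu x).continuousAt
  set m := (a + b) / 2 with hm
  have hcos : ∀ x ∈ Set.uIcc a b, Real.cos (k * (x - m)) ≠ 0 := by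
    intro x hx
    rw [Set.uIcc_of_le hab.le] at hx
    refine (Real.cos_pos_of_mem_Ioo ⟨?_, ?_⟩).ne'
    · nlinarith [mul_le_mul_of_nonneg_left hx.1 hk]
    · nlinarith [mul_le_mul_of_nonneg_left hx.2 hk]
  set F : ℝ → ℝ := fun x => u x ^ 2 * (-k * Real.tan (k * (x - m))) with hF
  set F' : ℝ → ℝ := fun x => 2 * u x * u' x * (-k * Real.tan (k * (x - m)))
    + u x ^ 2 * (-k * (1 / Real.cos (k * (x - m)) ^ 2 * k)) with hF'
  have hFd : ∀ x ∈ Set.uIcc a b, HasDerivAt F (F' x) x := by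
    intro x hx
    have h1 : HasDerivAt (fun x => k * (x - m)) k x := by
      simpa using ((hasDerivAt_id x).sub_const m).const_mul k
    have h2 := (Real.hasDerivAt_tan (hcos x hx)).comp x h1
    have h3 := ((hu x).pow 2).mul (h2.const_mul (-k))
    exact h3.congr_deriv (by simp [hF'])
  have hF'c : ContinuousOn F' (Set.uIcc a b) := by
    have ht : ContinuousOn (fun x => Real.tan (k * (x - m))) (Set.uIcc a b) :=
      Real.continuousOn_tan.comp (by fun_prop) hcos
    have hs : ContinuousOn (fun x => 1 / Real.cos (k * (x - m)) ^ 2) (Set.uIcc a b) :=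
      ContinuousOn.div (by fun_prop) (by fun_prop) fun x hx => pow_ne_zero 2 (hcos x hx)
    fun_prop
  have hint : ∫ x in a..b, F' x = 0 := by
    rw [intervalIntegral.integral_eq_sub_of_hasDerivAt hFd hF'c.intervalIntegrable]
    simp [hF, ha, hb]
  have hmono : ∫ x in a..b, (k ^ 2 * u x ^ 2 + F' x) ≤ ∫ x in a..b, u' x ^ 2 := by
    refine intervalIntegral.integral_mono_on hab.le ?_ ?_ ?_
    · exact (ContinuousOn.add (by fun_prop) hF'c).intervalIntegrable
    · exact (hu'.pow 2).intervalIntegrable _ _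
    · intro x hx
      have hx' := hcos x (Set.uIcc_of_le hab.le ▸ hx)
      have hsec : 1 / Real.cos (k * (x - m)) ^ 2 = 1 + Real.tan (k * (x - m)) ^ 2 := by
        rw [← Real.inv_one_add_tan_sq hx', one_div, inv_inv]
      simp only [hF', hsec]
      nlinarith [sq_nonneg (u' x + k * u x * Real.tan (k * (x - m)))]
  rw [intervalIntegral.integral_add (by apply Continuous.intervalIntegrable; fun_prop)
    hF'c.intervalIntegrable, hint, intervalIntegral.integral_const_mul] at hmono
  linarith

/-- Wirtinger's inequality for a function vanishing at both ends of an interval. -/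
lemma wirtinger_inequality {a b : ℝ} (hab : a < b) {u u' : ℝ → ℝ}
    (hu : ∀ x, HasDerivAt u (u' x) x) (hu' : Continuous u') (ha : u a = 0) (hb : u b = 0) :
    (π / (b - a)) ^ 2 * ∫ x in a..b, u x ^ 2 ≤ ∫ x in a..b, u' x ^ 2 := by
  have hL : 0 < b - a := sub_pos.2 hab
  have hlim : Filter.Tendsto (fun k : ℝ => k ^ 2 * ∫ x in a..b, u x ^ 2)
      (nhdsWithin (π / (b - a)) (Set.Iio (π / (b - a))))
      (nhds ((π / (b - a)) ^ 2 * ∫ x in a..b, u x ^ 2)) :=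
    (Continuous.tendsto (by fun_prop) _).mono_left nhdsWithin_le_nhds
  refine le_of_tendsto hlim ?_
  filter_upwards [Ioo_mem_nhdsLT (div_pos pi_pos hL)] with k hk
  exact sq_mul_integral_sq_le_of_mul_lt_pi hab hk.1.le ((lt_div_iff₀ hL).1 hk.2) hu hu' ha hb

/-- The tangent-angle function of a strictly convex curve has a continuously differentiable
increasing inverse. -/
lemma exists_inverse_tangentAngle {φ : ℝ → ℝ} (hφ : ContDiff ℝ (⊤ : ℕ∞) φ)
    (hφ' : ∀ s, 0 < deriv φ s) (hφper : ∀ s, φ (s + 2 * π) = φ s + 2 * π) :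
    ∃ T T' : ℝ → ℝ, (∀ θ, φ (T θ) = θ) ∧ StrictMono T ∧ (∀ θ, T (θ + 2 * π) = T θ + 2 * π) ∧
      (∀ θ, HasDerivAt T (T' θ) θ) ∧ Continuous T' := by
  have hmono : StrictMono φ := strictMono_of_deriv_pos hφ'
  have hc : Continuous φ := hφ.continuous
  have hn : ∀ n : ℕ, φ (n * (2 * π)) = φ 0 + n * (2 * π) ∧
      φ (-(n * (2 * π))) = φ 0 - n * (2 * π) := by
    intro n
    induction n with
    | zero => simp
    | succ n ih =>
      refine ⟨?_, ?_⟩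
      · have := hφper (n * (2 * π))
        push_cast
        rw [show ((n : ℝ) + 1) * (2 * π) = n * (2 * π) + 2 * π by ring, this, ih.1]
        ring
      · have := hφper (-((n + 1) * (2 * π)))
        rw [show -(((n : ℝ) + 1) * (2 * π)) + 2 * π = -(n * (2 * π)) by ring, ih.2] at this
        push_cast
        linarith
  have hsurj : Function.Surjective φ := by
    intro y
    obtain ⟨n, hn'⟩ := exists_nat_ge (|y - φ 0| / (2 * π))
    rw [div_le_iff₀ (by positivity)] at hn'
    have h := abs_le.1 hn'
    have : y ∈ Set.Icc (φ (-(n * (2 * π)))) (φ (n * (2 * π))) := by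
      rw [(hn n).1, (hn n).2]
      constructor <;> linarith
    obtain ⟨x, -, hx⟩ := intermediate_value_Icc
      (by have : 0 ≤ (n : ℝ) * (2 * π) := by positivity
          linarith) hc.continuousOn this
    exact ⟨x, hx⟩
  set e := hmono.orderIsoOfSurjective φ hsurj with he
  have hTφ : ∀ θ, φ (e.symm θ) = θ := fun θ => e.apply_symm_apply θ
  have hTc : Continuous e.symm := e.symm.continuous
  refine ⟨e.symm, fun θ => (deriv φ (e.symm θ))⁻¹, hTφ, e.symm.strictMono, ?_, ?_, ?_⟩
  · intro θ
    apply hmono.injective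
    rw [hTφ, hφper, hTφ]
  · intro θ
    have hd : HasDerivAt φ (deriv φ (e.symm θ)) (e.symm θ) :=
      ((hφ.differentiable (by simp)) _).hasDerivAt
    exact hd.of_local_left_inverse hTc.continuousAt (hφ' _).ne' (Filter.Eventually.of_forall hTφ)
  · have hne : ∀ s, deriv φ s ≠ 0 := fun s => (hφ' s).ne'
    exact ((hφ.continuous_deriv (by simp)).comp hTc).inv₀ fun θ => hne (e.symm θ)

/-- The excess over `π` of the length of the arc along which the tangent angle grows from `θ`
to `θ + π`. -/
noncomputable def arcExcess (T : ℝ → ℝ) (θ : ℝ) : ℝ := T (θ + π) - T θ - π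

lemma arcExcess_add_pi {T : ℝ → ℝ} (hT : ∀ θ, T (θ + 2 * π) = T θ + 2 * π) (θ : ℝ) :
    arcExcess T (θ + π) = -arcExcess T θ := by
  have := hT θ
  simp only [arcExcess]
  rw [show θ + π + π = θ + 2 * π by ring, this]
  ring

/-- The closing condition makes the arc excess orthogonal to all first harmonics. -/
lemma integral_arcExcess_mul_sin_eq_zero {φ T T' : ℝ → ℝ} (hφ : Continuous φ)
    (hφper : ∀ s, φ (s + 2 * π) = φ s + 2 * π)
    (hclose_cos : (∫ s in (0:ℝ)..(2 * π), Real.cos (φ s)) = 0)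
    (hclose_sin : (∫ s in (0:ℝ)..(2 * π), Real.sin (φ s)) = 0)
    (hφT : ∀ θ, φ (T θ) = θ) (hTper : ∀ θ, T (θ + 2 * π) = T θ + 2 * π)
    (hT : ∀ θ, HasDerivAt T (T' θ) θ) (hT' : Continuous T') (α τ : ℝ) :
    ∫ θ in α..(α + π), arcExcess T θ * Real.sin (θ - τ) = 0 := by
  have hTc : Continuous T := continuous_iff_continuousAt.2 fun x => (hT x).continuousAt
  have h1 : ∫ s in T α..T (α + 2 * π), Real.cos (φ s - τ) = 0 := by
    have hper : Function.Periodic (fun s => Real.cos (φ s - τ)) (2 * π) := by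
      intro s
      simp only [hφper]
      rw [show φ s + 2 * π - τ = φ s - τ + 2 * π by ring, Real.cos_add_two_pi]
    rw [hTper, hper.intervalIntegral_add_eq (T α) 0, zero_add]
    simp only [Real.cos_sub]
    rw [intervalIntegral.integral_add (by apply Continuous.intervalIntegrable; fun_prop)
      (by apply Continuous.intervalIntegrable; fun_prop), intervalIntegral.integral_mul_const,
      intervalIntegral.integral_mul_const, hclose_cos, hclose_sin]
    simp
  have h2 : ∫ θ in α..(α + 2 * π), Real.cos (θ - τ) * T' θ = 0 := by
    rw [← h1, ← intervalIntegral.integral_comp_mul_deriv (fun x _ => hT x) hT'.continuousOn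
      (g := fun s => Real.cos (φ s - τ)) (by fun_prop)]
    simp [hφT]
  have hcosd : ∀ θ, HasDerivAt (fun θ => Real.cos (θ - τ)) (-Real.sin (θ - τ)) θ := by
    intro θ
    simpa using ((hasDerivAt_id θ).sub_const τ).cos
  have h3 := intervalIntegral.integral_mul_deriv_eq_deriv_mul (a := α) (b := α + 2 * π)
    (fun x _ => hcosd x) (fun x _ => hT x)
    (by apply Continuous.intervalIntegrable; fun_prop) (hT'.intervalIntegrable _ _)
  rw [h2, hTper, show α + 2 * π - τ = α - τ + 2 * π by ring, Real.cos_add_two_pi] at h3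
  have hint : ∀ a b, IntervalIntegrable (fun θ => -Real.sin (θ - τ) * T θ)
      MeasureTheory.volume a b := fun a b => by
    apply Continuous.intervalIntegrable; fun_prop
  rw [← intervalIntegral.integral_add_adjacent_intervals (hint α (α + π)) (hint (α + π) _),
    show α + 2 * π = α + π + π by ring,
    ← intervalIntegral.integral_comp_add_right (a := α) (b := α + π)
      (fun θ => -Real.sin (θ - τ) * T θ) π,
    ← intervalIntegral.integral_add (by apply Continuous.intervalIntegrable; fun_prop)
      (by apply Continuous.intervalIntegrable; fun_prop)] at h3
  have h4 : ∫ θ in α..(α + π), Real.sin (θ - τ) = 2 * Real.cos (α - τ) := by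
    rw [intervalIntegral.integral_comp_sub_right (fun θ => Real.sin θ), integral_sin,
      show α + π - τ = α - τ + π by ring, Real.cos_add_pi]
    ring
  have h5 : ∀ θ, arcExcess T θ * Real.sin (θ - τ) =
      (-Real.sin (θ - τ) * T θ + -Real.sin (θ + π - τ) * T (θ + π)) - π * Real.sin (θ - τ) := by
    intro θ
    rw [show θ + π - τ = θ - τ + π by ring, Real.sin_add_pi]
    simp only [arcExcess]
    ring
  simp only [h5]
  rw [intervalIntegral.integral_sub (by apply Continuous.intervalIntegrable; fun_prop)
      (by apply Continuous.intervalIntegrable; fun_prop), intervalIntegral.integral_const_mul, h4]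
  linarith

/-- The component of the curve `ψ e^{iφ}` orthogonal to the direction `θ`. -/
noncomputable def component (φ ψ : ℝ → ℝ) (θ s : ℝ) : ℝ := ψ s * Real.sin (φ s - θ)

/-- The derivative of `component φ ψ θ`. -/
noncomputable def componentDeriv (φ ψ : ℝ → ℝ) (θ s : ℝ) : ℝ :=
  deriv ψ s * Real.sin (φ s - θ) + ψ s * (Real.cos (φ s - θ) * deriv φ s)

/-- On each of the two arcs cut out by the direction `θ`, Wirtinger's inequality applies to
the component orthogonal to `θ`. -/
lemma sq_mul_integral_component_sq_le {φ ψ T : ℝ → ℝ} (hφ : ContDiff ℝ (⊤ : ℕ∞) φ)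
    (hφper : ∀ s, φ (s + 2 * π) = φ s + 2 * π) (hψ : ContDiff ℝ 1 ψ)
    (hψper : ∀ s, ψ (s + 2 * π) = ψ s) (hφT : ∀ θ, φ (T θ) = θ) (hTm : StrictMono T)
    (hTper : ∀ θ, T (θ + 2 * π) = T θ + 2 * π) (θ : ℝ) :
    (π / (π + |arcExcess T θ|)) ^ 2 * ∫ s in (0:ℝ)..(2 * π), component φ ψ θ s ^ 2 ≤
      ∫ s in (0:ℝ)..(2 * π), componentDeriv φ ψ θ s ^ 2 := by
  have hφd : ∀ s, HasDerivAt φ (deriv φ s) s := fun s =>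
    ((hφ.differentiable (by simp)) s).hasDerivAt
  have hψd : ∀ s, HasDerivAt ψ (deriv ψ s) s := fun s =>
    ((hψ.differentiable (by simp)) s).hasDerivAt
  have hφc := hφ.continuous
  have hψc := hψ.continuous
  have hφc' := hφ.continuous_deriv (by simp)
  have hψc' := hψ.continuous_deriv le_rfl
  have hd : ∀ s, HasDerivAt (component φ ψ θ) (componentDeriv φ ψ θ s) s := fun s =>
    (hψd s).mul ((hφd s).sub_const θ).sin
  have hc : Continuous (component φ ψ θ) := by unfold component; fun_prop
  have hc' : Continuous (componentDeriv φ ψ θ) := by unfold componentDeriv; fun_prop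
  have hφper' : ∀ s, deriv φ (s + 2 * π) = deriv φ s := fun s => by
    rw [← deriv_comp_add_const, funext hφper, deriv_add_const]
  have hψper' : ∀ s, deriv ψ (s + 2 * π) = deriv ψ s := fun s => by
    rw [← deriv_comp_add_const, funext hψper]
  have hper : Function.Periodic (fun s => component φ ψ θ s ^ 2) (2 * π) := fun s => by
    simp only [component, hφper, hψper]
    rw [show φ s + 2 * π - θ = φ s - θ + 2 * π by ring, Real.sin_add_two_pi]
  have hper' : Function.Periodic (fun s => componentDeriv φ ψ θ s ^ 2) (2 * π) := fun s => by
    simp only [componentDeriv, hφper, hψper, hφper', hψper']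
    rw [show φ s + 2 * π - θ = φ s - θ + 2 * π by ring, Real.sin_add_two_pi,
      Real.cos_add_two_pi]
  have h0 : component φ ψ θ (T θ) = 0 := by simp [component, hφT]
  have h1 : component φ ψ θ (T (θ + π)) = 0 := by simp [component, hφT]
  have h2 : component φ ψ θ (T (θ + 2 * π)) = 0 := by simp [component, hφT]
  have hlt1 : T θ < T (θ + π) := hTm (by linarith [pi_pos])
  have hlt2 : T (θ + π) < T (θ + 2 * π) := hTm (by linarith [pi_pos])
  have key : ∀ a b, a < b → b - a ≤ π + |arcExcess T θ| → component φ ψ θ a = 0 →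
      component φ ψ θ b = 0 → (π / (π + |arcExcess T θ|)) ^ 2 *
        ∫ s in a..b, component φ ψ θ s ^ 2 ≤ ∫ s in a..b, componentDeriv φ ψ θ s ^ 2 := by
    intro a b hab hle ha hb
    refine le_trans ?_ (wirtinger_inequality hab hd hc' ha hb)
    have hI : 0 ≤ ∫ s in a..b, component φ ψ θ s ^ 2 :=
      intervalIntegral.integral_nonneg hab.le fun _ _ => sq_nonneg _
    have := sub_pos.2 hab
    gcongr
  have k1 := key _ _ hlt1 (by
    have := le_abs_self (arcExcess T θ)
    simp only [arcExcess] at this ⊢; linarith) h0 h1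
  have k2 := key _ _ hlt2 (by
    have := neg_abs_le (arcExcess T θ)
    rw [hTper]
    simp only [arcExcess] at this ⊢; linarith) h1 h2
  have e1 := hper.intervalIntegral_add_eq (T θ) 0
  have e2 := hper'.intervalIntegral_add_eq (T θ) 0
  rw [← hTper, zero_add] at e1 e2
  have split : ∀ f : ℝ → ℝ, Continuous f → ∫ s in T θ..T (θ + 2 * π), f s ^ 2 =
      (∫ s in T θ..T (θ + π), f s ^ 2) + ∫ s in T (θ + π)..T (θ + 2 * π), f s ^ 2 :=
    fun f hf => (intervalIntegral.integral_add_adjacent_intervals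
      ((hf.pow 2).intervalIntegrable _ _) ((hf.pow 2).intervalIntegrable _ _)).symm
  rw [← e1, ← e2, split _ hc, split _ hc', mul_add]
  exact add_le_add k1 k2

lemma exists_integral_component_sq_eq {φ ψ : ℝ → ℝ} (hφ : Continuous φ) (hψ : Continuous ψ) :
    ∃ c d : ℝ, ∀ θ, ∫ s in (0:ℝ)..(2 * π), component φ ψ θ s ^ 2 =
      (∫ s in (0:ℝ)..(2 * π), ψ s ^ 2) / 2 + c * Real.cos (2 * θ) + d * Real.sin (2 * θ) := by
  refine ⟨∫ s in (0:ℝ)..(2 * π), -(ψ s ^ 2 * Real.cos (2 * φ s)) / 2,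
    ∫ s in (0:ℝ)..(2 * π), -(ψ s ^ 2 * Real.sin (2 * φ s)) / 2, fun θ => ?_⟩
  rw [← intervalIntegral.integral_div, ← intervalIntegral.integral_mul_const,
    ← intervalIntegral.integral_mul_const, ← intervalIntegral.integral_add
    (by apply Continuous.intervalIntegrable; fun_prop)
    (by apply Continuous.intervalIntegrable; fun_prop), ← intervalIntegral.integral_add
    (by apply Continuous.intervalIntegrable; fun_prop)
    (by apply Continuous.intervalIntegrable; fun_prop)]
  congr 1
  ext s
  have h : Real.sin (φ s - θ) ^ 2 = 1 / 2 - Real.cos (2 * φ s - 2 * θ) / 2 := by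
    rw [Real.sin_sq_eq_half_sub]; ring_nf
  rw [component, mul_pow, h, Real.cos_sub]
  ring

lemma exists_integral_componentDeriv_sq_eq {φ ψ : ℝ → ℝ} (hφ : ContDiff ℝ (⊤ : ℕ∞) φ)
    (hψ : ContDiff ℝ 1 ψ) :
    ∃ c d : ℝ, ∀ θ, ∫ s in (0:ℝ)..(2 * π), componentDeriv φ ψ θ s ^ 2 =
      (∫ s in (0:ℝ)..(2 * π), (deriv ψ s ^ 2 + deriv φ s ^ 2 * ψ s ^ 2)) / 2 +
        c * Real.cos (2 * θ) + d * Real.sin (2 * θ) := by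
  have hφc := hφ.continuous
  have hψc := hψ.continuous
  have hφc' := hφ.continuous_deriv (by simp)
  have hψc' := hψ.continuous_deriv le_rfl
  refine ⟨∫ s in (0:ℝ)..(2 * π), ((deriv φ s ^ 2 * ψ s ^ 2 - deriv ψ s ^ 2) / 2 *
      Real.cos (2 * φ s) + deriv ψ s * ψ s * deriv φ s * Real.sin (2 * φ s)),
    ∫ s in (0:ℝ)..(2 * π), ((deriv φ s ^ 2 * ψ s ^ 2 - deriv ψ s ^ 2) / 2 *
      Real.sin (2 * φ s) - deriv ψ s * ψ s * deriv φ s * Real.cos (2 * φ s)), fun θ => ?_⟩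
  rw [← intervalIntegral.integral_div, ← intervalIntegral.integral_mul_const,
    ← intervalIntegral.integral_mul_const, ← intervalIntegral.integral_add
    (by apply Continuous.intervalIntegrable; fun_prop)
    (by apply Continuous.intervalIntegrable; fun_prop), ← intervalIntegral.integral_add
    (by apply Continuous.intervalIntegrable; fun_prop)
    (by apply Continuous.intervalIntegrable; fun_prop)]
  congr 1
  ext s
  have h1 : Real.sin (φ s - θ) ^ 2 = 1 / 2 - Real.cos (2 * φ s - 2 * θ) / 2 := by
    rw [Real.sin_sq_eq_half_sub]; ring_nf
  have h2 : Real.cos (φ s - θ) ^ 2 = 1 / 2 + Real.cos (2 * φ s - 2 * θ) / 2 := by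
    rw [Real.cos_sq]; ring_nf
  have h3 : 2 * Real.sin (φ s - θ) * Real.cos (φ s - θ) = Real.sin (2 * φ s - 2 * θ) := by
    rw [← Real.sin_two_mul]; ring_nf
  have h4 : componentDeriv φ ψ θ s ^ 2 = deriv ψ s ^ 2 * Real.sin (φ s - θ) ^ 2 +
      deriv ψ s * ψ s * deriv φ s * (2 * Real.sin (φ s - θ) * Real.cos (φ s - θ)) +
      ψ s ^ 2 * deriv φ s ^ 2 * Real.cos (φ s - θ) ^ 2 := by
    rw [componentDeriv]; ring
  rw [h4, h1, h2, h3, Real.cos_sub, Real.sin_sub]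
  ring

/-- No component of a test function vanishes identically. -/
lemma integral_component_sq_pos {φ ψ : ℝ → ℝ} (hφ : Continuous φ) (hmono : StrictMono φ)
    (hψ : Continuous ψ) (hψpos : 0 < ∫ s in (0:ℝ)..(2 * π), ψ s ^ 2) (θ : ℝ) :
    0 < ∫ s in (0:ℝ)..(2 * π), component φ ψ θ s ^ 2 := by
  have hc : Continuous (component φ ψ θ) := by unfold component; fun_prop
  by_contra hcon
  obtain ⟨s, hs, hψs⟩ : ∃ s ∈ Set.Ioo (0:ℝ) (2 * π), ψ s ≠ 0 := by
    by_contra! h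
    have h0 : ∫ s in (0:ℝ)..(2 * π), ψ s ^ 2 = ∫ s in (0:ℝ)..(2 * π), (0:ℝ) := by
      refine intervalIntegral.integral_congr_Ioo_of_le two_pi_pos.le fun s hs => ?_
      simp [h s hs]
    simp [h0] at hψpos
  have hnear : ∀ᶠ t in nhds s, t ∈ Set.Ioo (0:ℝ) (2 * π) ∧ ψ t ≠ 0 ∧ |φ t - φ s| < π / 2 :=
    Filter.Eventually.and (Ioo_mem_nhds hs.1 hs.2) ((hψ.continuousAt.eventually_ne hψs).and
      ((by fun_prop : Continuous fun t => |φ t - φ s|).continuousAt.eventually_lt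
        continuousAt_const (by simp [pi_pos])))
  have hzero : ∀ t ∈ Set.Ioo (0:ℝ) (2 * π), component φ ψ θ t = 0 := by
    intro t ht
    by_contra hne
    refine hcon (intervalIntegral.integral_pos two_pi_pos (by fun_prop)
      (fun _ _ => sq_nonneg _) ⟨t, ⟨ht.1.le, ht.2.le⟩, by positivity⟩)
  have hs0 : Real.sin (φ s - θ) = 0 :=
    (mul_eq_zero.1 (hzero s hs)).resolve_left hψs
  obtain ⟨t, ⟨ht, hψt, hφt⟩, hts⟩ := (hnear.filter_mono nhdsWithin_le_nhds |>.and
    (self_mem_nhdsWithin (s := Set.Ioi s))).exists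
  have ht0 : Real.sin (φ t - θ) = 0 := (mul_eq_zero.1 (hzero t ht)).resolve_left hψt
  have hst : 0 < φ t - φ s := sub_pos.2 (hmono hts)
  have hpos : 0 < Real.sin (φ t - φ s) :=
    Real.sin_pos_of_pos_of_lt_pi hst (by linarith [(abs_lt.1 hφt).2, pi_pos])
  rw [show φ t - φ s = (φ t - θ) - (φ s - θ) by ring, Real.sin_sub, hs0, ht0] at hpos
  simp at hpos

lemma exists_forall_pos_imp_cos_pos (β γ : ℝ) : ∃ δ : ℝ, ∀ θ,
    0 < β * Real.cos (2 * θ) + γ * Real.sin (2 * θ) → 0 < Real.cos (2 * (θ - δ)) := by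
  refine ⟨Complex.arg ⟨β, γ⟩ / 2, fun θ h => ?_⟩
  have h1 := Complex.norm_mul_cos_arg ⟨β, γ⟩
  have h2 := Complex.norm_mul_sin_arg ⟨β, γ⟩
  set ρ := ‖(⟨β, γ⟩ : ℂ)‖
  set a := Complex.arg ⟨β, γ⟩
  simp only at h1 h2
  rw [show 2 * (θ - a / 2) = 2 * θ - a by ring, Real.cos_sub]
  rw [← h1, ← h2] at h
  have hρ : 0 ≤ ρ := norm_nonneg _
  by_contra hcon
  nlinarith [mul_nonneg hρ (neg_nonneg.2 (not_lt.1 hcon))]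

lemma cos_two_mul_sub_nonpos {x δ : ℝ} (h1 : δ + π / 4 ≤ x) (h2 : x ≤ δ + 3 * π / 4) :
    Real.cos (2 * (x - δ)) ≤ 0 :=
  Real.cos_nonpos_of_pi_div_two_le_of_le (by linarith) (by linarith)

lemma IsPreconnected.pos_of_ne_zero {s : Set ℝ} (hs : IsPreconnected s) {g : ℝ → ℝ}
    (hg : ContinuousOn g s) (hne : ∀ x ∈ s, g x ≠ 0) {a b : ℝ} (ha : a ∈ s) (hb : b ∈ s)
    (hpos : 0 < g a) : 0 < g b := by
  by_contra! h
  obtain ⟨x, hx, hx0⟩ := hs.intermediate_value hb ha hg ⟨h, hpos.le⟩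
  exact hne x hx hx0

/-- If the zeros of a `π`-antiperiodic continuous function lie, modulo `π`, in an open interval
of length `π / 2`, then up to `π`-translation they have a least and a greatest element, and the
function is positive on one complementary interval. -/
lemma exists_zeros_forall_Ioo_pos {g : ℝ → ℝ} (hg : Continuous g)
    (hanti : ∀ θ, g (θ + π) = -g θ) {δ : ℝ} (hδ : ∀ θ, g θ = 0 → 0 < Real.cos (2 * (θ - δ))) :
    ∃ l r, l ≤ r ∧ r < l + π / 2 ∧ g l = 0 ∧ g r = 0 ∧ ∀ θ ∈ Set.Ioo r (l + π), 0 < g θ := by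
  have hπ := pi_pos
  have hne : ∀ δ, (∀ θ, g θ = 0 → 0 < Real.cos (2 * (θ - δ))) →
      ∀ x ∈ Set.Icc (δ + π / 4) (δ + 3 * π / 4), g x ≠ 0 := fun δ hδ x hx h0 =>
    absurd (hδ x h0) (cos_two_mul_sub_nonpos hx.1 hx.2).not_gt
  obtain ⟨δ, hδ, hpos⟩ : ∃ δ, (∀ θ, g θ = 0 → 0 < Real.cos (2 * (θ - δ))) ∧
      0 < g (δ + π / 4) := by
    rcases lt_or_gt_of_ne (hne δ hδ (δ + π / 4) ⟨le_rfl, by linarith⟩) with h | h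
    · refine ⟨δ + π, fun θ h0 => ?_, ?_⟩
      · rw [show 2 * (θ - (δ + π)) = 2 * (θ - δ) - 2 * π by ring, Real.cos_sub_two_pi]
        exact hδ θ h0
      · rw [show δ + π + π / 4 = δ + π / 4 + π by ring, hanti]
        linarith
    · exact ⟨δ, hδ, h⟩
  have hpos' : 0 < g (δ + 3 * π / 4) :=
    isPreconnected_Icc.pos_of_ne_zero hg.continuousOn (hne δ hδ) (a := δ + π / 4)
      ⟨le_rfl, by linarith⟩ ⟨by linarith, le_rfl⟩ hpos
  have hneg : g (δ - π / 4) < 0 := by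
    have := hanti (δ - π / 4)
    rw [show δ - π / 4 + π = δ + 3 * π / 4 by ring] at this
    linarith
  set Z := Set.Icc (δ - π / 4) (δ + π / 4) ∩ g ⁻¹' {0} with hZ
  have hZc : IsCompact Z := isCompact_Icc.inter_right (isClosed_singleton.preimage hg)
  have hZn : Z.Nonempty := by
    obtain ⟨x, hx, h0⟩ := intermediate_value_Icc (by linarith : δ - π / 4 ≤ δ + π / 4)
      hg.continuousOn ⟨hneg.le, hpos.le⟩
    exact ⟨x, hx, h0⟩
  obtain ⟨l, ⟨hl, hl0⟩, hlmin⟩ := hZc.exists_isLeast hZn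
  obtain ⟨r, ⟨hr, hr0⟩, hrmax⟩ := hZc.exists_isGreatest hZn
  have hl0' : g l = 0 := hl0
  have hr0' : g r = 0 := hr0
  have hl' : δ - π / 4 < l := lt_of_le_of_ne hl.1 fun h => by rw [← h] at hl0'; linarith
  have hr' : r < δ + π / 4 := lt_of_le_of_ne hr.2 fun h => by rw [h] at hr0'; linarith
  refine ⟨l, r, hlmin ⟨hr, hr0⟩, by linarith, hl0', hr0', fun θ hθ => ?_⟩
  refine isPreconnected_Ioo.pos_of_ne_zero hg.continuousOn (fun x hx h0 => ?_)
    (a := δ + π / 4) ⟨hr', by linarith⟩ hθ hpos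
  rcases le_total x (δ + π / 4) with h1 | h1
  · exact absurd (hrmax ⟨⟨by linarith [hr.1, hx.1], h1⟩, h0⟩) hx.1.not_ge
  rcases le_total x (δ + 3 * π / 4) with h2 | h2
  · exact hne δ hδ x ⟨h1, h2⟩ h0
  · have h3 : g (x - π) = 0 := by
      have := hanti (x - π)
      rw [sub_add_cancel, h0] at this
      linarith
    have := hlmin ⟨⟨by linarith, by linarith [hx.2, hl.2]⟩, h3⟩
    linarith [hx.2]

/-- The arc excess on `[l, r]` and outside of it share a total variation of at most `2π`. -/
lemma arcExcess_sub_add_le_pi {T : ℝ → ℝ} (hTm : StrictMono T)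
    (hTper : ∀ θ, T (θ + 2 * π) = T θ + 2 * π) {l r a b p : ℝ} (hla : l ≤ a) (hab : a ≤ b)
    (hbr : b ≤ r) (hrp : r ≤ p) (hpl : p ≤ l + π) :
    arcExcess T a - arcExcess T b + arcExcess T p ≤ π := by
  have hper := hTper l
  have m1 := hTm.monotone hla
  have m2 := hTm.monotone hab
  have m3 := hTm.monotone hbr
  have m4 := hTm.monotone hrp
  have m5 := hTm.monotone hpl
  have n1 := hTm.monotone (add_le_add_left hla π)
  have n2 := hTm.monotone (add_le_add_left hab π)
  have n3 := hTm.monotone (add_le_add_left hbr π)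
  have n4 := hTm.monotone (add_le_add_left hrp π)
  have n5 := hTm.monotone (add_le_add_left hpl π)
  rw [show l + π + π = l + 2 * π by ring] at n5
  simp only [arcExcess]
  linarith

lemma sin_add_cos_le_sin_add_cos {h x : ℝ} (h0 : 0 ≤ h) (hx : h ≤ x) (hx' : x ≤ π / 2 - h) :
    Real.sin h + Real.cos h ≤ Real.sin x + Real.cos x := by
  have h1 : Real.sin ((x + h) / 2) ≤ Real.cos ((x + h) / 2) := by
    rw [← Real.sin_pi_div_two_sub]
    apply Real.sin_le_sin_of_le_of_le_pi_div_two <;> linarith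
  have h2 : 0 ≤ Real.sin ((x - h) / 2) :=
    Real.sin_nonneg_of_nonneg_of_le_pi (by linarith) (by linarith)
  have h3 := Real.sin_sub_sin x h
  have h4 := Real.cos_sub_cos x h
  nlinarith [mul_nonneg h2 (sub_nonneg.2 h1)]

/-- If the arc excess vanishes at `l` and `r`, is positive between `r` and `l + π`, and is at
least `q` on a quarter turn there, then the orthogonality to first harmonics bounds `q`. -/
lemma mul_sin_add_cos_le_of_arcExcess {T : ℝ → ℝ} (hTc : Continuous T) (hTm : StrictMono T)
    (hTper : ∀ θ, T (θ + 2 * π) = T θ + 2 * π)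
    (horth : ∀ α τ, ∫ θ in α..(α + π), arcExcess T θ * Real.sin (θ - τ) = 0)
    {l r p q y : ℝ} (hlr : l ≤ r) (hl : arcExcess T l = 0)
    (hr : arcExcess T r = 0) (hpos : ∀ θ ∈ Set.Ioo r (l + π), 0 < arcExcess T θ)
    (hrp : r ≤ p) (hpl : p ≤ l + π) (hq : 0 ≤ q) (hyl : y < l) (hry : r < y + π / 2)
    (hy : ∀ θ ∈ Set.Icc (y + π / 2) (y + π), q ≤ |arcExcess T θ|) :
    q * (Real.sin ((r - l) / 2) + Real.cos ((r - l) / 2)) ≤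
      (π - arcExcess T p) * (1 - Real.cos ((r - l) / 2)) := by
  have hπ := pi_pos
  obtain ⟨h, μ, hl_eq, hr_eq⟩ : ∃ h μ, l = μ - h ∧ r = μ + h :=
    ⟨(r - l) / 2, (l + r) / 2, by ring, by ring⟩
  have hh : (r - l) / 2 = h := by rw [hl_eq, hr_eq]; ring
  rw [hh]
  have hh0 : 0 ≤ h := by linarith
  have hgc : Continuous (arcExcess T) := by unfold arcExcess; fun_prop
  set f : ℝ → ℝ := fun θ => arcExcess T θ * Real.sin (θ - μ) with hf
  have hfc : Continuous f := by fun_prop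
  have hfi : ∀ a b, IntervalIntegrable f MeasureTheory.volume a b :=
    fun a b => hfc.intervalIntegrable a b
  have hl' : arcExcess T (l + π) = 0 := by rw [arcExcess_add_pi hTper, hl, neg_zero]
  have hnn : ∀ θ ∈ Set.Icc r (l + π), 0 ≤ f θ := by
    intro θ hθ
    refine mul_nonneg ?_ (Real.sin_nonneg_of_nonneg_of_le_pi (by linarith [hθ.1])
      (by linarith [hθ.2]))
    rcases hθ.1.eq_or_lt with h1 | h1
    · rw [← h1, hr]
    rcases hθ.2.eq_or_lt with h2 | h2
    · rw [h2, hl']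
    exact (hpos θ ⟨h1, h2⟩).le
  have htotal : (∫ θ in l..μ, f θ) + (∫ θ in μ..r, f θ) + (∫ θ in r..(y + π / 2), f θ) +
      (∫ θ in (y + π / 2)..(y + π), f θ) + (∫ θ in (y + π)..(l + π), f θ) = 0 := by
    rw [intervalIntegral.integral_add_adjacent_intervals (hfi _ _) (hfi _ _),
      intervalIntegral.integral_add_adjacent_intervals (hfi _ _) (hfi _ _),
      intervalIntegral.integral_add_adjacent_intervals (hfi _ _) (hfi _ _),
      intervalIntegral.integral_add_adjacent_intervals (hfi _ _) (hfi _ _)]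
    exact horth l μ
  have hi3 : 0 ≤ ∫ θ in r..(y + π / 2), f θ :=
    intervalIntegral.integral_nonneg hry.le fun θ hθ =>
      hnn θ ⟨hθ.1, by linarith [hθ.2]⟩
  have hi5 : 0 ≤ ∫ θ in (y + π)..(l + π), f θ :=
    intervalIntegral.integral_nonneg (by linarith) fun θ hθ =>
      hnn θ ⟨by linarith [hθ.1], hθ.2⟩
  have hi4 : q * (Real.sin (μ - y) + Real.cos (μ - y)) ≤
      ∫ θ in (y + π / 2)..(y + π), f θ := by
    have h1 : ∫ θ in (y + π / 2)..(y + π), q * Real.sin (θ - μ) =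
        q * (Real.sin (μ - y) + Real.cos (μ - y)) := by
      rw [intervalIntegral.integral_const_mul,
        intervalIntegral.integral_comp_sub_right (fun θ => Real.sin θ), integral_sin,
        show y + π / 2 - μ = π / 2 - (μ - y) by ring, show y + π - μ = π - (μ - y) by ring,
        Real.cos_pi_div_two_sub, Real.cos_pi_sub]
      ring
    rw [← h1]
    refine intervalIntegral.integral_mono_on (by linarith)
      (by apply Continuous.intervalIntegrable; fun_prop) (hfi _ _) fun θ hθ => ?_
    refine mul_le_mul_of_nonneg_right ?_ (Real.sin_nonneg_of_nonneg_of_le_pi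
      (by linarith [hθ.1]) (by linarith [hθ.2]))
    have := hy θ hθ
    rwa [abs_of_pos (hpos θ ⟨by linarith [hθ.1], by linarith [hθ.2]⟩)] at this
  have hi12 : -((π - arcExcess T p) * (1 - Real.cos h)) ≤
      (∫ θ in l..μ, f θ) + ∫ θ in μ..r, f θ := by
    have h1 : ∫ θ in l..μ, f θ = ∫ x in (0:ℝ)..h, f (μ - x) := by
      rw [intervalIntegral.integral_comp_sub_left f μ, hl_eq, sub_zero]
    have h2 : ∫ θ in μ..r, f θ = ∫ x in (0:ℝ)..h, f (μ + x) := by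
      rw [intervalIntegral.integral_comp_add_left f μ, hr_eq, add_zero]
    have h3 : ∫ x in (0:ℝ)..h, -(π - arcExcess T p) * Real.sin x =
        -((π - arcExcess T p) * (1 - Real.cos h)) := by
      rw [intervalIntegral.integral_const_mul, integral_sin, Real.cos_zero]
      ring
    rw [h1, h2, ← h3, ← intervalIntegral.integral_add
      (by apply Continuous.intervalIntegrable; fun_prop)
      (by apply Continuous.intervalIntegrable; fun_prop)]
    refine intervalIntegral.integral_mono_on hh0
      (by apply Continuous.intervalIntegrable; fun_prop)
      (by apply Continuous.intervalIntegrable; fun_prop) fun x hx => ?_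
    have h4 := arcExcess_sub_add_le_pi hTm hTper (a := μ - x) (b := μ + x)
      (by linarith [hx.2]) (by linarith [hx.1]) (by linarith [hx.2]) hrp hpl
    have h5 : 0 ≤ Real.sin x :=
      Real.sin_nonneg_of_nonneg_of_le_pi hx.1 (by linarith [hx.2])
    simp only [hf]
    rw [show μ - x - μ = -x by ring, show μ + x - μ = x by ring, Real.sin_neg]
    nlinarith [mul_nonneg h5 (sub_nonneg.2 h4)]
  have hsc := mul_le_mul_of_nonneg_left (sin_add_cos_le_sin_add_cos hh0
    (x := μ - y) (by linarith) (by linarith)) hq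
  linarith

lemma G_eq {Δ : ℝ} (hΔ : Δ ∈ Set.Ioo 0 (π / 2)) :
    G Δ = Real.sin (Δ / 4) ^ 2 / (Real.sin (Δ / 4) + Real.cos (Δ / 4)) ^ 2 := by
  have hs : 0 < Real.sin (Δ / 4) :=
    Real.sin_pos_of_pos_of_lt_pi (by linarith [hΔ.1]) (by linarith [hΔ.2, pi_pos])
  rw [G, Real.cot_eq_cos_div_sin, one_add_div hs.ne', div_pow, inv_div]

lemma sin_quarter_pos_and_lt_cos {Δ : ℝ} (hΔ : Δ ∈ Set.Ioo 0 (π / 2)) :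
    0 < Real.sin (Δ / 4) ∧ Real.sin (Δ / 4) < Real.cos (Δ / 4) := by
  refine ⟨Real.sin_pos_of_pos_of_lt_pi (by linarith [hΔ.1]) (by linarith [hΔ.2, pi_pos]), ?_⟩
  rw [← Real.sin_pi_div_two_sub]
  apply Real.sin_lt_sin_of_lt_of_le_pi_div_two <;> linarith [hΔ.1, hΔ.2, pi_pos]

lemma G_pos_and_lt {Δ : ℝ} (hΔ : Δ ∈ Set.Ioo 0 (π / 2)) : 0 < G Δ ∧ G Δ < 1 / 2 := by
  obtain ⟨hs, hsc⟩ := sin_quarter_pos_and_lt_cos hΔ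
  have hc := hs.trans hsc
  rw [G_eq hΔ]
  refine ⟨by positivity, ?_⟩
  rw [div_lt_iff₀ (by positivity)]
  nlinarith

/-- The factor `2 - sec²(Δ/2)` in `B₂`. -/
lemma two_sub_sec_sq_mem {Δ : ℝ} (hΔ : Δ ∈ Set.Ioo 0 (π / 2)) :
    0 < 2 - ((Real.cos (Δ / 2))⁻¹) ^ 2 ∧ 2 - ((Real.cos (Δ / 2))⁻¹) ^ 2 ≤ 1 ∧
      2 * Real.cos Δ = (2 - ((Real.cos (Δ / 2))⁻¹) ^ 2) * (1 + Real.cos Δ) := by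
  have hcΔ : 0 < Real.cos Δ :=
    Real.cos_pos_of_mem_Ioo ⟨by linarith [hΔ.1, pi_pos], hΔ.2⟩
  have hc : 0 < Real.cos (Δ / 2) :=
    Real.cos_pos_of_mem_Ioo ⟨by linarith [hΔ.1, pi_pos], by linarith [hΔ.1, hΔ.2]⟩
  have hd : Real.cos Δ = 2 * Real.cos (Δ / 2) ^ 2 - 1 := by
    rw [← Real.cos_two_mul]; ring_nf
  have heq : 2 * Real.cos Δ = (2 - ((Real.cos (Δ / 2))⁻¹) ^ 2) * (1 + Real.cos Δ) := by
    rw [hd]; field_simp; ring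
  refine ⟨?_, ?_, heq⟩
  · by_contra! h
    nlinarith
  · have h1 : 1 ≤ (Real.cos (Δ / 2))⁻¹ := (one_le_inv₀ hc).2 (Real.cos_le_one _)
    nlinarith

/-- For every `Δ` the two bounds agree at some positive `ν`. -/
lemma exists_B₁_eq_B₂ {Δ : ℝ} (hΔ : Δ ∈ Set.Ioo 0 (π / 2)) :
    ∃ ν ∈ Set.Ioc (0:ℝ) 1, B₁ ν Δ = B₂ ν Δ := by
  obtain ⟨hG0, hG1⟩ := G_pos_and_lt hΔ
  obtain ⟨hw0, hw1, -⟩ := two_sub_sec_sq_mem hΔ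
  have h0 : B₂ 0 Δ - B₁ 0 Δ < 0 := by
    simp only [B₁, B₂]
    rw [inv_pow] at hw0 ⊢
    norm_num
    linarith
  have h1 : 0 ≤ B₂ 1 Δ - B₁ 1 Δ := by
    simp only [B₁, B₂]
    rw [show 2 + 2 * 1 * G Δ - 1 = 1 + 2 * 1 * G Δ by ring]
    have : ((1 + 2 * 1 * G Δ) ^ 2)⁻¹ ≤ 1 := inv_le_one_of_one_le₀ (by nlinarith)
    nlinarith
  have hc : ContinuousOn (fun ν => B₂ ν Δ - B₁ ν Δ) (Set.Icc 0 1) := by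
    unfold B₁ B₂
    refine ContinuousOn.sub ?_ (ContinuousOn.inv₀ (by fun_prop) fun ν hν => ?_)
    · refine continuousOn_const.sub (continuousOn_const.mul (continuousOn_const.sub
        (ContinuousOn.inv₀ (by fun_prop) fun ν hν => ?_)))
      have : 0 < 2 + 2 * ν * G Δ - ν := by nlinarith [hν.1, hν.2]
      positivity
    · have := hν.1
      positivity
  obtain ⟨ν, hν, hν0⟩ := intermediate_value_Icc zero_le_one hc ⟨h0.le, h1⟩
  refine ⟨ν, ⟨lt_of_le_of_ne hν.1 ?_, hν.2⟩, ?_⟩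
  · rintro rfl
    exact h0.ne hν0
  · simp only at hν0
    linarith

lemma B₁_lt_one {ν Δ : ℝ} (hν : 0 < ν) (hΔ : Δ ∈ Set.Ioo 0 (π / 2)) : B₁ ν Δ < 1 := by
  have := mul_pos hν (G_pos_and_lt hΔ).1
  exact inv_lt_one_of_one_lt₀ (by nlinarith)

/-- Two quadratic forms on the plane, with traces `N` and `D`, are given as functions of the
direction. If the first dominates the positive second one in the directions `μ ± h` but has small
trace, then it is less than `κ` times the second one in the direction orthogonal to `μ`. -/
lemma lt_of_le_B₂_mul {N D c₁ d₁ c₂ d₂ μ h κ w : ℝ}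
    (hcos : 0 < Real.cos (2 * h))
    (hw : 2 * Real.cos (2 * h) = w * (1 + Real.cos (2 * h)))
    (hMD : ∀ θ, 0 < D / 2 + c₂ * Real.cos (2 * θ) + d₂ * Real.sin (2 * θ))
    (hl : D / 2 + c₂ * Real.cos (2 * (μ - h)) + d₂ * Real.sin (2 * (μ - h)) ≤
      N / 2 + c₁ * Real.cos (2 * (μ - h)) + d₁ * Real.sin (2 * (μ - h)))
    (hr : D / 2 + c₂ * Real.cos (2 * (μ + h)) + d₂ * Real.sin (2 * (μ + h)) ≤
      N / 2 + c₁ * Real.cos (2 * (μ + h)) + d₁ * Real.sin (2 * (μ + h)))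
    (hN : N ≤ (1 - w * (1 - κ)) * D) (hκ : κ < 1) :
    N / 2 + c₁ * Real.cos (2 * (μ + π / 2)) + d₁ * Real.sin (2 * (μ + π / 2)) <
      κ * (D / 2 + c₂ * Real.cos (2 * (μ + π / 2)) + d₂ * Real.sin (2 * (μ + π / 2))) := by
  have hM := hMD μ
  have e1 : Real.cos (2 * (μ + π / 2)) = -Real.cos (2 * μ) := by
    rw [show 2 * (μ + π / 2) = 2 * μ + π by ring, Real.cos_add_pi]
  have e2 : Real.sin (2 * (μ + π / 2)) = -Real.sin (2 * μ) := by
    rw [show 2 * (μ + π / 2) = 2 * μ + π by ring, Real.sin_add_pi]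
  rw [mul_sub, Real.cos_sub, Real.sin_sub] at hl
  rw [mul_add, Real.cos_add, Real.sin_add] at hr
  rw [e1, e2]
  set C := Real.cos (2 * h)
  set A₁ := c₁ * Real.cos (2 * μ) + d₁ * Real.sin (2 * μ) with hA₁
  set A₂ := c₂ * Real.cos (2 * μ) + d₂ * Real.sin (2 * μ) with hA₂
  have hM' : 0 < D / 2 + A₂ := by linarith
  have hlr : 0 ≤ (N - D) / 2 + (A₁ - A₂) * C := by
    simp only [hA₁, hA₂]
    linarith
  by_contra! hcon
  have hp : κ * (D / 2 - A₂) ≤ N / 2 - A₁ := by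
    simp only [hA₁, hA₂]
    linarith
  -- combine the two inequalities and use that the component at `μ` is nonzero
  have h1 : -((1 - κ) * (D / 2 - A₂)) * C ≤ ((N - D) / 2 - (A₁ - A₂)) * C :=
    mul_le_mul_of_nonneg_right (by linarith) hcos.le
  have h2 : N - D ≤ -(w * (1 - κ) * D) := by linarith
  have h3 := mul_le_mul_of_nonneg_right h2 (by linarith : 0 ≤ 1 + C)
  have h4 : -(w * (1 - κ) * D) * (1 + C) = -(2 * C * (1 - κ) * D) := by
    rw [hw]; ring
  have h5 : 0 < C * (1 - κ) * (D / 2 + A₂) := by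
    have := sub_pos.2 hκ
    positivity
  nlinarith

/-- For every test function `ψ`, the Rayleigh quotient `E(φ,ψ)` exceeds the infimum of
`max(B₁(ν̃,Δ), B₂(ν̃,Δ))` over `ν̃ ∈ [0,1]` and `Δ ∈ (0,π/2)`. -/
theorem rayleigh_gt_inf_max_B1_B2 (φ ψ : ℝ → ℝ)
    (hφ : ContDiff ℝ (⊤ : ℕ∞) φ)
    (hφ' : ∀ s, 0 < deriv φ s)
    (hφper : ∀ s, φ (s + 2 * π) = φ s + 2 * π)
    (hclose_cos : (∫ s in (0:ℝ)..(2 * π), Real.cos (φ s)) = 0)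
    (hclose_sin : (∫ s in (0:ℝ)..(2 * π), Real.sin (φ s)) = 0)
    (hψ : ContDiff ℝ 1 ψ)
    (hψper : ∀ s, ψ (s + 2 * π) = ψ s)
    (hψpos : 0 < ∫ s in (0:ℝ)..(2 * π), ψ s ^ 2) :
    (∫ s in (0:ℝ)..(2 * π), (deriv ψ s ^ 2 + deriv φ s ^ 2 * ψ s ^ 2)) /
        (∫ s in (0:ℝ)..(2 * π), ψ s ^ 2) >
      sInf {r : ℝ | ∃ ν Δ : ℝ, ν ∈ Set.Icc (0 : ℝ) 1 ∧ Δ ∈ Set.Ioo (0 : ℝ) (π / 2) ∧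
        r = max (B₁ ν Δ) (B₂ ν Δ)} := by
  have hπ := pi_pos
  by_contra! hcon
  obtain ⟨T, T', hφT, hTm, hTper, hTd, hT'⟩ := exists_inverse_tangentAngle hφ hφ' hφper
  have hTc : Continuous T := continuous_iff_continuousAt.2 fun x => (hTd x).continuousAt
  have horth := integral_arcExcess_mul_sin_eq_zero hφ.continuous hφper hclose_cos hclose_sin
    hφT hTper hTd hT'
  have hwirt := sq_mul_integral_component_sq_le hφ hφper hψ hψper hφT hTm hTper
  have hMpos := integral_component_sq_pos hφ.continuous (strictMono_of_deriv_pos hφ')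
    hψ.continuous hψpos
  obtain ⟨c₁, d₁, hI⟩ := exists_integral_componentDeriv_sq_eq hφ hψ
  obtain ⟨c₂, d₂, hM⟩ := exists_integral_component_sq_eq hφ.continuous hψ.continuous
  simp only [hI, hM] at hwirt hMpos
  set N := ∫ s in (0:ℝ)..(2 * π), (deriv ψ s ^ 2 + deriv φ s ^ 2 * ψ s ^ 2)
  set D := ∫ s in (0:ℝ)..(2 * π), ψ s ^ 2
  clear hI hM
  set I : ℝ → ℝ := fun θ => N / 2 + c₁ * Real.cos (2 * θ) + d₁ * Real.sin (2 * θ) with hIdef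
  set M : ℝ → ℝ := fun θ => D / 2 + c₂ * Real.cos (2 * θ) + d₂ * Real.sin (2 * θ) with hMdef
  replace hwirt : ∀ θ, (π / (π + |arcExcess T θ|)) ^ 2 * M θ ≤ I θ := hwirt
  replace hMpos : ∀ θ, 0 < M θ := hMpos
  have hND : ∀ {ν Δ : ℝ}, ν ∈ Set.Ioc (0:ℝ) 1 → Δ ∈ Set.Ioo 0 (π / 2) → B₁ ν Δ = B₂ ν Δ →
      N ≤ B₁ ν Δ * D := by
    intro ν Δ hν hΔ heq
    rw [← div_le_iff₀ hψpos]
    refine hcon.trans (csInf_le ⟨0, ?_⟩ ⟨ν, Δ, ⟨hν.1.le, hν.2⟩, hΔ, by rw [← heq, max_self]⟩)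
    rintro x ⟨ν', Δ', -, -, rfl⟩
    exact le_max_of_le_left (inv_nonneg.2 (sq_nonneg _))
  have hND1 : N < D := by
    have hΔ : (1:ℝ) ∈ Set.Ioo 0 (π / 2) := ⟨one_pos, by linarith [pi_gt_three]⟩
    obtain ⟨ν, hν, heq⟩ := exists_B₁_eq_B₂ hΔ
    nlinarith [hND hν hΔ heq, B₁_lt_one hν.1 hΔ]
  have hgc : Continuous (arcExcess T) := by unfold arcExcess; fun_prop
  have hzero : ∀ θ, arcExcess T θ = 0 → M θ ≤ I θ := by
    intro θ h
    have := hwirt θ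
    rwa [h, abs_zero, add_zero, div_self hπ.ne', one_pow, one_mul] at this
  -- the zeros of the arc excess lie in a short interval
  obtain ⟨δ, hδ⟩ := exists_forall_pos_imp_cos_pos (c₁ - c₂) (d₁ - d₂)
  obtain ⟨l, r, hlr, hrl, hl0, hr0, hpos⟩ := exists_zeros_forall_Ioo_pos hgc
    (arcExcess_add_pi hTper) (δ := δ) fun θ h => hδ θ (by
      have := hzero θ h
      simp only [hIdef, hMdef] at this
      linarith)
  have hlr' : l < r := by
    refine lt_of_le_of_ne hlr fun h => ?_
    subst h
    refine (intervalIntegral.intervalIntegral_pos_of_pos_on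
      (by apply Continuous.intervalIntegrable; fun_prop) (fun θ hθ => ?_)
      (by linarith : l < l + π)).ne' (horth l l)
    exact mul_pos (hpos θ hθ) (Real.sin_pos_of_pos_of_lt_pi (by linarith [hθ.1])
      (by linarith [hθ.2]))
  have hΔ : r - l ∈ Set.Ioo 0 (π / 2) := ⟨by linarith, by linarith⟩
  obtain ⟨ν, hν, heq⟩ := exists_B₁_eq_B₂ hΔ
  have hNB := hND hν hΔ heq
  obtain ⟨hG0, hG1⟩ := G_pos_and_lt hΔ
  have hνG := mul_pos hν.1 hG0
  set p := (l + r) / 2 + π / 2 with hp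
  have hrp : r < p := by linarith
  have hpl : p < l + π := by linarith
  have hgp : 0 < arcExcess T p := hpos p ⟨hrp, hpl⟩
  set q := 2 * π * (ν * G (r - l)) with hq
  have hq0 : 0 < q := by positivity
  rcases le_or_gt (arcExcess T p) (π * (1 - ν) + q) with hB | hB
  · -- the component orthogonal to the bisector has a large Rayleigh quotient
    obtain ⟨-, -, hw⟩ := two_sub_sec_sq_mem hΔ
    have h2h : 2 * ((r - l) / 2) = r - l := by ring
    have hden : 1 < 2 + 2 * ν * G (r - l) - ν := by linarith [hν.2]
    have hlm : (l + r) / 2 - (r - l) / 2 = l := by ring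
    have hrm : (l + r) / 2 + (r - l) / 2 = r := by ring
    have hlt := lt_of_le_B₂_mul (N := N) (D := D) (c₁ := c₁) (d₁ := d₁) (c₂ := c₂) (d₂ := d₂)
      (μ := (l + r) / 2) (h := (r - l) / 2) (w := 2 - ((Real.cos ((r - l) / 2))⁻¹) ^ 2)
      (κ := ((2 + 2 * ν * G (r - l) - ν) ^ 2)⁻¹)
      (by rw [h2h]; exact Real.cos_pos_of_mem_Ioo ⟨by linarith, hΔ.2⟩)
      (by rw [h2h]; exact hw) hMpos (by rw [hlm]; exact hzero l hl0)
      (by rw [hrm]; exact hzero r hr0) (by rw [heq] at hNB; exact hNB)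
      (inv_lt_one_of_one_lt₀ (by nlinarith))
    refine (lt_of_lt_of_le hlt ?_).not_ge (hwirt p)
    refine mul_le_mul_of_nonneg_right ?_ (hMpos p).le
    rw [← inv_pow, ← one_div]
    have hstep : 1 / (2 + 2 * ν * G (r - l) - ν) ≤ π / (π + |arcExcess T p|) := by
      rw [abs_of_pos hgp, div_le_div_iff₀ (by linarith) (by linarith)]
      nlinarith
    exact pow_le_pow_left₀ (by positivity) hstep 2
  · -- otherwise the arc excess is at least `q` on a quarter turn
    set lam := B₁ ν (r - l) with hlam
    have hlam_eq : lam = (π / (π + q)) ^ 2 := by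
      rw [hlam, B₁, hq, ← inv_pow]
      congr 1
      field_simp
    obtain ⟨δ', hδ'⟩ := exists_forall_pos_imp_cos_pos (c₁ - lam * c₂) (d₁ - lam * d₂)
    have hsmall : ∀ θ, |arcExcess T θ| < q → 0 < Real.cos (2 * (θ - δ')) := by
      intro θ h
      refine hδ' θ ?_
      have h1 : lam < (π / (π + |arcExcess T θ|)) ^ 2 := by
        rw [hlam_eq]
        have := abs_nonneg (arcExcess T θ)
        gcongr
      have h2 := (mul_lt_mul_of_pos_right h1 (hMpos θ)).trans_le (hwirt θ)
      simp only [hIdef, hMdef] at h2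
      linarith
    have hshift : ∀ (n : ℤ) θ, Real.cos (2 * (θ - (δ' + n * π))) = Real.cos (2 * (θ - δ')) := by
      intro n θ
      rw [show 2 * (θ - (δ' + n * π)) = 2 * (θ - δ') - n * (2 * π) by ring,
        Real.cos_sub_int_mul_two_pi]
    obtain ⟨δ₀, hδ₀, hδ₀l, hδ₀l'⟩ : ∃ δ₀, (∀ θ, |arcExcess T θ| < q →
        0 < Real.cos (2 * (θ - δ₀))) ∧ δ₀ - π / 4 ≤ l ∧ l < δ₀ + 3 * π / 4 := by
      refine ⟨δ' + ⌊(l - δ' + π / 4) / π⌋ * π, fun θ h => by rw [hshift]; exact hsmall θ h,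
        ?_, ?_⟩
      · have := (le_div_iff₀ hπ).1 (Int.floor_le ((l - δ' + π / 4) / π))
        linarith
      · have := (div_lt_iff₀ hπ).1 (Int.lt_floor_add_one ((l - δ' + π / 4) / π))
        linarith
    have hlcos := hδ₀ l (by rwa [hl0, abs_zero])
    have hrcos := hδ₀ r (by rwa [hr0, abs_zero])
    have hl1 : l < δ₀ + π / 4 := by
      by_contra! h
      exact hlcos.not_ge (cos_two_mul_sub_nonpos h hδ₀l'.le)
    have hl2 : δ₀ - π / 4 < l := by
      refine lt_of_le_of_ne hδ₀l fun h => ?_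
      rw [← h, show 2 * (δ₀ - π / 4 - δ₀) = -(π / 2) by ring, Real.cos_neg,
        Real.cos_pi_div_two] at hlcos
      exact hlcos.false
    have hr1 : r < δ₀ + π / 4 := by
      by_contra! h
      exact hrcos.not_ge (cos_two_mul_sub_nonpos h (by linarith))
    have hfinal := mul_sin_add_cos_le_of_arcExcess hTc hTm hTper horth (q := q)
      (y := δ₀ - π / 4) hlr hl0 hr0 hpos hrp.le hpl.le hq0.le hl2 (by linarith)
      fun θ hθ => by
        by_contra! h
        exact (hδ₀ θ h).not_ge
          (cos_two_mul_sub_nonpos (by linarith [hθ.1]) (by linarith [hθ.2]))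
    obtain ⟨hs, hsc⟩ := sin_quarter_pos_and_lt_cos hΔ
    have hGeq := G_eq hΔ
    have hc := hs.trans hsc
    have hsin : Real.sin ((r - l) / 2) = 2 * Real.sin ((r - l) / 4) * Real.cos ((r - l) / 4) := by
      rw [← Real.sin_two_mul]; ring_nf
    have hcos : Real.cos ((r - l) / 2) = 1 - 2 * Real.sin ((r - l) / 4) ^ 2 := by
      rw [← Real.cos_two_mul_eq_one_sub]; ring_nf
    have hone := Real.sin_sq_add_cos_sq ((r - l) / 4)
    rw [hsin, hcos] at hfinal
    set s := Real.sin ((r - l) / 4)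
    set c := Real.cos ((r - l) / 4)
    have hqs : q * (s + c) ^ 2 = 2 * π * ν * s ^ 2 := by
      rw [hq, hGeq]
      field_simp
    have hs2 : 0 < s ^ 2 := by positivity
    nlinarith [mul_pos hs2 (sub_pos.2 hB)]
end

section
/- For every ν̃ ∈ [0,1] and every Δ ∈ (0, π/2), max(B₁(ν̃,Δ), B₂(ν̃,Δ)) > 0.81. -/
open Real

/-- An interval bound on `(1 - q²)(1 - w⁻²)`, where `q = tan (Δ/2)` is written in terms of
`s = √G` and `w = 2 + 2νs² - ν`. -/
lemma one_sub_sq_mul_lt_of_mem_Icc {a b A W s q ν : ℝ} (ha : 0 ≤ a) (has : a ≤ s) (hsb : s ≤ b)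
    (hs : s < 1 / 2) (hν0 : 0 ≤ ν) (hν1 : ν ≤ 1) (hνs : 1 / 18 ≤ ν * s ^ 2)
    (hq : q * (1 - 2 * s) = 2 * s * (1 - s)) (hq0 : 0 ≤ q) (hq1 : q ≤ 1) (hA0 : 0 ≤ A)
    (hA : A * (1 - 2 * a) ≤ 2 * a * (1 - a)) (hb : b ^ 2 ≤ 1 / 2)
    (hW : 1 - 2 * b ^ 2 ≥ (2 - W) * (18 * b ^ 2))
    (hAW : (1 - A ^ 2) * (1 - (W ^ 2)⁻¹) < 0.19) :
    (1 - q ^ 2) * (1 - ((2 + 2 * ν * s ^ 2 - ν) ^ 2)⁻¹) < 0.19 := by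
  have hs2 : s ^ 2 ≤ b ^ 2 := by gcongr; linarith
  have hAq : A ≤ q := by
    have hsa : 2 * a * (1 - a) * (1 - 2 * s) ≤ 2 * s * (1 - s) * (1 - 2 * a) := by
      nlinarith [mul_nonneg (sub_nonneg.2 has) (by nlinarith : 0 ≤ 1 - a - s + 2 * a * s)]
    have h1 : 0 < (1 - 2 * s) * (1 - 2 * a) := mul_pos (by linarith) (by linarith)
    refine le_of_mul_le_mul_right ?_ h1
    nlinarith [mul_le_mul_of_nonneg_right hA (by linarith : 0 ≤ 1 - 2 * s)]
  have hνb : 1 ≤ 18 * b ^ 2 * ν := by nlinarith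
  have hb0 : 0 < b ^ 2 := by nlinarith
  have hw1 : 1 ≤ 2 + 2 * ν * s ^ 2 - ν := by nlinarith
  have hwW : 2 + 2 * ν * s ^ 2 - ν ≤ W := by
    have h1 : 2 + 2 * ν * s ^ 2 - ν ≤ 2 - ν * (1 - 2 * b ^ 2) := by nlinarith
    have h2 : 2 - W ≤ ν * (1 - 2 * b ^ 2) := by
      refine le_of_mul_le_mul_right ?_ (by positivity : 0 < 18 * b ^ 2)
      nlinarith [mul_le_mul_of_nonneg_right hνb (by linarith : 0 ≤ 1 - 2 * b ^ 2)]
    linarith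
  refine lt_of_le_of_lt ?_ hAW
  have hinv : ((2 + 2 * ν * s ^ 2 - ν) ^ 2)⁻¹ ≤ 1 := inv_le_one_of_one_le₀ (one_le_pow₀ hw1)
  have hq2 : q ^ 2 ≤ 1 := pow_le_one₀ hq0 hq1
  have hAq2 : A ^ 2 ≤ q ^ 2 := by gcongr
  apply mul_le_mul
  · linarith
  · gcongr
  · linarith
  · linarith

lemma one_sub_sq_mul_lt {s q ν : ℝ} (hs0 : 0 ≤ s) (hs : s < 1 / 2) (hν0 : 0 ≤ ν) (hν1 : ν ≤ 1)
    (hνs : 1 / 18 ≤ ν * s ^ 2) (hq : q * (1 - 2 * s) = 2 * s * (1 - s)) (hq0 : 0 ≤ q) :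
    (1 - q ^ 2) * (1 - ((2 + 2 * ν * s ^ 2 - ν) ^ 2)⁻¹) < 0.19 := by
  rcases le_total q 1 with hq1 | hq1
  · have hlo : 0.2357 ≤ s := by nlinarith
    have hhi : s ≤ 0.293 := by nlinarith
    rcases le_total s 0.245 with h1 | h1
    · exact one_sub_sq_mul_lt_of_mem_Icc (A := 0.681) (W := 1.187) (by norm_num) hlo h1 hs hν0 hν1
        hνs hq hq0 hq1 (by norm_num) (by norm_num) (by norm_num) (by norm_num) (by norm_num)
    rcases le_total s 0.253 with h2 | h2
    · exact one_sub_sq_mul_lt_of_mem_Icc (A := 0.725) (W := 1.245) (by norm_num) h1 h2 hs hν0 hν1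
        hνs hq hq0 hq1 (by norm_num) (by norm_num) (by norm_num) (by norm_num) (by norm_num)
    rcases le_total s 0.264 with h3 | h3
    · exact one_sub_sq_mul_lt_of_mem_Icc (A := 0.765) (W := 1.315) (by norm_num) h2 h3 hs hν0 hν1
        hνs hq hq0 hq1 (by norm_num) (by norm_num) (by norm_num) (by norm_num) (by norm_num)
    · exact one_sub_sq_mul_lt_of_mem_Icc (A := 0.823) (W := 1.465) (by norm_num) h3 hhi hs hν0 hν1
        hνs hq hq0 hq1 (by norm_num) (by norm_num) (by norm_num) (by norm_num) (by norm_num)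
  · have hw1 : 1 ≤ 2 + 2 * ν * s ^ 2 - ν := by nlinarith
    have hinv : ((2 + 2 * ν * s ^ 2 - ν) ^ 2)⁻¹ ≤ 1 := inv_le_one_of_one_le₀ (one_le_pow₀ hw1)
    have hq2 : 1 ≤ q ^ 2 := one_le_pow₀ hq1
    have := mul_nonneg (sub_nonneg.2 hq2) (sub_nonneg.2 hinv)
    norm_num
    nlinarith

lemma G_eq_tan_div_sq {Δ : ℝ} (h : 0 < tan (Δ / 4)) :
    G Δ = (tan (Δ / 4) / (1 + tan (Δ / 4))) ^ 2 := by
  rw [G, ← Real.tan_inv_eq_cot]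
  field_simp
  ring

theorem max_B1_B2_gt (ν Δ : ℝ) (hν : ν ∈ Set.Icc (0 : ℝ) 1)
    (hΔ : Δ ∈ Set.Ioo (0 : ℝ) (π / 2)) :
    max (B₁ ν Δ) (B₂ ν Δ) > 0.81 := by
  obtain ⟨hν0, hν1⟩ := hν
  obtain ⟨hΔ0, hΔ1⟩ := hΔ
  have ht0 : 0 < tan (Δ / 4) := tan_pos_of_pos_of_lt_pi_div_two (by linarith) (by linarith)
  have ht1 : tan (Δ / 4) < 1 := by
    rw [← tan_pi_div_four]
    exact tan_lt_tan_of_lt_of_lt_pi_div_two (by linarith) (by linarith) (by linarith)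
  have hq0 : 0 < tan (Δ / 2) := tan_pos_of_pos_of_lt_pi_div_two (by linarith) (by linarith)
  have hq : tan (Δ / 2) = 2 * tan (Δ / 4) / (1 - tan (Δ / 4) ^ 2) := by
    rw [← tan_two_mul]
    congr 1
    ring
  have hcos : cos (Δ / 2) ≠ 0 := (cos_pos_of_mem_Ioo ⟨by linarith, by linarith⟩).ne'
  have hsec : ((cos (Δ / 2))⁻¹) ^ 2 = 1 + tan (Δ / 2) ^ 2 := by
    rw [inv_pow, ← inv_one_add_tan_sq hcos, inv_inv]
  have hG := G_eq_tan_div_sq ht0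
  set t := tan (Δ / 4)
  set q := tan (Δ / 2)
  rw [gt_iff_lt, lt_max_iff]
  by_cases hνG : ν * G Δ < 1 / 18
  · left
    have hνG0 : 0 ≤ ν * G Δ := by rw [hG]; positivity
    rw [B₁, lt_inv_comm₀ (by norm_num) (pow_pos (by linarith) 2)]
    norm_num
    nlinarith
  · right
    rw [not_lt, hG] at hνG
    have hqs : q * (1 - 2 * (t / (1 + t))) = 2 * (t / (1 + t)) * (1 - t / (1 + t)) := by
      have : 1 - t ^ 2 ≠ 0 := by nlinarith
      rw [hq]
      field_simp
      ring
    have hs : t / (1 + t) < 1 / 2 := by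
      rw [div_lt_div_iff₀ (by linarith) (by norm_num)]
      linarith
    have := one_sub_sq_mul_lt (by positivity) hs hν0 hν1 hνG hqs hq0.le
    rw [B₂, hsec, hG, show 2 - (1 + q ^ 2) = 1 - q ^ 2 by ring]
    norm_num at this ⊢
    linarith
end

section
/- For every test function ψ, the Rayleigh quotient satisfies E(φ,ψ) > 0.81. (Hence the lowest eigenvalue λ_Γ of the Schrödinger operator −d²/ds² + κ(s)² with periodic boundary conditions exceeds 0.81.) -/
open Real

theorem dirichlet_poincare_of_lt {h : ℝ → ℝ} (hh : ContDiff ℝ 1 h) {a b q : ℝ} (hab : a < b)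
    (ha : h a = 0) (hb : h b = 0) (hq : 0 < q) (hq' : q < π / (b - a)) :
    q ^ 2 * ∫ x in a..b, h x ^ 2 ≤ ∫ x in a..b, deriv h x ^ 2 := by
  have hba : 0 < b - a := sub_pos.2 hab
  have hqb : q * (b - a) < π := (lt_div_iff₀ hba).1 hq'
  set θ : ℝ → ℝ := fun x => q * (x - (a + b) / 2) with hθ
  have hcos : ∀ x ∈ Set.uIcc a b, cos (θ x) ≠ 0 := by
    intro x hx
    rw [Set.uIcc_of_le hab.le] at hx
    refine (cos_pos_of_mem_Ioo ⟨?_, ?_⟩).ne'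
    · simp only [hθ]; nlinarith [hx.1]
    · simp only [hθ]; nlinarith [hx.2]
  have hd : Continuous (deriv h) := hh.continuous_deriv le_rfl
  have hc : Continuous h := hh.continuous
  have hθc : Continuous θ := by fun_prop
  have htan : ContinuousOn (fun x => tan (θ x)) (Set.uIcc a b) := fun x hx =>
    ((continuousAt_tan.2 (hcos x hx)).comp (f := θ) hθc.continuousAt).continuousWithinAt
  have hF : ∀ x ∈ Set.uIcc a b, HasDerivAt (fun x => q * tan (θ x) * h x ^ 2)
      ((deriv h x + q * tan (θ x) * h x) ^ 2 + q ^ 2 * h x ^ 2 - deriv h x ^ 2) x := by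
    intro x hx
    have h1 : HasDerivAt θ q x := by
      simpa [hθ] using ((hasDerivAt_id x).sub_const ((a + b) / 2)).const_mul q
    have h2 := ((hasDerivAt_tan (hcos x hx)).comp x h1).const_mul q
    have h3 := (hh.differentiable one_ne_zero x).hasDerivAt
    refine (h2.mul (h3.pow 2)).congr_deriv ?_
    have h4 : 1 / cos (θ x) ^ 2 = 1 + tan (θ x) ^ 2 := by
      rw [one_div, ← inv_one_add_tan_sq (hcos x hx), inv_inv]
    simp only [Function.comp_apply, Pi.pow_apply]
    rw [h4]
    push_cast
    ring
  have hsq : ContinuousOn (fun x => (deriv h x + q * tan (θ x) * h x) ^ 2) (Set.uIcc a b) :=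
    (hd.continuousOn.add ((htan.const_mul q |>.congr fun _ _ => rfl).mul hc.continuousOn)).pow 2
  have key := intervalIntegral.integral_eq_sub_of_hasDerivAt hF
    (ContinuousOn.intervalIntegrable
      ((hsq.add (by fun_prop)).sub (by fun_prop)))
  rw [intervalIntegral.integral_sub, intervalIntegral.integral_add,
    intervalIntegral.integral_const_mul, ha, hb] at key
  · have : 0 ≤ ∫ x in a..b, (deriv h x + q * tan (θ x) * h x) ^ 2 :=
      intervalIntegral.integral_nonneg hab.le fun x _ => sq_nonneg _
    linarith
  · exact hsq.intervalIntegrable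
  · exact Continuous.intervalIntegrable (by fun_prop) _ _
  · exact ContinuousOn.intervalIntegrable (hsq.add (by fun_prop))
  · exact Continuous.intervalIntegrable (by fun_prop) _ _

/-- The Poincaré inequality with Dirichlet boundary conditions on an interval. -/
theorem dirichlet_poincare {h : ℝ → ℝ} (hh : ContDiff ℝ 1 h) {a b : ℝ} (hab : a < b)
    (ha : h a = 0) (hb : h b = 0) :
    (π / (b - a)) ^ 2 * ∫ x in a..b, h x ^ 2 ≤ ∫ x in a..b, deriv h x ^ 2 := by
  have hpos : 0 < π / (b - a) := div_pos pi_pos (sub_pos.2 hab)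
  have hlim : Filter.Tendsto (fun q => q ^ 2 * ∫ x in a..b, h x ^ 2)
      (nhdsWithin (π / (b - a)) (Set.Iio (π / (b - a))))
      (nhds ((π / (b - a)) ^ 2 * ∫ x in a..b, h x ^ 2)) :=
    (Continuous.tendsto (by fun_prop) _).mono_left nhdsWithin_le_nhds
  refine le_of_tendsto hlim ?_
  filter_upwards [self_mem_nhdsWithin, nhdsWithin_le_nhds (lt_mem_nhds hpos)] with q hq hq0
  exact dirichlet_poincare_of_lt hh hab ha hb hq0 hq

theorem fourierCoeffOn_two_pi_eq {g : ℝ → ℝ} (hg : Continuous g) (n : ℤ) :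
    fourierCoeffOn two_pi_pos (fun x => (g x : ℂ)) n =
      (1 / (2 * π)) • (((∫ x in (0:ℝ)..(2 * π), g x * cos (n * x) : ℝ) : ℂ) -
        Complex.I * ((∫ x in (0:ℝ)..(2 * π), g x * sin (n * x) : ℝ) : ℂ)) := by
  rw [fourierCoeffOn_eq_integral, sub_zero, ← intervalIntegral.integral_ofReal,
    ← intervalIntegral.integral_ofReal, ← intervalIntegral.integral_const_mul,
    ← intervalIntegral.integral_sub]
  · congr 1
    refine intervalIntegral.integral_congr fun x _ => ?_
    have : (2 * π * Complex.I * ((-n : ℤ) : ℂ) * x / ((2 * π : ℝ) : ℂ)) =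
        ((-(n * x) : ℝ) : ℂ) * Complex.I := by
      have : (π : ℂ) ≠ 0 := by exact_mod_cast pi_ne_zero
      push_cast
      field_simp
    simp only [fourier_coe_apply, smul_eq_mul]
    rw [this, Complex.exp_mul_I, ← Complex.ofReal_cos, ← Complex.ofReal_sin, cos_neg, sin_neg]
    push_cast
    ring
  · exact Continuous.intervalIntegrable (by fun_prop) _ _
  · exact Continuous.intervalIntegrable (by fun_prop) _ _

theorem hasSum_sq_fourierCoeffOn_two_pi {g : ℝ → ℝ} (hg : Continuous g) :
    HasSum (fun n : ℤ => ‖fourierCoeffOn two_pi_pos (fun x => (g x : ℂ)) n‖ ^ 2)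
      ((2 * π)⁻¹ * ∫ x in (0:ℝ)..(2 * π), g x ^ 2) := by
  have hL2 : MeasureTheory.MemLp (fun x => (g x : ℂ)) 2
      (MeasureTheory.volume.restrict (Set.Ioc 0 (2 * π))) := by
    have hc : Continuous fun x => (g x : ℂ) := by fun_prop
    obtain ⟨C, hC⟩ := isCompact_Icc.exists_bound_of_continuousOn
      (s := Set.Icc 0 (2 * π)) hc.continuousOn
    refine MeasureTheory.MemLp.of_bound hc.aestronglyMeasurable C ?_
    refine (MeasureTheory.ae_restrict_iff' measurableSet_Ioc).2 (Filter.Eventually.of_forall ?_)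
    exact fun x hx => hC x (Set.Ioc_subset_Icc_self hx)
  simpa using hasSum_sq_fourierCoeffOn two_pi_pos hL2

theorem norm_fourierCoeffOn_deriv {g : ℝ → ℝ} (hg : ContDiff ℝ 1 g)
    (hper : g (2 * π) = g 0) (n : ℤ) :
    ‖fourierCoeffOn two_pi_pos (fun x => ((deriv g x : ℝ) : ℂ)) n‖ ^ 2 =
      n ^ 2 * ‖fourierCoeffOn two_pi_pos (fun x => (g x : ℂ)) n‖ ^ 2 := by
  have hd : Continuous (deriv g) := hg.continuous_deriv le_rfl
  have hderiv : ∀ x, HasDerivAt g (deriv g x) x := fun x =>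
    (hg.differentiable one_ne_zero x).hasDerivAt
  rcases eq_or_ne n 0 with rfl | hn
  · have h0 : ∫ x in (0:ℝ)..(2 * π), deriv g x = 0 := by
      rw [intervalIntegral.integral_eq_sub_of_hasDerivAt (fun x _ => hderiv x)
        (hd.intervalIntegrable _ _), hper, sub_self]
    simp [fourierCoeffOn_two_pi_eq hd, h0]
  · have h := fourierCoeffOn_of_hasDerivAt two_pi_pos (f := fun x => (g x : ℂ))
      (f' := fun x => ((deriv g x : ℝ) : ℂ)) hn (fun x _ => (hderiv x).ofReal_comp)
      (Continuous.intervalIntegrable (by fun_prop) _ _)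
    have hn' : (n : ℝ) ≠ 0 := by exact_mod_cast hn
    rw [h, hper, sub_self, mul_zero, zero_sub]
    simp only [norm_mul, norm_div, norm_neg, norm_one, Complex.norm_I, Complex.norm_intCast]
    push_cast
    simp only [norm_mul, Complex.norm_real, sub_zero, norm_eq_abs, abs_of_pos pi_pos, mul_one]
    rw [mul_pow, div_pow, mul_pow, sq_abs]
    have := pi_ne_zero
    field_simp

/-- Wirtinger's inequality for functions without Fourier modes of order below `N`. -/
theorem wirtinger_of_fourierCoeffOn_eq_zero {g : ℝ → ℝ} (hg : ContDiff ℝ 1 g)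
    (hper : g (2 * π) = g 0) (N : ℕ)
    (hN : ∀ n : ℤ, n ^ 2 < (N : ℤ) ^ 2 → fourierCoeffOn two_pi_pos (fun x => (g x : ℂ)) n = 0) :
    (N : ℝ) ^ 2 * ∫ x in (0:ℝ)..(2 * π), g x ^ 2 ≤ ∫ x in (0:ℝ)..(2 * π), deriv g x ^ 2 := by
  have h1 := (hasSum_sq_fourierCoeffOn_two_pi hg.continuous).mul_left ((N : ℝ) ^ 2)
  have h2 := hasSum_sq_fourierCoeffOn_two_pi (hg.continuous_deriv le_rfl)
  have h := hasSum_le (fun n => ?_) h1 h2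
  · have hp : 0 < (2 * π)⁻¹ := inv_pos.2 two_pi_pos
    rw [mul_left_comm] at h
    exact le_of_mul_le_mul_left h hp
  · rw [norm_fourierCoeffOn_deriv hg hper]
    by_cases hn : n ^ 2 < (N : ℤ) ^ 2
    · simp [hN n hn]
    · have : (N : ℝ) ^ 2 ≤ (n : ℝ) ^ 2 := by exact_mod_cast not_lt.1 hn
      gcongr

/-- Wirtinger's inequality. -/
theorem wirtinger {g : ℝ → ℝ} (hg : ContDiff ℝ 1 g) (hper : g (2 * π) = g 0)
    (h0 : ∫ x in (0:ℝ)..(2 * π), g x = 0) :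
    ∫ x in (0:ℝ)..(2 * π), g x ^ 2 ≤ ∫ x in (0:ℝ)..(2 * π), deriv g x ^ 2 := by
  have := wirtinger_of_fourierCoeffOn_eq_zero hg hper 1 fun n hn => ?_
  · simpa using this
  · have : n = 0 := by
      have := abs_lt_of_sq_lt_sq hn (by norm_num)
      simpa using this
    subst this
    simp [fourierCoeffOn_two_pi_eq hg.continuous, h0]

theorem wirtinger_four {g : ℝ → ℝ} (hg : ContDiff ℝ 1 g) (hper : g (2 * π) = g 0)
    (h0 : ∫ x in (0:ℝ)..(2 * π), g x = 0) (hc : ∫ x in (0:ℝ)..(2 * π), g x * cos x = 0)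
    (hs : ∫ x in (0:ℝ)..(2 * π), g x * sin x = 0) :
    4 * ∫ x in (0:ℝ)..(2 * π), g x ^ 2 ≤ ∫ x in (0:ℝ)..(2 * π), deriv g x ^ 2 := by
  have := wirtinger_of_fourierCoeffOn_eq_zero hg hper 2 fun n hn => ?_
  · norm_num at this
    exact this
  · have := abs_lt.1 (abs_lt_of_sq_lt_sq hn (by norm_num))
    obtain rfl | rfl | rfl : n = -1 ∨ n = 0 ∨ n = 1 := by omega
    all_goals simp [fourierCoeffOn_two_pi_eq hg.continuous, h0, hc, hs]

theorem dirichlet_poincare_halves {r : ℝ → ℝ} (hr : ContDiff ℝ 1 r) (h0 : r 0 = 0)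
    (h1 : r (π / 2) = 0) (h2 : r π = 0) :
    4 * ∫ x in (0:ℝ)..π, r x ^ 2 ≤ ∫ x in (0:ℝ)..π, deriv r x ^ 2 := by
  have hc := hr.continuous
  have hd : Continuous (deriv r) := hr.continuous_deriv le_rfl
  have ha := dirichlet_poincare hr (a := 0) (b := π / 2) (by positivity) h0 h1
  have hb := dirichlet_poincare hr (a := π / 2) (b := π) (half_lt_self pi_pos) h1 h2
  have e1 : (π / (π / 2 - 0)) ^ 2 = 4 := by have := pi_ne_zero; field_simp; norm_num
  have e2 : (π / (π - π / 2)) ^ 2 = 4 := by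
    have := pi_ne_zero; rw [sub_half]; field_simp; norm_num
  rw [e1] at ha
  rw [e2] at hb
  rw [← intervalIntegral.integral_add_adjacent_intervals (a := 0) (b := π / 2) (c := π)
      (f := fun x => r x ^ 2) (Continuous.intervalIntegrable (by fun_prop) _ _)
      (Continuous.intervalIntegrable (by fun_prop) _ _),
    ← intervalIntegral.integral_add_adjacent_intervals (a := 0) (b := π / 2) (c := π)
      (f := fun x => deriv r x ^ 2) (Continuous.intervalIntegrable (by fun_prop) _ _)
      (Continuous.intervalIntegrable (by fun_prop) _ _)]
  linarith

/-- The pointwise estimate behind `integral_nonneg_of_trial`. -/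
theorem trial_pointwise {κ μ w c P y V t z z₁ z₂ W r r₁ ψ u F : ℝ} (hc : 0 < c) (hP : 0 ≤ P)
    (hPw : P * c ^ 2 ≤ w) (hy : 0 < y) (hyV : y ≤ 4 * κ - μ - P * V) (hu : 0 ≤ u)
    (hfac : t * z + r = ψ * u) (hV : W ^ 4 ≤ V)
    (hF : F = -κ * z₂ - μ * z + 2 * P * W - P * z * W ^ 4) :
    t ^ 2 * (z * (F + 2 * P * W)) - t ^ 2 / y * F ^ 2 - 2 * P * t ^ 2 / c * u
        + κ * t ^ 2 * (z₁ * z₁ + z * z₂) + 2 * t * κ * (z₂ * r + z₁ * r₁) + κ * (r₁ ^ 2 - 4 * r ^ 2)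
      ≤ κ * (t * z₁ + r₁) ^ 2 - μ * (ψ * u) ^ 2 + w * ψ ^ 2 := by
  have h1 : P * (4 * t * (ψ * u) * W - 2 * t ^ 2 / c * u - (ψ * u) ^ 2 * W ^ 4) ≤ w * ψ ^ 2 := by
    have e : c ^ 2 * ψ ^ 2 = 4 * t * (ψ * u) * W - 2 * t ^ 2 / c * u - (ψ * u) ^ 2 * W ^ 4
        + (c * ψ - ψ * u * W ^ 2) ^ 2 + 2 * u / c * (c * ψ * W - t) ^ 2 := by
      field_simp
      ring
    have p1 : 0 ≤ 2 * u / c * (c * ψ * W - t) ^ 2 := by positivity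
    have p2 : P * (c ^ 2 * ψ ^ 2) ≤ w * ψ ^ 2 := by
      rw [← mul_assoc]; exact mul_le_mul_of_nonneg_right hPw (sq_nonneg _)
    refine le_trans (mul_le_mul_of_nonneg_left ?_ hP) p2
    rw [e]
    nlinarith [sq_nonneg (c * ψ - ψ * u * W ^ 2)]
  have h2 : -(t ^ 2 / y * F ^ 2) ≤ 2 * t * r * F + y * r ^ 2 := by
    have e : 2 * t * r * F + y * r ^ 2 + t ^ 2 / y * F ^ 2 = y * (r + t * F / y) ^ 2 := by
      field_simp
      ring
    have : 0 ≤ y * (r + t * F / y) ^ 2 := by positivity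
    linarith
  have h3 : 0 ≤ (4 * κ - μ - P * W ^ 4 - y) * r ^ 2 :=
    mul_nonneg (by nlinarith) (sq_nonneg r)
  rw [← hfac] at h1 ⊢
  have e : κ * (t * z₁ + r₁) ^ 2 - μ * (t * z + r) ^ 2
        + P * (4 * t * (t * z + r) * W - 2 * t ^ 2 / c * u - (t * z + r) ^ 2 * W ^ 4)
      - (t ^ 2 * (z * (F + 2 * P * W)) + (2 * t * r * F + y * r ^ 2) - 2 * P * t ^ 2 / c * u
        + κ * t ^ 2 * (z₁ * z₁ + z * z₂) + 2 * t * κ * (z₂ * r + z₁ * r₁)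
        + κ * (r₁ ^ 2 - 4 * r ^ 2)) = (4 * κ - μ - P * W ^ 4 - y) * r ^ 2 := by
    rw [hF]
    ring
  linarith

/-- A lower bound for a weighted Dirichlet energy obtained by splitting `f = t z + r`, where the
trial function `z` and `f` agree at `π / 2` up to the factor `t`. -/
theorem integral_nonneg_of_trial {f ψ u z z₁ z₂ W F : ℝ → ℝ} {κ μ w c P y V M : ℝ}
    (hf : ContDiff ℝ 1 f) (hψ : Continuous ψ) (hu : Continuous u)
    (hz : ∀ x, HasDerivAt z (z₁ x) x) (hz₁ : ∀ x, HasDerivAt z₁ (z₂ x) x) (hz₂ : Continuous z₂)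
    (hF : ∀ x, F x = -κ * z₂ x - μ * z x + 2 * P * W x - P * z x * W x ^ 4) (hW : Continuous W)
    (hfac : ∀ x, f x = ψ x * u x) (hu0 : ∀ x ∈ Set.Icc 0 π, 0 ≤ u x)
    (hf0 : f 0 = 0) (hfπ : f π = 0) (hz0 : z 0 = 0) (hzπ : z π = 0) (hzm : z (π / 2) ≠ 0)
    (hM : ∫ x in (0:ℝ)..π, u x ≤ M) (hV : ∀ x ∈ Set.Icc 0 π, W x ^ 4 ≤ V)
    (hκ : 0 ≤ κ) (hc : 0 < c) (hP : 0 ≤ P) (hPw : P * c ^ 2 ≤ w) (hy : 0 < y)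
    (hyV : y ≤ 4 * κ - μ - P * V)
    (hmain : ∫ x in (0:ℝ)..π, F x ^ 2 ≤
      y * ((∫ x in (0:ℝ)..π, z x * (F x + 2 * P * W x)) - 2 * P / c * M)) :
    0 ≤ ∫ x in (0:ℝ)..π, (κ * deriv f x ^ 2 - μ * f x ^ 2 + w * ψ x ^ 2) := by
  have hzc : Continuous z := continuous_iff_continuousAt.2 fun x => (hz x).continuousAt
  have hz₁c : Continuous z₁ := continuous_iff_continuousAt.2 fun x => (hz₁ x).continuousAt
  have hFc : Continuous F := by
    rw [funext hF]
    fun_prop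
  set t : ℝ := f (π / 2) / z (π / 2) with ht
  set r : ℝ → ℝ := fun x => f x - t * z x with hr
  have hzC : ContDiff ℝ 1 z := by
    rw [contDiff_one_iff_deriv]
    refine ⟨fun x => (hz x).differentiableAt, ?_⟩
    rwa [funext fun x => (hz x).deriv]
  have hrC : ContDiff ℝ 1 r := hf.sub (contDiff_const.mul hzC)
  have hrc := hrC.continuous
  have hrd : Continuous (deriv r) := hrC.continuous_deriv le_rfl
  have hrD : ∀ x, HasDerivAt r (deriv r x) x := fun x =>
    (hrC.differentiable one_ne_zero x).hasDerivAt
  have hfd : ∀ x, deriv f x = t * z₁ x + deriv r x := by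
    intro x
    have : HasDerivAt f (t * z₁ x + deriv r x) x := by
      refine (((hz x).const_mul t).add (hrD x)).congr_of_eventuallyEq (.of_forall fun y => ?_)
      simp [hr]
    exact this.deriv
  have hr0 : r 0 = 0 := by simp [hr, hf0, hz0]
  have hrπ : r π = 0 := by simp [hr, hfπ, hzπ]
  have hrm : r (π / 2) = 0 := by simp [hr, ht, hzm]
  have hpoin := dirichlet_poincare_halves hrC hr0 hrm hrπ
  have hparts : ∫ x in (0:ℝ)..π, (z₂ x * r x + z₁ x * deriv r x) = 0 := by
    rw [intervalIntegral.integral_eq_sub_of_hasDerivAt (fun x _ => (hz₁ x).mul (hrD x))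
      (Continuous.intervalIntegrable (by fun_prop) _ _)]
    simp [hr0, hrπ]
  have hparts' : ∫ x in (0:ℝ)..π, (z₁ x * z₁ x + z x * z₂ x) = 0 := by
    rw [intervalIntegral.integral_eq_sub_of_hasDerivAt (fun x _ => (hz x).mul (hz₁ x))
      (Continuous.intervalIntegrable (by fun_prop) _ _)]
    simp [hz0, hzπ]
  have hle : ∫ x in (0:ℝ)..π, (t ^ 2 * (z x * (F x + 2 * P * W x)) - t ^ 2 / y * F x ^ 2
        - 2 * P * t ^ 2 / c * u x + κ * t ^ 2 * (z₁ x * z₁ x + z x * z₂ x)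
        + 2 * t * κ * (z₂ x * r x + z₁ x * deriv r x)
        + κ * (deriv r x ^ 2 - 4 * r x ^ 2)) ≤
      ∫ x in (0:ℝ)..π, (κ * deriv f x ^ 2 - μ * f x ^ 2 + w * ψ x ^ 2) := by
    have hfc : Continuous (deriv f) := hf.continuous_deriv le_rfl
    have hfc' := hf.continuous
    refine intervalIntegral.integral_mono_on pi_pos.le
      (Continuous.intervalIntegrable (by fun_prop) _ _)
      (Continuous.intervalIntegrable (by fun_prop) _ _) fun x hx => ?_
    rw [hfd, hfac]
    refine trial_pointwise hc hP hPw hy hyV (hu0 x hx) ?_ (hV x hx) (hF x)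
    rw [← hfac]
    simp [hr]
  refine le_trans ?_ hle
  have I : ∀ g : ℝ → ℝ, Continuous g → IntervalIntegrable g MeasureTheory.volume 0 π :=
    fun g hg => hg.intervalIntegrable _ _
  rw [intervalIntegral.integral_add (I _ (by fun_prop)) (I _ (by fun_prop)),
    intervalIntegral.integral_add (I _ (by fun_prop)) (I _ (by fun_prop)),
    intervalIntegral.integral_add (I _ (by fun_prop)) (I _ (by fun_prop)),
    intervalIntegral.integral_sub (I _ (by fun_prop)) (I _ (by fun_prop)),
    intervalIntegral.integral_sub (I _ (by fun_prop)) (I _ (by fun_prop))]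
  simp only [intervalIntegral.integral_const_mul]
  rw [hparts, hparts', intervalIntegral.integral_sub (I _ (by fun_prop)) (I _ (by fun_prop)),
    intervalIntegral.integral_const_mul]
  have h1 : 0 ≤ κ * ((∫ x in (0:ℝ)..π, deriv r x ^ 2) - 4 * ∫ x in (0:ℝ)..π, r x ^ 2) :=
    mul_nonneg hκ (sub_nonneg.2 hpoin)
  have h2 := mul_le_mul_of_nonneg_left hM (show 0 ≤ 2 * P * t ^ 2 / c by positivity)
  have h3 := mul_le_mul_of_nonneg_left hmain (show 0 ≤ t ^ 2 / y by positivity)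
  have e : t ^ 2 / y * (y * ((∫ x in (0:ℝ)..π, z x * (F x + 2 * P * W x)) - 2 * P / c * M)) =
      t ^ 2 * (∫ x in (0:ℝ)..π, z x * (F x + 2 * P * W x)) - 2 * P * t ^ 2 / c * M := by
    field_simp
  rw [e] at h3
  linarith

theorem integral_sin_pow_moments :
    (∫ x in (0:ℝ)..π, sin x ^ 2) = 1 / 2 * π ∧
    (∫ x in (0:ℝ)..π, sin x ^ 3) = 4 / 3 ∧
    (∫ x in (0:ℝ)..π, sin x ^ 4) = 3 / 8 * π ∧
    (∫ x in (0:ℝ)..π, sin x ^ 5) = 16 / 15 ∧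
    (∫ x in (0:ℝ)..π, sin x ^ 6) = 5 / 16 * π ∧
    (∫ x in (0:ℝ)..π, sin x ^ 7) = 32 / 35 ∧
    (∫ x in (0:ℝ)..π, sin x ^ 8) = 35 / 128 * π ∧
    (∫ x in (0:ℝ)..π, sin x ^ 9) = 256 / 315 ∧
    (∫ x in (0:ℝ)..π, sin x ^ 10) = 63 / 256 * π ∧
    (∫ x in (0:ℝ)..π, sin x ^ 11) = 512 / 693 ∧
    (∫ x in (0:ℝ)..π, sin x ^ 12) = 231 / 1024 * π ∧
    (∫ x in (0:ℝ)..π, sin x ^ 13) = 2048 / 3003 ∧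
    (∫ x in (0:ℝ)..π, sin x ^ 14) = 429 / 2048 * π := by
  have h0 : ∫ x in (0:ℝ)..π, sin x ^ 0 = π := by simp
  have h1 : ∫ x in (0:ℝ)..π, sin x ^ 1 = 2 := by simp; norm_num
  have h (n : ℕ) : ∫ x in (0:ℝ)..π, sin x ^ (n + 2) =
      (n + 1) / (n + 2) * ∫ x in (0:ℝ)..π, sin x ^ n := by
    rw [integral_sin_pow]
    simp
  refine ⟨?_, ?_, ?_, ?_, ?_, ?_, ?_, ?_, ?_, ?_, ?_, ?_, ?_⟩ <;>
    (simp only [h, h0, h1]; push_cast; ring)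

theorem integral_poly_sin (a0 a1 a2 a3 a4 a5 a6 a7 a8 a9 a10 a11 a12 a13 a14 : ℝ) :
    ∫ x in (0:ℝ)..π, (
      a0 + a1 * sin x + a2 * sin x ^ 2 + a3 * sin x ^ 3 + a4 * sin x ^ 4 + a5 * sin x ^ 5 +
      a6 * sin x ^ 6 + a7 * sin x ^ 7 + a8 * sin x ^ 8 + a9 * sin x ^ 9 + a10 * sin x ^ 10 +
      a11 * sin x ^ 11 + a12 * sin x ^ 12 + a13 * sin x ^ 13 + a14 * sin x ^ 14) =
      a0 * (π) + a1 * (2) + a2 * (1 / 2 * π) + a3 * (4 / 3) + a4 * (3 / 8 * π) + a5 * (16 / 15) +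
      a6 * (5 / 16 * π) + a7 * (32 / 35) + a8 * (35 / 128 * π) + a9 * (256 / 315) +
      a10 * (63 / 256 * π) + a11 * (512 / 693) + a12 * (231 / 1024 * π) + a13 * (2048 / 3003) +
      a14 * (429 / 2048 * π) := by
  have I : ∀ g : ℝ → ℝ, Continuous g → IntervalIntegrable g MeasureTheory.volume 0 π :=
    fun g hg => hg.intervalIntegrable _ _
  obtain ⟨m2, m3, m4, m5, m6, m7, m8, m9, m10, m11, m12, m13, m14⟩ := integral_sin_pow_moments
  rw [intervalIntegral.integral_add (I _ (by fun_prop)) (I _ (by fun_prop))]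
  rw [intervalIntegral.integral_add (I _ (by fun_prop)) (I _ (by fun_prop))]
  rw [intervalIntegral.integral_add (I _ (by fun_prop)) (I _ (by fun_prop))]
  rw [intervalIntegral.integral_add (I _ (by fun_prop)) (I _ (by fun_prop))]
  rw [intervalIntegral.integral_add (I _ (by fun_prop)) (I _ (by fun_prop))]
  rw [intervalIntegral.integral_add (I _ (by fun_prop)) (I _ (by fun_prop))]
  rw [intervalIntegral.integral_add (I _ (by fun_prop)) (I _ (by fun_prop))]
  rw [intervalIntegral.integral_add (I _ (by fun_prop)) (I _ (by fun_prop))]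
  rw [intervalIntegral.integral_add (I _ (by fun_prop)) (I _ (by fun_prop))]
  rw [intervalIntegral.integral_add (I _ (by fun_prop)) (I _ (by fun_prop))]
  rw [intervalIntegral.integral_add (I _ (by fun_prop)) (I _ (by fun_prop))]
  rw [intervalIntegral.integral_add (I _ (by fun_prop)) (I _ (by fun_prop))]
  rw [intervalIntegral.integral_add (I _ (by fun_prop)) (I _ (by fun_prop))]
  rw [intervalIntegral.integral_add (I _ (by fun_prop)) (I _ (by fun_prop))]
  simp only [intervalIntegral.integral_const_mul, intervalIntegral.integral_const,
    integral_sin, m2, m3, m4, m5, m6, m7, m8, m9, m10, m11, m12, m13, m14]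
  simp only [cos_zero, cos_pi, sub_zero, smul_eq_mul]
  ring

theorem integral_sq_poly_sin (F0 F1 F2 F3 F4 F5 F6 F7 : ℝ) :
    ∫ x in (0:ℝ)..π, (F0 + F1 * sin x + F2 * sin x ^ 2 + F3 * sin x ^ 3 +
      F4 * sin x ^ 4 + F5 * sin x ^ 5 + F6 * sin x ^ 6 + F7 * sin x ^ 7) ^ 2 =
      (F0 ^ 2) * (π) + (2 * F0 * F1) * (2) + (2 * F0 * F2 + F1 ^ 2) * (1 / 2 * π) +
      (2 * F0 * F3 + 2 * F1 * F2) * (4 / 3) + (2 * F0 * F4 + 2 * F1 * F3 +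
      F2 ^ 2) * (3 / 8 * π) + (2 * F0 * F5 + 2 * F1 * F4 + 2 * F2 * F3) * (16 / 15) +
      (2 * F0 * F6 + 2 * F1 * F5 + 2 * F2 * F4 + F3 ^ 2) * (5 / 16 * π) + (2 * F0 * F7 +
      2 * F1 * F6 + 2 * F2 * F5 + 2 * F3 * F4) * (32 / 35) + (2 * F1 * F7 + 2 * F2 * F6 +
      2 * F3 * F5 + F4 ^ 2) * (35 / 128 * π) + (2 * F2 * F7 + 2 * F3 * F6 +
      2 * F4 * F5) * (256 / 315) + (2 * F3 * F7 + 2 * F4 * F6 + F5 ^ 2) * (63 / 256 * π) +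
      (2 * F4 * F7 + 2 * F5 * F6) * (512 / 693) + (2 * F5 * F7 + F6 ^ 2) * (231 / 1024 * π) +
      (2 * F6 * F7) * (2048 / 3003) + (F7 ^ 2) * (429 / 2048 * π) := by
  rw [← integral_poly_sin]
  refine intervalIntegral.integral_congr fun x _ => ?_
  ring

theorem integral_mul_poly_sin (b2 b3 P w0 n1 F0 F1 F2 F3 F4 F5 F6 F7 : ℝ) :
    ∫ x in (0:ℝ)..π, (sin x + b2 * sin x ^ 2 + b3 * sin x ^ 3) *
      ((F0 + F1 * sin x + F2 * sin x ^ 2 + F3 * sin x ^ 3 +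
        F4 * sin x ^ 4 + F5 * sin x ^ 5 + F6 * sin x ^ 6 + F7 * sin x ^ 7) + 2 * P * (w0 - n1 * sin x)) =
      ((F0 + 2 * P * w0)) * (2) + ((F1 - 2 * P * n1) + b2 * (F0 + 2 * P * w0)) * (1 / 2 * π) +
      (F2 + b2 * (F1 - 2 * P * n1) + b3 * (F0 + 2 * P * w0)) * (4 / 3) + (F3 + b2 * F2 +
      b3 * (F1 - 2 * P * n1)) * (3 / 8 * π) + (F4 + b2 * F3 + b3 * F2) * (16 / 15) + (F5 +
      b2 * F4 + b3 * F3) * (5 / 16 * π) + (F6 + b2 * F5 + b3 * F4) * (32 / 35) + (F7 + b2 * F6 +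
      b3 * F5) * (35 / 128 * π) + (b2 * F7 + b3 * F6) * (256 / 315) +
      (b3 * F7) * (63 / 256 * π) := by
  have h := integral_poly_sin 0 (F0 + 2 * P * w0) ((F1 - 2 * P * n1) + b2 * (F0 + 2 * P * w0))
    (F2 + b2 * (F1 - 2 * P * n1) + b3 * (F0 + 2 * P * w0))
    (F3 + b2 * F2 + b3 * (F1 - 2 * P * n1)) (F4 + b2 * F3 + b3 * F2) (F5 + b2 * F4 + b3 * F3)
    (F6 + b2 * F5 + b3 * F4) (F7 + b2 * F6 + b3 * F5) (b2 * F7 + b3 * F6) (b3 * F7) 0 0 0 0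
  simp only [zero_mul, zero_add, add_zero] at h
  rw [← h]
  refine intervalIntegral.integral_congr fun x _ => ?_
  ring

/-- `integral_nonneg_of_trial` for a cubic trial function and an affine weight in `sin x`. -/
theorem integral_nonneg_of_trial_sin {f ψ u : ℝ → ℝ} {κ μ w c P y wm M b2 b3 w0 n1 : ℝ}
    {F0 F1 F2 F3 F4 F5 F6 F7 : ℝ}
    (hf : ContDiff ℝ 1 f) (hψ : Continuous ψ) (hu : Continuous u)
    (hfac : ∀ x, f x = ψ x * u x) (hu0 : ∀ x ∈ Set.Icc 0 π, 0 ≤ u x)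
    (hf0 : f 0 = 0) (hfπ : f π = 0) (hM : ∫ x in (0:ℝ)..π, u x ≤ M)
    (hb : 0 < 1 + b2 + b3) (hw0 : 0 ≤ w0) (hw0m : w0 ≤ wm) (hw1 : 0 ≤ w0 - n1)
    (hw1m : w0 - n1 ≤ wm) (hκ : 0 ≤ κ) (hc : 0 < c) (hP : 0 ≤ P) (hPw : P * c ^ 2 ≤ w) (hy : 0 < y)
    (hyV : y ≤ 4 * κ - μ - P * wm ^ 4)
    (hF0 : F0 = -(2 * κ * b2) + 2 * P * w0)
    (hF1 : F1 = -(κ * (6 * b3 - 1)) - μ - 2 * P * n1 - P * w0 ^ 4)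
    (hF2 : F2 = 4 * κ * b2 - μ * b2 - P * (b2 * w0 ^ 4 - 4 * w0 ^ 3 * n1))
    (hF3 : F3 = 9 * κ * b3 - μ * b3
      - P * (b3 * w0 ^ 4 - 4 * b2 * w0 ^ 3 * n1 + 6 * w0 ^ 2 * n1 ^ 2))
    (hF4 : F4 = -(P * (-(4 * b3 * w0 ^ 3 * n1) + 6 * b2 * w0 ^ 2 * n1 ^ 2 - 4 * w0 * n1 ^ 3)))
    (hF5 : F5 = -(P * (6 * b3 * w0 ^ 2 * n1 ^ 2 - 4 * b2 * w0 * n1 ^ 3 + n1 ^ 4)))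
    (hF6 : F6 = -(P * (b2 * n1 ^ 4 - 4 * b3 * w0 * n1 ^ 3)))
    (hF7 : F7 = -(P * b3 * n1 ^ 4))
    (hmain :
      (F0 ^ 2) * (π) + (2 * F0 * F1) * (2) + (2 * F0 * F2 + F1 ^ 2) * (1 / 2 * π) +
      (2 * F0 * F3 + 2 * F1 * F2) * (4 / 3) + (2 * F0 * F4 + 2 * F1 * F3 +
      F2 ^ 2) * (3 / 8 * π) + (2 * F0 * F5 + 2 * F1 * F4 + 2 * F2 * F3) * (16 / 15) +
      (2 * F0 * F6 + 2 * F1 * F5 + 2 * F2 * F4 + F3 ^ 2) * (5 / 16 * π) + (2 * F0 * F7 +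
      2 * F1 * F6 + 2 * F2 * F5 + 2 * F3 * F4) * (32 / 35) + (2 * F1 * F7 + 2 * F2 * F6 +
      2 * F3 * F5 + F4 ^ 2) * (35 / 128 * π) + (2 * F2 * F7 + 2 * F3 * F6 +
      2 * F4 * F5) * (256 / 315) + (2 * F3 * F7 + 2 * F4 * F6 + F5 ^ 2) * (63 / 256 * π) +
      (2 * F4 * F7 + 2 * F5 * F6) * (512 / 693) + (2 * F5 * F7 + F6 ^ 2) * (231 / 1024 * π) +
      (2 * F6 * F7) * (2048 / 3003) + (F7 ^ 2) * (429 / 2048 * π) ≤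
        y * ((
          ((F0 + 2 * P * w0)) * (2) + ((F1 - 2 * P * n1) + b2 * (F0 +
          2 * P * w0)) * (1 / 2 * π) + (F2 + b2 * (F1 - 2 * P * n1) + b3 * (F0 +
          2 * P * w0)) * (4 / 3) + (F3 + b2 * F2 + b3 * (F1 - 2 * P * n1)) * (3 / 8 * π) + (F4 +
          b2 * F3 + b3 * F2) * (16 / 15) + (F5 + b2 * F4 + b3 * F3) * (5 / 16 * π) + (F6 +
          b2 * F5 + b3 * F4) * (32 / 35) + (F7 + b2 * F6 + b3 * F5) * (35 / 128 * π) + (b2 * F7 +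
          b3 * F6) * (256 / 315) + (b3 * F7) * (63 / 256 * π))
          - 2 * P / c * M)) :
    0 ≤ ∫ x in (0:ℝ)..π, (κ * deriv f x ^ 2 - μ * f x ^ 2 + w * ψ x ^ 2) := by
  refine integral_nonneg_of_trial (z := fun x => sin x + b2 * sin x ^ 2 + b3 * sin x ^ 3)
    (z₁ := fun x => cos x + 2 * b2 * sin x * cos x + 3 * b3 * sin x ^ 2 * cos x)
    (z₂ := fun x => 2 * b2 + (6 * b3 - 1) * sin x - 4 * b2 * sin x ^ 2 - 9 * b3 * sin x ^ 3)
    (W := fun x => w0 - n1 * sin x)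
    (F := fun x => F0 + F1 * sin x + F2 * sin x ^ 2 + F3 * sin x ^ 3 +
      F4 * sin x ^ 4 + F5 * sin x ^ 5 + F6 * sin x ^ 6 + F7 * sin x ^ 7)
    (V := wm ^ 4) hf hψ hu (fun x => ?_) (fun x => ?_) (by fun_prop) (fun x => ?_) (by fun_prop)
    hfac hu0 hf0 hfπ (by simp) (by simp) ?_ hM (fun x hx => ?_) hκ hc hP hPw hy hyV ?_
  · have h := hasDerivAt_sin x
    refine ((h.add ((h.pow 2).const_mul b2)).add ((h.pow 3).const_mul b3)).congr_deriv ?_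
    push_cast
    ring
  · have h := hasDerivAt_sin x
    have h' := hasDerivAt_cos x
    refine ((h'.add ((h.const_mul (2 * b2)).mul h')).add
      (((h.pow 2).const_mul (3 * b3)).mul h')).congr_deriv ?_
    have e := cos_sq' x
    simp only [Pi.pow_apply]
    push_cast
    linear_combination (2 * b2 + 6 * b3 * sin x) * e
  · simp only [hF0, hF1, hF2, hF3, hF4, hF5, hF6, hF7]
    ring
  · simpa using hb.ne'
  · have h0 := sin_nonneg_of_mem_Icc hx
    have h1 := sin_le_one x
    have hl : 0 ≤ w0 - n1 * sin x := by
      linarith only [mul_nonneg (sub_nonneg.2 h1) hw0, mul_nonneg h0 hw1]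
    have hr : w0 - n1 * sin x ≤ wm := by
      linarith only [mul_le_mul_of_nonneg_left hw0m (sub_nonneg.2 h1),
        mul_le_mul_of_nonneg_left hw1m h0]
    exact pow_le_pow_left₀ hl hr 4
  · rw [integral_sq_poly_sin, integral_mul_poly_sin]
    exact hmain

set_option maxHeartbeats 2000000 in
theorem trial_estimate_of_ge {f ψ u : ℝ → ℝ} {k : ℝ} (hf : ContDiff ℝ 1 f)
    (hψ : Continuous ψ) (hu : Continuous u) (hfac : ∀ x, f x = ψ x * u x)
    (hu0 : ∀ x ∈ Set.Icc 0 π, 0 ≤ u x) (hf0 : f 0 = 0) (hfπ : f π = 0)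
    (hM : ∫ x in (0:ℝ)..π, u x ≤ π * (2 * k - 1)) (hk1 : 0.7875 ≤ k) (hk2 : k ≤ 0.901) :
    0 ≤ ∫ x in (0:ℝ)..π, (k ^ 2 * deriv f x ^ 2 - (0.811 + 0.24) * f x ^ 2 + 0.24 * ψ x ^ 2) := by
  have hk0 : 0 ≤ k := by linarith only [hk1]
  have hp := pi_gt_d6.le
  have hp' := pi_lt_d6.le
  have p1 := mul_nonneg (sub_nonneg.2 hp) hk0
  have p1' := mul_nonneg (sub_nonneg.2 hp') hk0
  have p2 := mul_nonneg (sub_nonneg.2 hp) (pow_nonneg hk0 2)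
  have p2' := mul_nonneg (sub_nonneg.2 hp') (pow_nonneg hk0 2)
  have p4 := mul_nonneg (sub_nonneg.2 hp) (pow_nonneg hk0 4)
  have p4' := mul_nonneg (sub_nonneg.2 hp') (pow_nonneg hk0 4)
  rcases le_total k 0.83 with hk2 | hk1
  · refine integral_nonneg_of_trial_sin (c := 0.77) (P := 0.40479) (y := 0.30866) (wm := 1.29)
      (b2 := 0.69) (b3 := -0.22) (w0 := 1.29) (n1 := 0.40) hf hψ hu hfac hu0 hf0 hfπ hM
      (by norm_num) (by norm_num) (by norm_num) (by norm_num) (by norm_num) (by positivity)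
      (by norm_num) (by norm_num) (by norm_num) (by norm_num) (by nlinarith only [hk1])
      rfl rfl rfl rfl rfl rfl rfl rfl ?_
    have q1 := mul_nonneg (sub_nonneg.2 hk1) (sub_nonneg.2 hk2)
    have q2 := sq_nonneg (k - 0.830)
    have q3 : 0 ≤ (k ^ 2 - 0.7875 ^ 2) * (0.83 ^ 2 - k ^ 2) :=
      mul_nonneg (by nlinarith only [hk1]) (by nlinarith only [hk1, hk2])
    linarith only [hk1, hk2, q1, q2, q3, hp, hp', p1, p1', p2, p2', p4, p4']
  rcases le_total k 0.87 with hk2 | hk1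
  · refine integral_nonneg_of_trial_sin (c := 0.86) (P := 0.32449) (y := 0.5615) (wm := 1.37)
      (b2 := 0.55) (b3 := -0.19) (w0 := 1.37) (n1 := 0.46) hf hψ hu hfac hu0 hf0 hfπ hM
      (by norm_num) (by norm_num) (by norm_num) (by norm_num) (by norm_num) (by positivity)
      (by norm_num) (by norm_num) (by norm_num) (by norm_num) (by nlinarith only [hk1])
      rfl rfl rfl rfl rfl rfl rfl rfl ?_
    have q1 := mul_nonneg (sub_nonneg.2 hk1) (sub_nonneg.2 hk2)
    have q2 := sq_nonneg (k - 0.830)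
    have q3 : 0 ≤ (k ^ 2 - 0.83 ^ 2) * (0.87 ^ 2 - k ^ 2) :=
      mul_nonneg (by nlinarith only [hk1]) (by nlinarith only [hk1, hk2])
    linarith only [hk1, hk2, q1, q2, q3, hp, hp', p1, p1', p2, p2', p4, p4']
  refine integral_nonneg_of_trial_sin (c := 0.91) (P := 0.28982) (y := 0.65973) (wm := 1.46)
    (b2 := 0.48) (b3 := -0.18) (w0 := 1.46) (n1 := 0.55) hf hψ hu hfac hu0 hf0 hfπ hM
    (by norm_num) (by norm_num) (by norm_num) (by norm_num) (by norm_num) (by positivity)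
    (by norm_num) (by norm_num) (by norm_num) (by norm_num) (by nlinarith only [hk1])
    rfl rfl rfl rfl rfl rfl rfl rfl ?_
  have q1 := mul_nonneg (sub_nonneg.2 hk1) (sub_nonneg.2 hk2)
  have q2 := sq_nonneg (k - 0.870)
  have q3 : 0 ≤ (k ^ 2 - 0.87 ^ 2) * (0.901 ^ 2 - k ^ 2) :=
    mul_nonneg (by nlinarith only [hk1]) (by nlinarith only [hk1, hk2])
  linarith only [hk1, hk2, q1, q2, q3, hp, hp', p1, p1', p2, p2', p4, p4']

theorem trial_estimate_mono {f ψ u : ℝ → ℝ} {k w w' : ℝ} (hf : ContDiff ℝ 1 f)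
    (hψ : Continuous ψ) (hfac : ∀ x, f x = ψ x * u x) (hu1 : ∀ x, u x ^ 2 ≤ 1) (hw : w ≤ w')
    (h : 0 ≤ ∫ x in (0:ℝ)..π, (k ^ 2 * deriv f x ^ 2 - (0.811 + w) * f x ^ 2 + w * ψ x ^ 2)) :
    0 ≤ ∫ x in (0:ℝ)..π, (k ^ 2 * deriv f x ^ 2 - (0.811 + w') * f x ^ 2 + w' * ψ x ^ 2) := by
  have hfc := hf.continuous
  have hfd : Continuous (deriv f) := hf.continuous_deriv le_rfl
  refine h.trans (intervalIntegral.integral_mono_on pi_pos.le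
    (Continuous.intervalIntegrable (by fun_prop) _ _)
    (Continuous.intervalIntegrable (by fun_prop) _ _) fun x _ => ?_)
  have h1 : f x ^ 2 ≤ ψ x ^ 2 := by
    rw [hfac, mul_pow]
    exact mul_le_of_le_one_right (sq_nonneg _) (hu1 x)
  nlinarith [mul_nonneg (sub_nonneg.2 hw) (sub_nonneg.2 h1)]

set_option maxHeartbeats 2000000 in
theorem trial_estimate_of_le {f ψ u : ℝ → ℝ} {k : ℝ} (hf : ContDiff ℝ 1 f)
    (hψ : Continuous ψ) (hu : Continuous u) (hfac : ∀ x, f x = ψ x * u x)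
    (hu0 : ∀ x ∈ Set.Icc 0 π, 0 ≤ u x)
    (hu1 : ∀ x, u x ^ 2 ≤ 1) (hf0 : f 0 = 0) (hfπ : f π = 0)
    (hM : ∫ x in (0:ℝ)..π, u x ≤ π * (2 * k - 1)) (hk1 : 0.5 ≤ k) (hk2 : k ≤ 0.7875) :
    0 ≤ ∫ x in (0:ℝ)..π, (k ^ 2 * deriv f x ^ 2 - (0.811 + 0.189) * f x ^ 2 + 0.189 * ψ x ^ 2) := by
  have hk0 : 0 ≤ k := by linarith only [hk1]
  have hp := pi_gt_d6.le
  have hp' := pi_lt_d6.le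
  have p1 := mul_nonneg (sub_nonneg.2 hp) hk0
  have p1' := mul_nonneg (sub_nonneg.2 hp') hk0
  have p2 := mul_nonneg (sub_nonneg.2 hp) (pow_nonneg hk0 2)
  have p2' := mul_nonneg (sub_nonneg.2 hp') (pow_nonneg hk0 2)
  have p4 := mul_nonneg (sub_nonneg.2 hp) (pow_nonneg hk0 4)
  have p4' := mul_nonneg (sub_nonneg.2 hp') (pow_nonneg hk0 4)
  rcases le_total k 0.54 with hk2 | hk1
  · refine trial_estimate_mono (w := 0.08) hf hψ hfac hu1 (by norm_num) ?_
    refine integral_nonneg_of_trial_sin (c := 0.21) (P := 1.81405) (y := 0.02048) (wm := 0.47)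
      (b2 := 2.48) (b3 := -0.15) (w0 := 0.41) (n1 := -0.06) hf hψ hu hfac hu0 hf0 hfπ hM
      (by norm_num) (by norm_num) (by norm_num) (by norm_num) (by norm_num) (by positivity)
      (by norm_num) (by norm_num) (by norm_num) (by norm_num) (by nlinarith only [hk1])
      rfl rfl rfl rfl rfl rfl rfl rfl ?_
    have q1 := mul_nonneg (sub_nonneg.2 hk1) (sub_nonneg.2 hk2)
    have q2 := sq_nonneg (k - 0.540)
    have q3 : 0 ≤ (k ^ 2 - 0.5 ^ 2) * (0.54 ^ 2 - k ^ 2) :=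
      mul_nonneg (by nlinarith only [hk1]) (by nlinarith only [hk1, hk2])
    linarith only [hk1, hk2, q1, q2, q3, hp, hp', p1, p1', p2, p2', p4, p4']
  rcases le_total k 0.6 with hk2 | hk1
  · refine trial_estimate_mono (w := 0.1) hf hψ hfac hu1 (by norm_num) ?_
    refine integral_nonneg_of_trial_sin (c := 0.28) (P := 1.27551) (y := 0.05446) (wm := 0.63)
      (b2 := 2.16) (b3 := -0.17) (w0 := 0.59) (n1 := -0.04) hf hψ hu hfac hu0 hf0 hfπ hM
      (by norm_num) (by norm_num) (by norm_num) (by norm_num) (by norm_num) (by positivity)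
      (by norm_num) (by norm_num) (by norm_num) (by norm_num) (by nlinarith only [hk1])
      rfl rfl rfl rfl rfl rfl rfl rfl ?_
    have q1 := mul_nonneg (sub_nonneg.2 hk1) (sub_nonneg.2 hk2)
    have q2 := sq_nonneg (k - 0.600)
    have q3 : 0 ≤ (k ^ 2 - 0.54 ^ 2) * (0.6 ^ 2 - k ^ 2) :=
      mul_nonneg (by nlinarith only [hk1]) (by nlinarith only [hk1, hk2])
    linarith only [hk1, hk2, q1, q2, q3, hp, hp', p1, p1', p2, p2', p4, p4']
  rcases le_total k 0.69 with hk2 | hk1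
  · refine integral_nonneg_of_trial_sin (c := 0.43) (P := 1.02217) (y := 0.09898) (wm := 0.76)
      (b2 := 1.60) (b3 := -0.20) (w0 := 0.76) (n1 := 0) hf hψ hu hfac hu0 hf0 hfπ hM
      (by norm_num) (by norm_num) (by norm_num) (by norm_num) (by norm_num) (by positivity)
      (by norm_num) (by norm_num) (by norm_num) (by norm_num) (by nlinarith only [hk1])
      rfl rfl rfl rfl rfl rfl rfl rfl ?_
    have q1 := mul_nonneg (sub_nonneg.2 hk1) (sub_nonneg.2 hk2)
    have q2 := sq_nonneg (k - 0.600)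
    have q3 : 0 ≤ (k ^ 2 - 0.6 ^ 2) * (0.69 ^ 2 - k ^ 2) :=
      mul_nonneg (by nlinarith only [hk1]) (by nlinarith only [hk1, hk2])
    linarith only [hk1, hk2, q1, q2, q3, hp, hp', p1, p1', p2, p2', p4, p4']
  rcases le_total k 0.75 with hk2 | hk1
  · refine integral_nonneg_of_trial_sin (c := 0.53) (P := 0.67283) (y := 0.14712) (wm := 1.03)
      (b2 := 1.20) (b3 := -0.27) (w0 := 1.03) (n1 := 0.18) hf hψ hu hfac hu0 hf0 hfπ hM
      (by norm_num) (by norm_num) (by norm_num) (by norm_num) (by norm_num) (by positivity)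
      (by norm_num) (by norm_num) (by norm_num) (by norm_num) (by nlinarith only [hk1])
      rfl rfl rfl rfl rfl rfl rfl rfl ?_
    have q1 := mul_nonneg (sub_nonneg.2 hk1) (sub_nonneg.2 hk2)
    have q2 := sq_nonneg (k - 0.750)
    have q3 : 0 ≤ (k ^ 2 - 0.69 ^ 2) * (0.75 ^ 2 - k ^ 2) :=
      mul_nonneg (by nlinarith only [hk1]) (by nlinarith only [hk1, hk2])
    linarith only [hk1, hk2, q1, q2, q3, hp, hp', p1, p1', p2, p2', p4, p4']
  refine integral_nonneg_of_trial_sin (c := 0.65) (P := 0.44733) (y := 0.22612) (wm := 1.23)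
    (b2 := 0.83) (b3 := -0.25) (w0 := 1.23) (n1 := 0.36) hf hψ hu hfac hu0 hf0 hfπ hM
    (by norm_num) (by norm_num) (by norm_num) (by norm_num) (by norm_num) (by positivity)
    (by norm_num) (by norm_num) (by norm_num) (by norm_num) (by nlinarith only [hk1])
    rfl rfl rfl rfl rfl rfl rfl rfl ?_
  have q1 := mul_nonneg (sub_nonneg.2 hk1) (sub_nonneg.2 hk2)
  have q2 := sq_nonneg (k - 0.787)
  have q3 : 0 ≤ (k ^ 2 - 0.75 ^ 2) * (0.7875 ^ 2 - k ^ 2) :=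
    mul_nonneg (by nlinarith only [hk1]) (by nlinarith only [hk1, hk2])
  linarith only [hk1, hk2, q1, q2, q3, hp, hp', p1, p1', p2, p2', p4, p4']

theorem hasDerivAt_first_mode (A B x : ℝ) :
    HasDerivAt (fun x => A * cos x + B * sin x) (B * cos x - A * sin x) x := by
  refine (((hasDerivAt_cos x).const_mul A).add ((hasDerivAt_sin x).const_mul B)).congr_deriv ?_
  ring

theorem integral_sq_first_mode (A B a b : ℝ) :
    ∫ x in a..b, (A * cos x + B * sin x) ^ 2 =
      (A ^ 2 + B ^ 2) * (b - a) / 2 + ((A ^ 2 - B ^ 2) * (sin b * cos b - sin a * cos a) / 2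
        + A * B * (sin b ^ 2 - sin a ^ 2)) := by
  have h : ∀ x ∈ Set.uIcc a b, HasDerivAt
      (fun x => (A ^ 2 + B ^ 2) * x / 2 + ((A ^ 2 - B ^ 2) * (sin x * cos x) / 2
        + A * B * sin x ^ 2)) ((A * cos x + B * sin x) ^ 2) x := by
    intro x _
    have hs := hasDerivAt_sin x
    have hc := hasDerivAt_cos x
    refine ((((hasDerivAt_id x).const_mul (A ^ 2 + B ^ 2)).div_const 2).add
      ((((hs.mul hc).const_mul (A ^ 2 - B ^ 2)).div_const 2).add
        ((hs.pow 2).const_mul (A * B)))).congr_deriv ?_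
    have e := sin_sq_add_cos_sq x
    push_cast
    linear_combination (-(A ^ 2 + B ^ 2) / 2) * e
  rw [intervalIntegral.integral_eq_sub_of_hasDerivAt h
    (Continuous.intervalIntegrable (by fun_prop) _ _)]
  ring

theorem integral_sq_first_mode_two_pi (A B : ℝ) :
    ∫ x in (0:ℝ)..(2 * π), (A * cos x + B * sin x) ^ 2 = (A ^ 2 + B ^ 2) * π := by
  rw [integral_sq_first_mode]
  simp
  ring

/-- Subtracting the first Fourier modes. -/
theorem exists_first_mode {g : ℝ → ℝ} (hg : ContDiff ℝ 1 g) (hper : g (2 * π) = g 0)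
    (h0 : ∫ x in (0:ℝ)..(2 * π), g x = 0) :
    ∃ A B : ℝ, 3 * ∫ x in (0:ℝ)..(2 * π), (g x - (A * cos x + B * sin x)) ^ 2 ≤
      ∫ x in (0:ℝ)..(2 * π), (deriv g x ^ 2 - g x ^ 2) := by
  have hgc := hg.continuous
  have hgd : Continuous (deriv g) := hg.continuous_deriv le_rfl
  have I : ∀ g : ℝ → ℝ, Continuous g → IntervalIntegrable g MeasureTheory.volume 0 (2 * π) :=
    fun g hg => hg.intervalIntegrable _ _
  set A : ℝ := (∫ x in (0:ℝ)..(2 * π), g x * cos x) / π with hA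
  set B : ℝ := (∫ x in (0:ℝ)..(2 * π), g x * sin x) / π with hB
  refine ⟨A, B, ?_⟩
  set r : ℝ → ℝ := fun x => g x - (A * cos x + B * sin x) with hr
  have hrC : ContDiff ℝ 1 r := by fun_prop
  have hrc := hrC.continuous
  have hrd : Continuous (deriv r) := hrC.continuous_deriv le_rfl
  have hrD : ∀ x, HasDerivAt r (deriv r x) x := fun x =>
    (hrC.differentiable one_ne_zero x).hasDerivAt
  have hgr : ∀ x, deriv g x = (B * cos x - A * sin x) + deriv r x := by
    intro x
    have : HasDerivAt g ((B * cos x - A * sin x) + deriv r x) x := by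
      refine ((hasDerivAt_first_mode A B x).add (hrD x)).congr_of_eventuallyEq
        (.of_forall fun y => ?_)
      simp [hr]
    exact this.deriv
  have hrper : r (2 * π) = r 0 := by simp [hr, hper]
  have hcos2 : ∫ x in (0:ℝ)..(2 * π), cos x ^ 2 = π := by
    simp
  have hsin2 : ∫ x in (0:ℝ)..(2 * π), sin x ^ 2 = π := by
    simp
  have hsc : ∫ x in (0:ℝ)..(2 * π), sin x * cos x = 0 := by simp
  have r0 : ∫ x in (0:ℝ)..(2 * π), r x = 0 := by
    simp only [hr]
    rw [intervalIntegral.integral_sub (I _ (by fun_prop)) (I _ (by fun_prop)),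
      intervalIntegral.integral_add (I _ (by fun_prop)) (I _ (by fun_prop)), h0]
    simp
  have rc : ∫ x in (0:ℝ)..(2 * π), r x * cos x = 0 := by
    have e : (fun x => r x * cos x) =
        fun x => g x * cos x - (A * cos x ^ 2 + B * (sin x * cos x)) := by
      funext x; simp only [hr]; ring
    rw [e, intervalIntegral.integral_sub (I _ (by fun_prop)) (I _ (by fun_prop)),
      intervalIntegral.integral_add (I _ (by fun_prop)) (I _ (by fun_prop)),
      intervalIntegral.integral_const_mul, intervalIntegral.integral_const_mul, hcos2, hsc, hA,
      div_mul_cancel₀ _ pi_ne_zero]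
    ring
  have rs : ∫ x in (0:ℝ)..(2 * π), r x * sin x = 0 := by
    have e : (fun x => r x * sin x) =
        fun x => g x * sin x - (A * (sin x * cos x) + B * sin x ^ 2) := by
      funext x; simp only [hr]; ring
    rw [e, intervalIntegral.integral_sub (I _ (by fun_prop)) (I _ (by fun_prop)),
      intervalIntegral.integral_add (I _ (by fun_prop)) (I _ (by fun_prop)),
      intervalIntegral.integral_const_mul, intervalIntegral.integral_const_mul, hsin2, hsc, hB,
      div_mul_cancel₀ _ pi_ne_zero]
    ring
  have h4 := wirtinger_four hrC hrper r0 rc rs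
  have hcross : ∫ x in (0:ℝ)..(2 * π), ((-(A * cos x + B * sin x)) * (2 * r x +
      (A * cos x + B * sin x)) + (B * cos x - A * sin x) * (2 * deriv r x +
      (B * cos x - A * sin x))) = 0 := by
    have hD : ∀ x ∈ Set.uIcc 0 (2 * π), HasDerivAt
        (fun x => (B * cos x - A * sin x) * (2 * r x + (A * cos x + B * sin x)))
        ((-(A * cos x + B * sin x)) * (2 * r x + (A * cos x + B * sin x)) +
          (B * cos x - A * sin x) * (2 * deriv r x + (B * cos x - A * sin x))) x := by
      intro x _
      have h1 : HasDerivAt (fun x => B * cos x - A * sin x) (-(A * cos x + B * sin x)) x := by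
        refine (((hasDerivAt_cos x).const_mul B).sub
          ((hasDerivAt_sin x).const_mul A)).congr_deriv ?_
        ring
      exact h1.mul (((hrD x).const_mul 2).add (hasDerivAt_first_mode A B x))
    rw [intervalIntegral.integral_eq_sub_of_hasDerivAt hD (I _ (by fun_prop))]
    simp [hrper]
  have e : (fun x => deriv g x ^ 2 - g x ^ 2) = fun x => (deriv r x ^ 2 - r x ^ 2) +
      ((-(A * cos x + B * sin x)) * (2 * r x +
      (A * cos x + B * sin x)) + (B * cos x - A * sin x) * (2 * deriv r x +
      (B * cos x - A * sin x))) := by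
    funext x
    rw [hgr]
    simp only [hr]
    ring
  rw [e, intervalIntegral.integral_add (I _ (by fun_prop)) (I _ (by fun_prop)), hcross,
    intervalIntegral.integral_sub (I _ (by fun_prop)) (I _ (by fun_prop))]
  linarith

theorem sin_le_of_le_27 {t : ℝ} (h0 : 0 ≤ t) (h : t ≤ 0.27 * π) : sin t ≤ 0.78 := by
  have hp := pi_gt_d6
  have hp' := pi_lt_d6
  have h1 : sin t ≤ sin (π / 4 + 0.02 * π) :=
    sin_le_sin_of_le_of_le_pi_div_two (by linarith) (by linarith) (by linarith)
  rw [sin_add, sin_pi_div_four, cos_pi_div_four] at h1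
  have h2 : sin (0.02 * π) ≤ 0.02 * π := sin_le (by positivity)
  have h3 := cos_le_one (0.02 * π)
  have h4 : √2 ≤ 1.415 := by
    rw [sqrt_le_left (by norm_num)]; norm_num
  have h5 : 0 ≤ √2 := sqrt_nonneg 2
  nlinarith

theorem sq_add_sq_mul_le_integral_sq_first_mode (A B : ℝ) {ℓ : ℝ} (h1 : π ≤ ℓ)
    (h2 : ℓ ≤ 1.27 * π) :
    (A ^ 2 + B ^ 2) * 0.756 ≤ ∫ x in ℓ..(2 * π), (A * cos x + B * sin x) ^ 2 := by
  rw [integral_sq_first_mode]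
  have hs : -sin ℓ ≤ 0.78 := by
    rw [← sin_sub_pi]
    exact sin_le_of_le_27 (by linarith) (by linarith)
  have hs0 : sin ℓ ≤ 0 := by
    have : 0 ≤ sin (ℓ - π) := sin_nonneg_of_nonneg_of_le_pi (by linarith) (by linarith [pi_pos])
    rw [sin_sub_pi] at this
    linarith
  have hp := pi_gt_d6
  have hq : -((A ^ 2 - B ^ 2) * cos ℓ + 2 * A * B * sin ℓ) ≤ A ^ 2 + B ^ 2 := by
    refine le_trans (neg_le_abs _) (abs_le_of_sq_le_sq ?_ (by positivity))
    have e := sin_sq_add_cos_sq ℓ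
    have : (A ^ 2 + B ^ 2) ^ 2 - ((A ^ 2 - B ^ 2) * cos ℓ + 2 * A * B * sin ℓ) ^ 2 =
        ((A ^ 2 - B ^ 2) * sin ℓ - 2 * A * B * cos ℓ) ^ 2 := by
      linear_combination (-(A ^ 2 + B ^ 2) ^ 2) * e
    nlinarith [sq_nonneg ((A ^ 2 - B ^ 2) * sin ℓ - 2 * A * B * cos ℓ)]
  have hn : 0 ≤ A ^ 2 + B ^ 2 := by positivity
  have h3 := mul_le_mul_of_nonneg_left hq (neg_nonneg.2 hs0)
  have h4 := mul_le_mul_of_nonneg_right hs hn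
  have h5 : (A ^ 2 + B ^ 2) * (0.73 * 3.141592) ≤ (A ^ 2 + B ^ 2) * (2 * π - ℓ) :=
    mul_le_mul_of_nonneg_left (by linarith) hn
  rw [sin_two_pi, cos_two_pi]
  nlinarith

/-- Wirtinger's inequality with an additional weight on the arc `[0, ℓ]`. -/
theorem weighted_wirtinger {g : ℝ → ℝ} (hg : ContDiff ℝ 1 g) (hper : g (2 * π) = g 0)
    (h0 : ∫ x in (0:ℝ)..(2 * π), g x = 0) {ℓ : ℝ} (h1 : π ≤ ℓ) (h2 : ℓ ≤ 1.27 * π) :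
    0.24 * (∫ x in (0:ℝ)..ℓ, g x ^ 2) ≤
      ∫ x in (0:ℝ)..(2 * π), (deriv g x ^ 2 - 0.811 * g x ^ 2) := by
  obtain ⟨A, B, hAB⟩ := exists_first_mode hg hper h0
  have hgc := hg.continuous
  have hgd : Continuous (deriv g) := hg.continuous_deriv le_rfl
  have I : ∀ (a b : ℝ) (g : ℝ → ℝ), Continuous g →
    IntervalIntegrable g MeasureTheory.volume a b := fun a b g hg => hg.intervalIntegrable _ _
  have hm := sq_add_sq_mul_le_integral_sq_first_mode A B h1 h2
  have hfull := integral_sq_first_mode_two_pi A B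
  have hp := pi_gt_d6
  have hp' := pi_lt_d6
  have split : ∀ F : ℝ → ℝ, Continuous F → (∫ x in (0:ℝ)..ℓ, F x) + ∫ x in ℓ..(2 * π), F x =
      ∫ x in (0:ℝ)..(2 * π), F x := fun F hF =>
    intervalIntegral.integral_add_adjacent_intervals (I _ _ _ hF) (I _ _ _ hF)
  set G : ℝ → ℝ := fun x => A * cos x + B * sin x with hG
  have hGc : Continuous G := by fun_prop
  change 3 * ∫ x in (0:ℝ)..(2 * π), (g x - G x) ^ 2 ≤ _ at hAB
  change _ ≤ ∫ x in ℓ..(2 * π), G x ^ 2 at hm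
  change ∫ x in (0:ℝ)..(2 * π), G x ^ 2 = _ at hfull
  have hplus : ∫ x in (0:ℝ)..ℓ, g x ^ 2 ≤
      ∫ x in (0:ℝ)..ℓ, (1.08 * G x ^ 2 + 13.5 * (g x - G x) ^ 2) :=
    intervalIntegral.integral_mono_on (by linarith [pi_pos]) (I _ _ _ (by fun_prop))
      (I _ _ _ (by fun_prop)) fun x _ => by nlinarith [sq_nonneg (2 * G x - 25 * (g x - G x))]
  have hminus : ∫ x in ℓ..(2 * π), (0.92 * G x ^ 2 - 11.5 * (g x - G x) ^ 2) ≤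
      ∫ x in ℓ..(2 * π), g x ^ 2 :=
    intervalIntegral.integral_mono_on (by linarith [pi_pos]) (I _ _ _ (by fun_prop))
      (I _ _ _ (by fun_prop)) fun x _ => by nlinarith [sq_nonneg (2 * G x + 25 * (g x - G x))]
  rw [intervalIntegral.integral_add (I _ _ _ (by fun_prop)) (I _ _ _ (by fun_prop)),
    intervalIntegral.integral_const_mul, intervalIntegral.integral_const_mul] at hplus
  rw [intervalIntegral.integral_sub (I _ _ _ (by fun_prop)) (I _ _ _ (by fun_prop)),
    intervalIntegral.integral_const_mul, intervalIntegral.integral_const_mul] at hminus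
  rw [intervalIntegral.integral_sub (I _ _ _ (by fun_prop)) (I _ _ _ (by fun_prop))] at hAB
  rw [intervalIntegral.integral_sub (I _ _ _ (by fun_prop)) (I _ _ _ (by fun_prop)),
    intervalIntegral.integral_const_mul]
  have s1 := split (fun x => g x ^ 2) (by fun_prop)
  have s2 := split (fun x => G x ^ 2) (by fun_prop)
  have s3 := split (fun x => (g x - G x) ^ 2) (by fun_prop)
  have n1 : 0 ≤ ∫ x in (0:ℝ)..ℓ, (g x - G x) ^ 2 :=
    intervalIntegral.integral_nonneg (by linarith) fun x _ => sq_nonneg _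
  have n2 : 0 ≤ ∫ x in ℓ..(2 * π), (g x - G x) ^ 2 :=
    intervalIntegral.integral_nonneg (by linarith) fun x _ => sq_nonneg _
  have hn : (A ^ 2 + B ^ 2) * π ≤ (A ^ 2 + B ^ 2) * 3.141593 :=
    mul_le_mul_of_nonneg_left hp'.le (by positivity)
  have hn0 : 0 ≤ A ^ 2 + B ^ 2 := by positivity
  linarith

theorem arc_estimate {f ψ u : ℝ → ℝ} {ℓ : ℝ} (hf : ContDiff ℝ 1 f)
    (hψ : Continuous ψ) (hu : Continuous u) (hfac : ∀ x, f x = ψ x * u x)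
    (hu0 : ∀ x ∈ Set.Icc 0 ℓ, 0 ≤ u x) (hu1 : ∀ x, u x ^ 2 ≤ 1) (hf0 : f 0 = 0) (hfℓ : f ℓ = 0)
    (hM : ∫ x in (0:ℝ)..ℓ, u x ≤ 2 * π - ℓ) (h1 : π ≤ 0.901 * ℓ) (h2 : ℓ ≤ 2 * π) :
    (0.7875 * ℓ ≤ π ∧
      0 ≤ ∫ x in (0:ℝ)..ℓ, (deriv f x ^ 2 - (0.811 + 0.24) * f x ^ 2 + 0.24 * ψ x ^ 2)) ∨
    0 ≤ ∫ x in (0:ℝ)..ℓ, (deriv f x ^ 2 - (0.811 + 0.189) * f x ^ 2 + 0.189 * ψ x ^ 2) := by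
  have hπ := pi_pos
  have hℓ : 0 < ℓ := by linarith
  set q : ℝ := ℓ / π with hq
  have hq0 : 0 < q := by positivity
  have hqπ : q * π = ℓ := div_mul_cancel₀ _ hπ.ne'
  have hkq : q⁻¹ = π / ℓ := by rw [hq, inv_div]
  have hscale : ∀ F : ℝ → ℝ, ∫ x in (0:ℝ)..π, F (q * x) = q⁻¹ * ∫ x in (0:ℝ)..ℓ, F x := by
    intro F
    rw [intervalIntegral.integral_comp_mul_left _ hq0.ne', mul_zero, hqπ, smul_eq_mul]
  have hF : ContDiff ℝ 1 fun x => f (q * x) := hf.comp (by fun_prop)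
  have hderiv : ∀ x, deriv (fun x => f (q * x)) x = q * deriv f (q * x) := fun x => by
    rw [deriv_comp_mul_left, smul_eq_mul]
  have hmem : ∀ x ∈ Set.Icc 0 π, q * x ∈ Set.Icc 0 ℓ := fun x hx =>
    ⟨mul_nonneg hq0.le hx.1, by rw [← hqπ]; exact mul_le_mul_of_nonneg_left hx.2 hq0.le⟩
  have hMq : ∫ x in (0:ℝ)..π, u (q * x) ≤ π * (2 * q⁻¹ - 1) := by
    rw [hscale u]
    calc q⁻¹ * ∫ x in (0:ℝ)..ℓ, u x ≤ q⁻¹ * (2 * π - ℓ) :=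
          mul_le_mul_of_nonneg_left hM (inv_nonneg.2 hq0.le)
      _ = π * (2 * q⁻¹ - 1) := by rw [hkq]; field_simp
  have hconv : ∀ w : ℝ, 0 ≤ ∫ x in (0:ℝ)..π, (q⁻¹ ^ 2 * deriv (fun x => f (q * x)) x ^ 2
      - (0.811 + w) * f (q * x) ^ 2 + w * ψ (q * x) ^ 2) →
      0 ≤ ∫ x in (0:ℝ)..ℓ, (deriv f x ^ 2 - (0.811 + w) * f x ^ 2 + w * ψ x ^ 2) := by
    intro w h
    have e : (fun x => q⁻¹ ^ 2 * deriv (fun x => f (q * x)) x ^ 2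
        - (0.811 + w) * f (q * x) ^ 2 + w * ψ (q * x) ^ 2) = fun x =>
        (fun y => deriv f y ^ 2 - (0.811 + w) * f y ^ 2 + w * ψ y ^ 2) (q * x) := by
      funext x
      rw [hderiv]
      field_simp
    rw [e, hscale fun y => deriv f y ^ 2 - (0.811 + w) * f y ^ 2 + w * ψ y ^ 2] at h
    exact nonneg_of_mul_nonneg_right h (inv_pos.2 hq0)
  have hk1 : q⁻¹ ≤ 0.901 := by rw [hkq, div_le_iff₀ hℓ]; exact h1
  have hk2 : 0.5 ≤ q⁻¹ := by rw [hkq, le_div_iff₀ hℓ]; linarith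
  have hψ' : Continuous fun x => ψ (q * x) := by fun_prop
  have hu' : Continuous fun x => u (q * x) := by fun_prop
  rcases le_total 0.7875 q⁻¹ with h | h
  · refine Or.inl ⟨?_, hconv _ ?_⟩
    · rwa [hkq, le_div_iff₀ hℓ] at h
    · exact trial_estimate_of_ge hF hψ' hu' (fun x => hfac _) (fun x hx => hu0 _ (hmem x hx))
        (by simpa using hf0) (by simpa [hqπ] using hfℓ) hMq h hk1
  · refine Or.inr (hconv _ ?_)
    exact trial_estimate_of_le hF hψ' hu' (fun x => hfac _) (fun x hx => hu0 _ (hmem x hx))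
      (fun x => hu1 _) (by simpa using hf0) (by simpa [hqπ] using hfℓ) hMq hk2 h

theorem dirichlet_poincare_of_le {h : ℝ → ℝ} (hh : ContDiff ℝ 1 h) {a b : ℝ} (hab : a < b)
    (ha : h a = 0) (hb : h b = 0) (hle : 0.901 * (b - a) ≤ π) :
    0.811 * ∫ x in a..b, h x ^ 2 ≤ ∫ x in a..b, deriv h x ^ 2 := by
  refine le_trans (mul_le_mul_of_nonneg_right ?_ ?_) (dirichlet_poincare hh hab ha hb)
  · have : 0.901 ≤ π / (b - a) := (le_div_iff₀ (sub_pos.2 hab)).2 hle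
    nlinarith
  · exact intervalIntegral.integral_nonneg hab.le fun x _ => sq_nonneg _

theorem deriv_mul_cos_comp {φ ψ : ℝ → ℝ} (hφ : ContDiff ℝ 1 φ) (hψ : ContDiff ℝ 1 ψ) (x : ℝ) :
    deriv (fun x => ψ x * cos (φ x)) x =
      deriv ψ x * cos (φ x) - ψ x * deriv φ x * sin (φ x) := by
  have h1 := (hφ.differentiable one_ne_zero x).hasDerivAt
  have h2 := (hψ.differentiable one_ne_zero x).hasDerivAt
  have h : HasDerivAt (fun x => ψ x * cos (φ x))
      (deriv ψ x * cos (φ x) + ψ x * (-sin (φ x) * deriv φ x)) x := h2.mul h1.cos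
  rw [h.deriv]
  ring

theorem deriv_mul_sin_comp {φ ψ : ℝ → ℝ} (hφ : ContDiff ℝ 1 φ) (hψ : ContDiff ℝ 1 ψ) (x : ℝ) :
    deriv (fun x => ψ x * sin (φ x)) x =
      deriv ψ x * sin (φ x) + ψ x * deriv φ x * cos (φ x) := by
  have h1 := (hφ.differentiable one_ne_zero x).hasDerivAt
  have h2 := (hψ.differentiable one_ne_zero x).hasDerivAt
  have h : HasDerivAt (fun x => ψ x * sin (φ x))
      (deriv ψ x * sin (φ x) + ψ x * (cos (φ x) * deriv φ x)) x := h2.mul h1.sin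
  rw [h.deriv]
  ring

/-- The energy bound when the arc `[ℓ, 2π]`, on which `cos ∘ φ ≤ 0`, is short. -/
theorem energy_ge_of_arcs {φ ψ : ℝ → ℝ} {ℓ : ℝ} (hφ : ContDiff ℝ 1 φ) (hmono : Monotone φ)
    (hφ0 : φ 0 = -(π / 2)) (hφℓ : φ ℓ = π / 2) (hφ2 : φ (2 * π) = 3 * π / 2)
    (hℓ0 : 0 < ℓ) (hℓ2 : ℓ < 2 * π) (hψ : ContDiff ℝ 1 ψ) (hψper : ψ (2 * π) = ψ 0)
    (hcos : ∫ s in (0:ℝ)..(2 * π), cos (φ s) = 0)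
    (hsin : ∫ s in (0:ℝ)..(2 * π), ψ s * sin (φ s) = 0) (hshort : 0.901 * (2 * π - ℓ) ≤ π) :
    0.811 * ∫ s in (0:ℝ)..(2 * π), ψ s ^ 2 ≤
      ∫ s in (0:ℝ)..(2 * π), (deriv ψ s ^ 2 + deriv φ s ^ 2 * ψ s ^ 2) := by
  have hπ := pi_pos
  set f : ℝ → ℝ := fun x => ψ x * cos (φ x) with hf
  set g : ℝ → ℝ := fun x => ψ x * sin (φ x) with hg
  have hfC : ContDiff ℝ 1 f := hψ.mul hφ.cos
  have hgC : ContDiff ℝ 1 g := hψ.mul hφ.sin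
  have hφc := hφ.continuous
  have hψc := hψ.continuous
  have hfc := hfC.continuous
  have hgc := hgC.continuous
  have hfd : Continuous (deriv f) := hfC.continuous_deriv le_rfl
  have hgd : Continuous (deriv g) := hgC.continuous_deriv le_rfl
  have hsq : ∀ x, ψ x ^ 2 = f x ^ 2 + g x ^ 2 := fun x => by
    simp only [hf, hg]
    linear_combination (-(ψ x ^ 2)) * sin_sq_add_cos_sq (φ x)
  have hsqd : ∀ x, deriv ψ x ^ 2 + deriv φ x ^ 2 * ψ x ^ 2 = deriv f x ^ 2 + deriv g x ^ 2 :=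
    fun x => by
      rw [deriv_mul_cos_comp hφ hψ, deriv_mul_sin_comp hφ hψ]
      linear_combination
        (-(deriv ψ x ^ 2 + deriv φ x ^ 2 * ψ x ^ 2)) * sin_sq_add_cos_sq (φ x)
  have I : ∀ (a b : ℝ) (g : ℝ → ℝ), Continuous g →
    IntervalIntegrable g MeasureTheory.volume a b := fun a b g hg => hg.intervalIntegrable _ _
  have split : ∀ F : ℝ → ℝ, Continuous F → (∫ x in (0:ℝ)..ℓ, F x) + ∫ x in ℓ..(2 * π), F x =
      ∫ x in (0:ℝ)..(2 * π), F x := fun F hF =>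
    intervalIntegral.integral_add_adjacent_intervals (I _ _ _ hF) (I _ _ _ hF)
  have hf0 : f 0 = 0 := by simp [hf, hφ0]
  have hfℓ : f ℓ = 0 := by simp [hf, hφℓ]
  have hf2 : f (2 * π) = 0 := by
    have : cos (3 * π / 2) = 0 := by
      rw [show 3 * π / 2 = π / 2 + π by ring, cos_add_pi, cos_pi_div_two, neg_zero]
    simp [hf, hφ2, this]
  have hgper : g (2 * π) = g 0 := by
    have : sin (3 * π / 2) = -1 := by
      rw [show 3 * π / 2 = π / 2 + π by ring, sin_add_pi, sin_pi_div_two]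
    simp [hg, hφ2, hφ0, this, hψper]
  have hminus := dirichlet_poincare_of_le hfC hℓ2 hfℓ hf2 hshort
  have hwirt := wirtinger hgC hgper hsin
  have s1 := split (fun x => f x ^ 2) (by fun_prop)
  have s2 := split (fun x => deriv f x ^ 2) (by fun_prop)
  have s3 := split (fun x => g x ^ 2) (by fun_prop)
  have n1 : 0 ≤ ∫ x in (0:ℝ)..ℓ, g x ^ 2 :=
    intervalIntegral.integral_nonneg hℓ0.le fun x _ => sq_nonneg _
  have n2 : 0 ≤ ∫ x in ℓ..(2 * π), g x ^ 2 :=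
    intervalIntegral.integral_nonneg hℓ2.le fun x _ => sq_nonneg _
  simp only [hsqd]
  simp only [hsq]
  rw [intervalIntegral.integral_add (I _ _ _ (by fun_prop)) (I _ _ _ (by fun_prop)),
    intervalIntegral.integral_add (I _ _ _ (by fun_prop)) (I _ _ _ (by fun_prop))]
  rcases le_total (0.901 * ℓ) π with hle | hle
  · have hplus := dirichlet_poincare_of_le hfC hℓ0 hf0 hfℓ (by simpa using hle)
    linarith
  · have hM : ∫ x in (0:ℝ)..ℓ, cos (φ x) ≤ 2 * π - ℓ := by
      have h1 := split (fun x => cos (φ x)) (by fun_prop)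
      have h2 : ∫ x in ℓ..(2 * π), (-1 : ℝ) ≤ ∫ x in ℓ..(2 * π), cos (φ x) :=
        intervalIntegral.integral_mono_on hℓ2.le (I _ _ _ (by fun_prop)) (I _ _ _ (by fun_prop))
          fun x _ => neg_one_le_cos _
      rw [intervalIntegral.integral_const, smul_eq_mul] at h2
      linarith
    have hu0 : ∀ x ∈ Set.Icc 0 ℓ, 0 ≤ cos (φ x) := fun x hx =>
      cos_nonneg_of_mem_Icc ⟨hφ0 ▸ hmono hx.1, hφℓ ▸ hmono hx.2⟩
    have hexp : ∀ w : ℝ, ∫ x in (0:ℝ)..ℓ, (deriv f x ^ 2 - (0.811 + w) * f x ^ 2 + w * ψ x ^ 2) =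
        (∫ x in (0:ℝ)..ℓ, deriv f x ^ 2) - 0.811 * (∫ x in (0:ℝ)..ℓ, f x ^ 2)
          + w * ∫ x in (0:ℝ)..ℓ, g x ^ 2 := by
      intro w
      rw [← intervalIntegral.integral_const_mul, ← intervalIntegral.integral_const_mul,
        ← intervalIntegral.integral_sub (I _ _ _ (by fun_prop)) (I _ _ _ (by fun_prop)),
        ← intervalIntegral.integral_add (I _ _ _ (by fun_prop)) (I _ _ _ (by fun_prop))]
      refine intervalIntegral.integral_congr fun x _ => ?_
      simp only [hsq]
      ring
    rcases arc_estimate hfC hψc (by fun_prop) (fun x => rfl) hu0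
        (fun x => cos_sq_le_one _) hf0 hfℓ hM hle hℓ2.le with ⟨h1, h⟩ | h
    · rw [hexp] at h
      have hw := weighted_wirtinger hgC hgper hsin (ℓ := ℓ) (by linarith) (by linarith)
      rw [intervalIntegral.integral_sub (I _ _ _ (by fun_prop)) (I _ _ _ (by fun_prop)),
        intervalIntegral.integral_const_mul] at hw
      linarith
    · rw [hexp] at h
      linarith

theorem integral_comp_add_of_periodic {F : ℝ → ℝ} (hF : ∀ s, F (s + 2 * π) = F s) (a : ℝ) :
    ∫ s in (0:ℝ)..(2 * π), F (s + a) = ∫ s in (0:ℝ)..(2 * π), F s := by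
  have hF' : Function.Periodic F (2 * π) := hF
  rw [intervalIntegral.integral_comp_add_right, zero_add, add_comm (2 * π) a,
    hF'.intervalIntegral_add_eq a 0, zero_add]

theorem energy_ge_of_arc {φ ψ : ℝ → ℝ} {ℓ : ℝ} (hφ : ContDiff ℝ 1 φ) (hmono : Monotone φ)
    (hφper : ∀ s, φ (s + 2 * π) = φ s + 2 * π)
    (hφ0 : φ 0 = -(π / 2)) (hφℓ : φ ℓ = π / 2)
    (hℓ0 : 0 < ℓ) (hℓ2 : ℓ < 2 * π) (hψ : ContDiff ℝ 1 ψ) (hψper : ∀ s, ψ (s + 2 * π) = ψ s)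
    (hcos : ∫ s in (0:ℝ)..(2 * π), cos (φ s) = 0)
    (hsin : ∫ s in (0:ℝ)..(2 * π), ψ s * sin (φ s) = 0) :
    0.811 * ∫ s in (0:ℝ)..(2 * π), ψ s ^ 2 ≤
      ∫ s in (0:ℝ)..(2 * π), (deriv ψ s ^ 2 + deriv φ s ^ 2 * ψ s ^ 2) := by
  have hφ2 : φ (2 * π) = 3 * π / 2 := by
    have := hφper 0
    rw [zero_add, hφ0] at this
    rw [this]; ring
  have hψ2 : ψ (2 * π) = ψ 0 := by simpa using hψper 0
  rcases le_total (0.901 * (2 * π - ℓ)) π with h | h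
  · exact energy_ge_of_arcs hφ hmono hφ0 hφℓ hφ2 hℓ0 hℓ2 hψ hψ2 hcos hsin h
  have hdφ : ∀ s, deriv φ (s + 2 * π) = deriv φ s := fun s => by
    rw [← deriv_comp_add_const, funext hφper, deriv_add_const]
  have hdψ : ∀ s, deriv ψ (s + 2 * π) = deriv ψ s := fun s => by
    rw [← deriv_comp_add_const, funext hψper]
  have key := energy_ge_of_arcs (φ := fun s => φ (s + ℓ) - π) (ψ := fun s => ψ (s + ℓ))
    (ℓ := 2 * π - ℓ) (by fun_prop) (fun x y hxy => by simpa using hmono (by simpa using hxy))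
    (by simp only [zero_add, hφℓ]; ring) (by rw [sub_add_cancel, hφ2]; ring)
    (by rw [add_comm, hφper, hφℓ]; ring) (by linarith) (by linarith) (by fun_prop)
    (by rw [add_comm, hψper, zero_add])
    (by
      simp only [cos_sub_pi]
      rw [integral_comp_add_of_periodic (F := fun s => -cos (φ s))
        (fun s => by rw [hφper, cos_add_two_pi]), intervalIntegral.integral_neg, hcos, neg_zero])
    (by
      simp only [sin_sub_pi]
      rw [integral_comp_add_of_periodic (F := fun s => ψ s * -sin (φ s))
        (fun s => by rw [hφper, sin_add_two_pi, hψper])]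
      simp only [mul_neg]
      rw [intervalIntegral.integral_neg, hsin, neg_zero])
    (by linarith [pi_pos])
  simp only [deriv_sub_const_fun, deriv_comp_add_const] at key
  rwa [integral_comp_add_of_periodic (F := fun s => ψ s ^ 2) (fun s => by rw [hψper]),
    integral_comp_add_of_periodic (F := fun s => deriv ψ s ^ 2 + deriv φ s ^ 2 * ψ s ^ 2)
      (fun s => by rw [hψper, hdφ, hdψ])] at key

theorem energy_ge {φ ψ : ℝ → ℝ} (hφ : ContDiff ℝ 1 φ) (hmono : Monotone φ)
    (hφper : ∀ s, φ (s + 2 * π) = φ s + 2 * π)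
    (hψ : ContDiff ℝ 1 ψ) (hψper : ∀ s, ψ (s + 2 * π) = ψ s)
    (hcos : ∫ s in (0:ℝ)..(2 * π), cos (φ s) = 0) (hsin : ∫ s in (0:ℝ)..(2 * π), sin (φ s) = 0) :
    0.811 * ∫ s in (0:ℝ)..(2 * π), ψ s ^ 2 ≤
      ∫ s in (0:ℝ)..(2 * π), (deriv ψ s ^ 2 + deriv φ s ^ 2 * ψ s ^ 2) := by
  have hπ := pi_pos
  have hφc := hφ.continuous
  have hψc := hψ.continuous
  have I : ∀ g : ℝ → ℝ, Continuous g → IntervalIntegrable g MeasureTheory.volume 0 (2 * π) :=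
    fun g hg => hg.intervalIntegrable _ _
  have hhalf : ∀ a, ∃ b ∈ Set.Icc a (a + 2 * π), φ b = φ a + π := fun a =>
    intermediate_value_Icc (by linarith) hφc.continuousOn
      ⟨by linarith, by rw [hφper]; linarith⟩
  set A : ℝ := ∫ s in (0:ℝ)..(2 * π), ψ s * cos (φ s) with hA
  set B : ℝ := ∫ s in (0:ℝ)..(2 * π), ψ s * sin (φ s) with hB
  obtain ⟨α, hα⟩ : ∃ α, A * cos (φ α) + B * sin (φ α) = 0 := by
    obtain ⟨b, -, hb⟩ := hhalf 0
    have hc : Continuous fun s => A * cos (φ s) + B * sin (φ s) := by fun_prop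
    have hmem : (0:ℝ) ∈ Set.uIcc (A * cos (φ 0) + B * sin (φ 0))
        (A * cos (φ b) + B * sin (φ b)) := by
      rw [hb, cos_add_pi, sin_add_pi, Set.mem_uIcc]
      rcases le_total 0 (A * cos (φ 0) + B * sin (φ 0)) with h | h
      · exact Or.inr ⟨by linarith, h⟩
      · exact Or.inl ⟨h, by linarith⟩
    obtain ⟨α, -, h⟩ := intermediate_value_uIcc hc.continuousOn hmem
    exact ⟨α, h⟩
  obtain ⟨β, ⟨hβ1, hβ2⟩, hβ⟩ := hhalf α
  have hβ1' : α < β := lt_of_le_of_ne hβ1 fun h => by rw [← h] at hβ; linarith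
  have hβ2' : β < α + 2 * π := lt_of_le_of_ne hβ2 fun h => by
    rw [h, hφper] at hβ; linarith
  have hdφ : ∀ s, deriv φ (s + 2 * π) = deriv φ s := fun s => by
    rw [← deriv_comp_add_const, funext hφper, deriv_add_const]
  have hdψ : ∀ s, deriv ψ (s + 2 * π) = deriv ψ s := fun s => by
    rw [← deriv_comp_add_const, funext hψper]
  have key := energy_ge_of_arc (φ := fun s => φ (s + α) - φ α - π / 2) (ψ := fun s => ψ (s + α))
    (ℓ := β - α) (by fun_prop) (fun x y hxy => by simpa using hmono (by simpa using hxy))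
    (fun s => by rw [add_right_comm, hφper]; ring)
    (by simp) (by rw [sub_add_cancel, hβ]; ring) (by linarith) (by linarith)
    (by fun_prop) (fun s => by rw [add_right_comm, hψper])
    (by
      simp only [cos_sub_pi_div_two]
      rw [integral_comp_add_of_periodic (F := fun s => sin (φ s - φ α))
        (fun s => by rw [hφper, add_sub_right_comm, sin_add_two_pi])]
      simp only [sin_sub]
      rw [intervalIntegral.integral_sub (I _ (by fun_prop)) (I _ (by fun_prop)),
        intervalIntegral.integral_mul_const, intervalIntegral.integral_mul_const, hcos, hsin]
      ring)
    (by
      simp only [sin_sub_pi_div_two]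
      rw [integral_comp_add_of_periodic (F := fun s => ψ s * -cos (φ s - φ α))
        (fun s => by rw [hφper, add_sub_right_comm, cos_add_two_pi, hψper])]
      have e : (fun s => ψ s * -cos (φ s - φ α)) = fun s =>
          (-cos (φ α)) * (ψ s * cos (φ s)) + (-sin (φ α)) * (ψ s * sin (φ s)) := by
        funext s
        rw [cos_sub]
        ring
      rw [e, intervalIntegral.integral_add (I _ (by fun_prop)) (I _ (by fun_prop)),
        intervalIntegral.integral_const_mul, intervalIntegral.integral_const_mul, ← hA, ← hB]
      linarith)
  simp only [deriv_sub_const_fun, deriv_comp_add_const] at key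
  rwa [integral_comp_add_of_periodic (F := fun s => ψ s ^ 2) (fun s => by rw [hψper]),
    integral_comp_add_of_periodic (F := fun s => deriv ψ s ^ 2 + deriv φ s ^ 2 * ψ s ^ 2)
      (fun s => by rw [hψper, hdφ, hdψ])] at key

/-- For every test function `ψ`, the Rayleigh quotient `E(φ,ψ)` exceeds `0.81`. -/
theorem rayleigh_gt_081 (φ ψ : ℝ → ℝ)
    (hφ : ContDiff ℝ (⊤ : ℕ∞) φ)
    (hφ' : ∀ s, 0 < deriv φ s)
    (hφper : ∀ s, φ (s + 2 * π) = φ s + 2 * π)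
    (hclose_cos : (∫ s in (0:ℝ)..(2 * π), Real.cos (φ s)) = 0)
    (hclose_sin : (∫ s in (0:ℝ)..(2 * π), Real.sin (φ s)) = 0)
    (hψ : ContDiff ℝ 1 ψ)
    (hψper : ∀ s, ψ (s + 2 * π) = ψ s)
    (hψpos : 0 < ∫ s in (0:ℝ)..(2 * π), ψ s ^ 2) :
    (∫ s in (0:ℝ)..(2 * π), (deriv ψ s ^ 2 + deriv φ s ^ 2 * ψ s ^ 2)) /
        (∫ s in (0:ℝ)..(2 * π), ψ s ^ 2) > 0.81 := by
  have h := energy_ge (hφ.of_le (by exact_mod_cast le_top)) (strictMono_of_deriv_pos hφ').monotone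
    hφper hψ hψper hclose_cos hclose_sin
  rw [gt_iff_lt, lt_div_iff₀ hψpos]
  linarith
end

section
/- For every ν̃ ∈ [0,1] and every Δ ∈ (0, π/2), B₁(ν̃,Δ) > (3 + 2√2)/8, and the infimum of B₁(ν̃,Δ) over ν̃ ∈ [0,1] and Δ ∈ (0, π/2) equals (3 + 2√2)/8. -/
open Real

lemma tan_pi_div_eight_eq : Real.tan (π / 8) = √2 - 1 := by
  have hpos : 0 < Real.tan (π / 8) :=
    Real.tan_pos_of_pos_of_lt_pi_div_two (by positivity) (by linarith [Real.pi_pos])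
  have h := Real.tan_two_mul (x := π / 8)
  rw [show 2 * (π / 8) = π / 4 by ring, Real.tan_pi_div_four] at h
  have hne : 1 - Real.tan (π / 8) ^ 2 ≠ 0 := by
    intro h0
    simp [h0] at h
  rw [eq_div_iff hne] at h
  rw [eq_sub_iff_add_eq, eq_comm, Real.sqrt_eq_iff_mul_self_eq (by norm_num) (by linarith)]
  linarith

lemma cot_pi_div_eight : Real.cot (π / 8) = 1 + √2 := by
  rw [← inv_inv (Real.cot _), Real.cot_inv_eq_tan, tan_pi_div_eight_eq]
  apply inv_eq_of_mul_eq_one_right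
  linarith [Real.mul_self_sqrt (show (0 : ℝ) ≤ 2 by norm_num)]

lemma one_add_sqrt_two_lt_cot {x : ℝ} (hx : 0 < x) (hx' : x < π / 8) :
    1 + √2 < Real.cot x := by
  have hpos : 0 < Real.tan x :=
    Real.tan_pos_of_pos_of_lt_pi_div_two hx (by linarith [Real.pi_pos])
  have hlt : Real.tan x < Real.tan (π / 8) :=
    Real.tan_lt_tan_of_lt_of_lt_pi_div_two (by linarith) (by linarith [Real.pi_pos]) hx'
  rw [← cot_pi_div_eight, ← inv_inv (Real.cot x), ← inv_inv (Real.cot (π / 8)),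
    Real.cot_inv_eq_tan, Real.cot_inv_eq_tan]
  exact inv_strictAnti₀ hpos hlt

lemma inv_two_add_sqrt_two_sq : ((2 + √2) ^ 2)⁻¹ = (3 - 2 * √2) / 2 := by
  have h : √2 ^ 2 = 2 := Real.sq_sqrt (by norm_num)
  apply inv_eq_of_mul_eq_one_right
  nlinarith

lemma inv_four_sub_two_mul_sqrt_two_sq : ((4 - 2 * √2) ^ 2)⁻¹ = (3 + 2 * √2) / 8 := by
  have h : √2 ^ 2 = 2 := Real.sq_sqrt (by norm_num)
  apply inv_eq_of_mul_eq_one_right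
  nlinarith

lemma G_pi_div_two : G (π / 2) = (3 - 2 * √2) / 2 := by
  rw [G, show π / 2 / 4 = π / 8 by ring, cot_pi_div_eight, ← inv_two_add_sqrt_two_sq]
  ring

lemma G_nonneg (Δ : ℝ) : 0 ≤ G Δ := inv_nonneg.2 (sq_nonneg _)

lemma G_lt {Δ : ℝ} (h : Δ ∈ Set.Ioo (0 : ℝ) (π / 2)) : G Δ < (3 - 2 * √2) / 2 := by
  have hc := one_add_sqrt_two_lt_cot (x := Δ / 4) (by linarith [h.1]) (by linarith [h.2])
  rw [← inv_two_add_sqrt_two_sq, G]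
  apply inv_strictAnti₀ (by positivity)
  exact pow_lt_pow_left₀ (by linarith) (by positivity) two_ne_zero

lemma lt_B₁ {ν Δ : ℝ} (hν : ν ∈ Set.Icc (0 : ℝ) 1) (hΔ : Δ ∈ Set.Ioo (0 : ℝ) (π / 2)) :
    (3 + 2 * √2) / 8 < B₁ ν Δ := by
  have h0 := G_nonneg Δ
  have h1 := G_lt hΔ
  have h2 : ν * G Δ ≤ G Δ := mul_le_of_le_one_left h0 hν.2
  have h3 : 0 ≤ ν * G Δ := mul_nonneg hν.1 h0
  rw [← inv_four_sub_two_mul_sqrt_two_sq, B₁]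
  apply inv_strictAnti₀ (by nlinarith)
  exact pow_lt_pow_left₀ (by linarith) (by linarith) two_ne_zero

lemma B₁_one_pi_div_two : B₁ 1 (π / 2) = (3 + 2 * √2) / 8 := by
  rw [B₁, G_pi_div_two, ← inv_four_sub_two_mul_sqrt_two_sq]
  ring

lemma continuousAt_B₁_one_pi_div_two : ContinuousAt (B₁ 1) (π / 2) := by
  have hsin : Real.sin (π / 2 / 4) ≠ 0 :=
    (Real.sin_pos_of_pos_of_lt_pi (by positivity) (by linarith [Real.pi_pos])).ne'
  have hcot : ContinuousAt (fun Δ : ℝ => Real.cot (Δ / 4)) (π / 2) := by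
    simp only [Real.cot_eq_cos_div_sin]
    exact ContinuousAt.div (by fun_prop) (by fun_prop) hsin
  have hG : ContinuousAt G (π / 2) := by
    refine ContinuousAt.inv₀ (by fun_prop) ?_
    rw [show π / 2 / 4 = π / 8 by ring, cot_pi_div_eight]
    positivity
  refine ContinuousAt.inv₀ (by fun_prop) ?_
  have := G_nonneg (π / 2)
  positivity

/-- `B₁ > (3 + 2√2)/8` on `[0,1] × (0,π/2)`, and the infimum of `B₁` there equals
`(3 + 2√2)/8`. -/
theorem B1_gt_and_inf :
    (∀ ν Δ : ℝ, ν ∈ Set.Icc (0 : ℝ) 1 → Δ ∈ Set.Ioo (0 : ℝ) (π / 2) →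
      B₁ ν Δ > (3 + 2 * Real.sqrt 2) / 8) ∧
    sInf {r : ℝ | ∃ ν Δ : ℝ, ν ∈ Set.Icc (0 : ℝ) 1 ∧ Δ ∈ Set.Ioo (0 : ℝ) (π / 2) ∧
        r = B₁ ν Δ} = (3 + 2 * Real.sqrt 2) / 8 := by
  refine ⟨fun ν Δ hν hΔ => lt_B₁ hν hΔ, ?_⟩
  refine csInf_eq_of_forall_ge_of_forall_gt_exists_lt ?_ ?_ ?_
  · exact ⟨_, 0, π / 4, by simp, ⟨by positivity, by linarith [Real.pi_pos]⟩, rfl⟩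
  · rintro _ ⟨ν, Δ, hν, hΔ, rfl⟩
    exact (lt_B₁ hν hΔ).le
  · intro w hw
    rw [← B₁_one_pi_div_two] at hw
    have hlt : ∀ᶠ Δ in nhdsWithin (π / 2) (Set.Iio (π / 2)), B₁ 1 Δ < w :=
      (continuousAt_B₁_one_pi_div_two.eventually_lt_const hw).filter_mono nhdsWithin_le_nhds
    obtain ⟨Δ, hΔw, hΔ⟩ :=
      (hlt.and (Ioo_mem_nhdsLT (show (0 : ℝ) < π / 2 by positivity))).exists
    exact ⟨_, ⟨1, Δ, by simp, hΔ, rfl⟩, hΔw⟩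
end

section
/- If f, g : ℝ → ℝ are differentiable functions satisfying f(t + π) = −f(t) and g(t + π) = g(t) for all t ∈ ℝ, and 1 + f'(t) + g'(t) ≥ 0 for all t ∈ ℝ, then the total variation of f over one period satisfies ∫₀^{2π} |f'(t)| dt ≤ 2π. -/
open Real

theorem deriv_add_of_antiperiodic {f : ℝ → ℝ} {c : ℝ} (hf : ∀ t, f (t + c) = - f t) (t : ℝ) :
    deriv f (t + c) = - deriv f t := by
  rw [← deriv_comp_add_const, funext hf, deriv.fun_neg]

theorem deriv_add_of_periodic {g : ℝ → ℝ} {c : ℝ} (hg : ∀ t, g (t + c) = g t) (t : ℝ) :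
    deriv g (t + c) = deriv g t := by
  rw [← deriv_comp_add_const, funext hg]

/-- Upper bound on the total variation of the anti-periodic part: if `f` is `π`-anti-periodic,
`g` is `π`-periodic and `1 + f' + g' ≥ 0` everywhere, then `∫₀^{2π} |f'| ≤ 2π`. -/
theorem total_variation_le_two_pi (f g : ℝ → ℝ)
    (hf : Differentiable ℝ f) (hg : Differentiable ℝ g)
    (hfa : ∀ t, f (t + π) = - f t)
    (hgp : ∀ t, g (t + π) = g t)
    (hpos : ∀ t, 0 ≤ 1 + deriv f t + deriv g t) :
    (∫ t in (0:ℝ)..(2 * π), |deriv f t|) ≤ 2 * π := by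
  have hbound (t : ℝ) : |deriv f t| ≤ 1 + deriv g t := by
    have h := hpos (t + π)
    rw [deriv_add_of_antiperiodic hfa, deriv_add_of_periodic hgp] at h
    exact abs_le.2 ⟨by linarith [hpos t], by linarith⟩
  have hderiv (t : ℝ) : HasDerivAt (fun s => s + g s) (1 + deriv g t) t :=
    (hasDerivAt_id t).add (hg t).hasDerivAt
  have hint : IntervalIntegrable (fun t => 1 + deriv g t) MeasureTheory.volume 0 (2 * π) :=
    intervalIntegral.intervalIntegrable_deriv_of_nonneg
      (fun t _ => (hderiv t).continuousAt.continuousWithinAt) (fun t _ => hderiv t)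
      (fun t _ => (abs_nonneg _).trans (hbound t))
  have hintf : IntervalIntegrable (fun t => |deriv f t|) MeasureTheory.volume 0 (2 * π) :=
    hint.mono_fun' (measurable_deriv f).abs.aestronglyMeasurable
      (.of_forall fun t => by simpa using hbound t)
  have hperiod : g (2 * π) = g 0 := by
    rw [two_mul, hgp, ← hgp 0, zero_add]
  calc ∫ t in (0:ℝ)..(2 * π), |deriv f t|
      ≤ ∫ t in (0:ℝ)..(2 * π), (1 + deriv g t) :=
        intervalIntegral.integral_mono_on two_pi_pos.le hintf hint fun t _ => hbound t
    _ = 2 * π := by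
        rw [intervalIntegral.integral_eq_sub_of_hasDerivAt (fun t _ => hderiv t) hint, hperiod]
        ring
end

section
/- There exist six distinct points s₁ < s₂ < s₃ < s₄ < s₅ < s₆ in [0, 2π) such that φ(sᵢ + π) = φ(sᵢ) + π for i = 1,…,6; that is, the curve Γ has at least six critical points. -/
open Real

/-- A continuous function without zeros on an open interval has constant sign there. -/
lemma exists_sign_of_ne_zero_on_Ioo {f : ℝ → ℝ} (hf : Continuous f) {a b : ℝ}
    (h : ∀ x ∈ Set.Ioo a b, f x ≠ 0) :
    ∃ ε : ℝ, (ε = 1 ∨ ε = -1) ∧ ∀ x ∈ Set.Ioo a b, 0 < ε * f x := by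
  by_cases hpos : ∀ x ∈ Set.Ioo a b, 0 < f x
  · exact ⟨1, Or.inl rfl, by simpa using hpos⟩
  · push Not at hpos
    obtain ⟨y, hy, hfy⟩ := hpos
    refine ⟨-1, Or.inr rfl, fun x hx => ?_⟩
    by_contra! hfx
    obtain ⟨z, hz, hfz⟩ := isPreconnected_Ioo.intermediate_value hy hx hf.continuousOn
      (show (0 : ℝ) ∈ Set.Icc (f y) (f x) from ⟨hfy, by linarith⟩)
    exact h z hz hfz

lemma false_of_sin_mul_sign
    {m G : ℝ → ℝ} (hm : Continuous m) (hG : Continuous G) (hmper : ∀ s, m (s + π) = m s + π)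
    (hGper : ∀ s, G (s + π) = -G s) (hint : ∀ c, ∫ s in (0 : ℝ)..π, sin (m s - c) * G s = 0)
    {a b c ε : ℝ} (hab : a < b) (hba : b < a + π)
    (h₁ : ∀ x ∈ Set.Ioo a b, 0 < ε * (sin (m x - c) * G x))
    (h₂ : ∀ x ∈ Set.Ioo b (a + π), 0 < ε * (sin (m x - c) * G x)) : False := by
  have hcont : Continuous fun x => ε * (sin (m x - c) * G x) := by fun_prop
  have hper : Function.Periodic (fun x => sin (m x - c) * G x) π := fun x => by
    simp only [hmper, hGper, add_sub_right_comm, sin_add_pi]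
    ring
  have hzero : ∫ x in a..a + π, ε * (sin (m x - c) * G x) = 0 := by
    rw [intervalIntegral.integral_const_mul, hper.intervalIntegral_add_eq a 0, zero_add, hint,
      mul_zero]
  have hpos₁ := intervalIntegral.intervalIntegral_pos_of_pos_on
    (hcont.intervalIntegrable a b) h₁ hab
  have hpos₂ := intervalIntegral.intervalIntegral_pos_of_pos_on
    (hcont.intervalIntegrable b (a + π)) h₂ hba
  rw [← intervalIntegral.integral_add_adjacent_intervals (hcont.intervalIntegrable a b)
    (hcont.intervalIntegrable b (a + π))] at hzero
  linarith

lemma sin_sub_pos_of_mem_Ioo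
    {m : ℝ → ℝ} (hmono : StrictMono m) (hmper : ∀ s, m (s + π) = m s + π)
    {p x : ℝ} (hx : x ∈ Set.Ioo p (p + π)) :
    0 < sin (m x - m p) := by
  have h₁ := hmono hx.1
  have h₂ := hmono hx.2
  rw [hmper] at h₂
  exact sin_pos_of_pos_of_lt_pi (by linarith) (by linarith)

lemma sin_sub_neg_of_mem_Ioo
    {m : ℝ → ℝ} (hmono : StrictMono m) (hmper : ∀ s, m (s + π) = m s + π)
    {p x : ℝ} (hx : x ∈ Set.Ioo (p - π) p) :
    sin (m x - m p) < 0 := by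
  have h₁ := hmono hx.2
  have h₂ := hmono (show p < x + π by linarith [hx.1])
  rw [hmper] at h₂
  exact sin_neg_of_neg_of_neg_pi_lt (by linarith) (by linarith)

/-- An antiperiodic function orthogonal to all `sin (m - c)` has two further zeros within a
half-period of any given point. -/
lemma exists_two_zeros_in_Ioo
    {m G : ℝ → ℝ} (hm : Continuous m) (hG : Continuous G) (hmono : StrictMono m)
    (hmper : ∀ s, m (s + π) = m s + π) (hGper : ∀ s, G (s + π) = -G s)
    (hint : ∀ c, ∫ s in (0 : ℝ)..π, sin (m s - c) * G s = 0)
    (a : ℝ) :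
    ∃ b c, a < b ∧ b < c ∧ c < a + π ∧ G b = 0 ∧ G c = 0 := by
  have hπ := pi_pos
  obtain ⟨b, hb, hGb⟩ : ∃ b ∈ Set.Ioo a (a + π), G b = 0 := by
    by_contra! hne
    obtain ⟨ε, -, hε⟩ := exists_sign_of_ne_zero_on_Ioo hG hne
    have hpos : ∀ x ∈ Set.Ioo a (a + π), 0 < ε * (sin (m x - m a) * G x) := fun x hx => by
      have := mul_pos (sin_sub_pos_of_mem_Ioo hmono hmper hx) (hε x hx)
      linarith
    exact false_of_sin_mul_sign hm hG hmper hGper hint (b := a + π / 2) (by linarith)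
      (by linarith) (fun x hx => hpos x ⟨hx.1, by linarith [hx.2]⟩)
      (fun x hx => hpos x ⟨by linarith [hx.1], hx.2⟩)
  by_contra! hne
  obtain ⟨ε₁, hε₁, h₁⟩ := exists_sign_of_ne_zero_on_Ioo (a := a) (b := b) hG
    fun x hx h => hne x b hx.1 hx.2 hb.2 h hGb
  obtain ⟨ε₂, hε₂, h₂⟩ := exists_sign_of_ne_zero_on_Ioo (a := b) (b := a + π) hG
    fun x hx => hne b x hb.1 hx.1 hx.2 hGb
  have hcases : ε₂ = ε₁ ∨ ε₂ = -ε₁ := by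
    rcases hε₁ with rfl | rfl <;> rcases hε₂ with rfl | rfl <;> simp
  rcases hcases with rfl | rfl
  · refine false_of_sin_mul_sign hm hG hmper hGper hint (c := m a) (ε := ε₂) hb.1 hb.2
      (fun x hx => ?_) (fun x hx => ?_)
    · have := mul_pos (sin_sub_pos_of_mem_Ioo hmono hmper ⟨hx.1, hx.2.trans hb.2⟩) (h₁ x hx)
      linarith
    · have := mul_pos (sin_sub_pos_of_mem_Ioo hmono hmper ⟨hb.1.trans hx.1, hx.2⟩) (h₂ x hx)
      linarith
  · refine false_of_sin_mul_sign hm hG hmper hGper hint (c := m b) (ε := -ε₁) hb.1 hb.2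
      (fun x hx => ?_) (fun x hx => ?_)
    · have := mul_neg_of_neg_of_pos (sin_sub_neg_of_mem_Ioo hmono hmper
        ⟨by linarith [hx.1, hb.2], hx.2⟩) (h₁ x hx)
      linarith
    · have := mul_pos (sin_sub_pos_of_mem_Ioo hmono hmper
        ⟨hx.1, by linarith [hx.2, hb.1]⟩) (h₂ x hx)
      linarith

lemma exists_three_zeros_in_Ico
    {m G : ℝ → ℝ} (hm : Continuous m) (hG : Continuous G) (hmono : StrictMono m)
    (hmper : ∀ s, m (s + π) = m s + π) (hGper : ∀ s, G (s + π) = -G s)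
    (hint : ∀ c, ∫ s in (0 : ℝ)..π, sin (m s - c) * G s = 0) :
    ∃ a b c, 0 ≤ a ∧ a < b ∧ b < c ∧ c < π ∧ G a = 0 ∧ G b = 0 ∧ G c = 0 := by
  have hπ := pi_pos
  obtain ⟨b, c, hb, hbc, hcπ, hGb, -⟩ :=
    exists_two_zeros_in_Ioo hm hG hmono hmper hGper hint 0
  have hshift : ∀ x, G x = 0 → G (x - π) = 0 := fun x hx => by
    have := hGper (x - π)
    rw [sub_add_cancel, hx] at this
    linarith
  obtain ⟨a, ha, haπ, hGa⟩ : ∃ a, 0 ≤ a ∧ a < π ∧ G a = 0 := by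
    by_cases hbπ : b < π
    · exact ⟨b, hb.le, hbπ, hGb⟩
    · exact ⟨b - π, by linarith, by linarith, hshift b hGb⟩
  obtain ⟨b, c, hab, hbc, hca, hGb, hGc⟩ :=
    exists_two_zeros_in_Ioo hm hG hmono hmper hGper hint a
  rcases lt_or_ge c π with hc | hc
  · exact ⟨a, b, c, ha, hab, hbc, hc, hGa, hGb, hGc⟩
  rcases lt_or_ge b π with hb | hb
  · exact ⟨c - π, a, b, by linarith, by linarith, hab, hb, hshift c hGc, hGa, hGb⟩
  · exact ⟨b - π, c - π, a, by linarith, by linarith, by linarith, haπ, hshift b hGb,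
      hshift c hGc, hGa⟩

/-- Every smooth closed curve has at least six critical points, i.e. six points
`s₁ < ⋯ < s₆` in `[0, 2π)` with `φ(sᵢ + π) = φ(sᵢ) + π`. -/
theorem six_critical_points (φ : ℝ → ℝ)
    (hφ : ContDiff ℝ (⊤ : ℕ∞) φ)
    (hφ' : ∀ s, 0 < deriv φ s)
    (hφper : ∀ s, φ (s + 2 * π) = φ s + 2 * π)
    (hclose_cos : (∫ s in (0:ℝ)..(2 * π), Real.cos (φ s)) = 0)
    (hclose_sin : (∫ s in (0:ℝ)..(2 * π), Real.sin (φ s)) = 0) :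
    ∃ s₁ s₂ s₃ s₄ s₅ s₆ : ℝ,
      s₁ < s₂ ∧ s₂ < s₃ ∧ s₃ < s₄ ∧ s₄ < s₅ ∧ s₅ < s₆ ∧
      s₁ ∈ Set.Ico (0:ℝ) (2 * π) ∧ s₂ ∈ Set.Ico (0:ℝ) (2 * π) ∧
      s₃ ∈ Set.Ico (0:ℝ) (2 * π) ∧ s₄ ∈ Set.Ico (0:ℝ) (2 * π) ∧
      s₅ ∈ Set.Ico (0:ℝ) (2 * π) ∧ s₆ ∈ Set.Ico (0:ℝ) (2 * π) ∧
      φ (s₁ + π) = φ s₁ + π ∧ φ (s₂ + π) = φ s₂ + π ∧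
      φ (s₃ + π) = φ s₃ + π ∧ φ (s₄ + π) = φ s₄ + π ∧
      φ (s₅ + π) = φ s₅ + π ∧ φ (s₆ + π) = φ s₆ + π := by
  have hπ := pi_pos
  have hcont : Continuous φ := hφ.continuous
  have hmono : StrictMono φ := strictMono_of_deriv_pos hφ'
  have hper : ∀ s, φ (s + π + π) = φ s + 2 * π := fun s => by rw [← hφper]; ring_nf
  have hint : ∀ c, ∫ s in (0 : ℝ)..π,
      sin ((φ s + φ (s + π)) / 2 - c) * cos ((φ (s + π) - φ s) / 2) = 0 := fun c => by
    have hsin : Continuous fun s => sin (φ s - c) := by fun_prop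
    have htotal : ∫ s in (0 : ℝ)..(2 * π), sin (φ s - c) = 0 := by
      simp only [sin_sub]
      rw [intervalIntegral.integral_sub
        (Continuous.intervalIntegrable (by fun_prop) _ _)
        (Continuous.intervalIntegrable (by fun_prop) _ _),
        intervalIntegral.integral_mul_const, intervalIntegral.integral_mul_const,
        hclose_cos, hclose_sin]
      ring
    have hshift : ∫ s in (0 : ℝ)..π, sin (φ (s + π) - c) =
        ∫ s in π..(2 * π), sin (φ s - c) := by
      rw [intervalIntegral.integral_comp_add_right (fun s => sin (φ s - c)), zero_add, two_mul]
    have hprod : ∀ s, sin ((φ s + φ (s + π)) / 2 - c) * cos ((φ (s + π) - φ s) / 2) =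
        (1 / 2) * (sin (φ s - c) + sin (φ (s + π) - c)) := fun s => by
      rw [show φ s - c = ((φ s + φ (s + π)) / 2 - c) - (φ (s + π) - φ s) / 2 by ring,
        show φ (s + π) - c = ((φ s + φ (s + π)) / 2 - c) + (φ (s + π) - φ s) / 2 by ring,
        sin_sub _ ((φ (s + π) - φ s) / 2), sin_add]
      ring
    simp only [hprod]
    rw [intervalIntegral.integral_const_mul, intervalIntegral.integral_add
      (hsin.intervalIntegrable _ _) (Continuous.intervalIntegrable (by fun_prop) _ _), hshift,
      intervalIntegral.integral_add_adjacent_intervals (hsin.intervalIntegrable _ _)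
        (hsin.intervalIntegrable _ _), htotal, mul_zero]
  obtain ⟨a, b, c, ha, hab, hbc, hc, hGa, hGb, hGc⟩ := exists_three_zeros_in_Ico
    (m := fun s => (φ s + φ (s + π)) / 2) (G := fun s => cos ((φ (s + π) - φ s) / 2))
    (by fun_prop) (by fun_prop)
    (fun x y hxy => by
      have h₁ := hmono hxy
      have h₂ := hmono (add_lt_add_left hxy π)
      dsimp only
      linarith)
    (fun s => by rw [hper]; ring)
    (fun s => by
      rw [hper, ← cos_pi_sub]
      congr 1
      ring)
    hint
  have hcrit : ∀ s, cos ((φ (s + π) - φ s) / 2) = 0 → φ (s + π) = φ s + π := fun s hs => by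
    have h₁ := hmono (show s < s + π by linarith)
    have h₂ := hmono (show s + π < s + π + π by linarith)
    rw [hper] at h₂
    have := injOn_cos (x₁ := (φ (s + π) - φ s) / 2) (x₂ := π / 2)
      ⟨by linarith, by linarith⟩ ⟨by linarith, by linarith⟩ (by rw [hs, cos_pi_div_two])
    linarith
  have hcrit' : ∀ s, φ (s + π) = φ s + π → φ (s + π + π) = φ (s + π) + π := fun s hs => by
    rw [hper, hs]
    ring
  have hca := hcrit a hGa
  have hcb := hcrit b hGb
  have hcc := hcrit c hGc
  exact ⟨a, b, c, a + π, b + π, c + π, hab, hbc, by linarith, by linarith, by linarith,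
    ⟨by linarith, by linarith⟩, ⟨by linarith, by linarith⟩, ⟨by linarith, by linarith⟩,
    ⟨by linarith, by linarith⟩, ⟨by linarith, by linarith⟩, ⟨by linarith, by linarith⟩,
    hca, hcb, hcc, hcrit' a hca, hcrit' b hcb, hcrit' c hcc⟩
end

section
/- For every t ∈ ℝ, the energy projection satisfies I(t) ≥ (1 + 2|f(t)|/π)⁻². -/
open Real

/-- The Dirichlet Wirtinger inequality with a frequency strictly below the sharp one. -/
theorem wirtinger_dirichlet_of_lt {h h' : ℝ → ℝ} {a b ω : ℝ} (hab : a ≤ b)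
    (hd : ∀ s, HasDerivAt h (h' s) s) (hc : Continuous h') (ha : h a = 0) (hb : h b = 0)
    (hω : 0 ≤ ω) (hωb : ω * (b - a) < π) :
    ω ^ 2 * (∫ s in a..b, h s ^ 2) ≤ ∫ s in a..b, h' s ^ 2 := by
  set m := (a + b) / 2 with hm
  have hcont : Continuous h := continuous_iff_continuousAt.2 fun s => (hd s).continuousAt
  have hcos : ∀ s ∈ Set.uIcc a b, cos (ω * (s - m)) ≠ 0 := by
    intro s hs
    rw [Set.uIcc_of_le hab] at hs
    have h1 : ω * a ≤ ω * s := mul_le_mul_of_nonneg_left hs.1 hω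
    have h2 : ω * s ≤ ω * b := mul_le_mul_of_nonneg_left hs.2 hω
    refine (cos_pos_of_mem_Ioo ⟨?_, ?_⟩).ne' <;> rw [hm] <;> nlinarith
  have hder : ∀ s ∈ Set.uIcc a b, HasDerivAt (fun s => ω * tan (ω * (s - m)) * h s ^ 2)
      ((h' s + ω * tan (ω * (s - m)) * h s) ^ 2 - (h' s ^ 2 - ω ^ 2 * h s ^ 2)) s := by
    intro s hs
    have hlin : HasDerivAt (fun s => ω * (s - m)) ω s := by
      simpa using ((hasDerivAt_id s).sub_const m).const_mul ω
    have htan := (hasDerivAt_tan (hcos s hs)).comp s hlin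
    refine ((htan.const_mul ω).mul ((hd s).pow 2)).congr_deriv ?_
    have hsec : 1 / cos (ω * (s - m)) ^ 2 = 1 + tan (ω * (s - m)) ^ 2 := by
      rw [one_div, ← inv_one_add_tan_sq (hcos s hs), inv_inv]
    rw [hsec]
    simp only [Function.comp, Pi.pow_apply]
    push_cast
    ring
  have hq : ContinuousOn (fun s => ω * tan (ω * (s - m))) (Set.uIcc a b) := by
    simp only [tan_eq_sin_div_cos]
    exact continuousOn_const.mul (ContinuousOn.div (by fun_prop) (by fun_prop) hcos)
  have hsq : IntervalIntegrable (fun s => (h' s + ω * tan (ω * (s - m)) * h s) ^ 2)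
      MeasureTheory.volume a b :=
    ((hc.continuousOn.add (hq.mul hcont.continuousOn)).pow 2).intervalIntegrable
  have hi1 : IntervalIntegrable (fun s => h' s ^ 2) MeasureTheory.volume a b :=
    (hc.pow 2).intervalIntegrable _ _
  have hi2 : IntervalIntegrable (fun s => ω ^ 2 * h s ^ 2) MeasureTheory.volume a b :=
    (continuous_const.mul (hcont.pow 2)).intervalIntegrable _ _
  have hftc := intervalIntegral.integral_eq_sub_of_hasDerivAt hder (hsq.sub (hi1.sub hi2))
  rw [intervalIntegral.integral_sub hsq (hi1.sub hi2), intervalIntegral.integral_sub hi1 hi2,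
    intervalIntegral.integral_const_mul, ha, hb] at hftc
  have hnn : 0 ≤ ∫ s in a..b, (h' s + ω * tan (ω * (s - m)) * h s) ^ 2 :=
    intervalIntegral.integral_nonneg hab fun s _ => sq_nonneg _
  linarith

/-- The Dirichlet Wirtinger inequality: if `h` vanishes at both ends of `[a, b]` and
`ω (b - a) ≤ π`, then `ω² ∫ h² ≤ ∫ h'²`. -/
theorem wirtinger_dirichlet {h h' : ℝ → ℝ} {a b ω : ℝ} (hab : a ≤ b)
    (hd : ∀ s, HasDerivAt h (h' s) s) (hc : Continuous h') (ha : h a = 0) (hb : h b = 0)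
    (hω : 0 < ω) (hωb : ω * (b - a) ≤ π) :
    ω ^ 2 * (∫ s in a..b, h s ^ 2) ≤ ∫ s in a..b, h' s ^ 2 := by
  have hlim : Filter.Tendsto (fun x : ℝ => x ^ 2 * (∫ s in a..b, h s ^ 2))
      (nhdsWithin ω (Set.Iio ω)) (nhds (ω ^ 2 * (∫ s in a..b, h s ^ 2))) :=
    (Continuous.tendsto (by fun_prop) ω).mono_left nhdsWithin_le_nhds
  refine le_of_tendsto hlim ?_
  filter_upwards [Ioo_mem_nhdsLT hω] with x hx
  refine wirtinger_dirichlet_of_lt hab hd hc ha hb hx.1.le ?_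
  rcases hab.eq_or_lt with rfl | hlt
  · simpa using pi_pos
  · exact (mul_lt_mul_of_pos_right hx.2 (sub_pos.2 hlt)).trans_le hωb

/-- Lower bound on the energy projection: `I(t) ≥ (1 + 2|f(t)|/π)⁻²`, where
`f(t) = (u(t) − u(t+π) + π)/2` and `u = φ⁻¹`. -/
theorem energy_projection_lower_bound (φ u ψ : ℝ → ℝ)
    (hφ : ContDiff ℝ (⊤ : ℕ∞) φ)
    (hφ' : ∀ s, 0 < deriv φ s)
    (hφper : ∀ s, φ (s + 2 * π) = φ s + 2 * π)
    (hclose_cos : (∫ s in (0:ℝ)..(2 * π), Real.cos (φ s)) = 0)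
    (hclose_sin : (∫ s in (0:ℝ)..(2 * π), Real.sin (φ s)) = 0)
    (hu : ∀ t, φ (u t) = t) (hu' : ∀ s, u (φ s) = s)
    (hψ : ContDiff ℝ 1 ψ)
    (hψper : ∀ s, ψ (s + 2 * π) = ψ s)
    (hψpos : ∀ s, 0 < ψ s)
    (t : ℝ) :
    ((1 + 2 * |(u t - u (t + π) + π) / 2| / π) ^ 2)⁻¹ ≤
      (∫ s in (0:ℝ)..(2 * π),
          (deriv (fun s => ψ s * Real.cos (φ s) * Real.sin t
            - ψ s * Real.sin (φ s) * Real.cos t) s) ^ 2) /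
        (∫ s in (0:ℝ)..(2 * π),
          (ψ s * Real.cos (φ s) * Real.sin t - ψ s * Real.sin (φ s) * Real.cos t) ^ 2) := by
  set h : ℝ → ℝ := fun s => ψ s * Real.cos (φ s) * Real.sin t
    - ψ s * Real.sin (φ s) * Real.cos t with hh
  change _ ≤ (∫ s in (0:ℝ)..(2 * π), deriv h s ^ 2) / (∫ s in (0:ℝ)..(2 * π), h s ^ 2)
  have hmono : StrictMono φ := strictMono_of_deriv_pos hφ'
  have hsin : ∀ s, h s = ψ s * sin (t - φ s) := fun s => by
    simp only [hh, sin_sub]; ring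
  have hφ1 : ContDiff ℝ 1 φ := hφ.of_le (by exact_mod_cast le_top)
  have hC : ContDiff ℝ 1 h :=
    ((hψ.mul hφ1.cos).mul contDiff_const).sub ((hψ.mul hφ1.sin).mul contDiff_const)
  have hd : ∀ s, HasDerivAt h (deriv h s) s := fun s =>
    (hC.differentiable one_ne_zero s).hasDerivAt
  have hc' : Continuous (deriv h) := hC.continuous_deriv le_rfl
  have hper : Function.Periodic h (2 * π) := fun s => by
    simp only [hh, hψper, hφper, cos_add_two_pi, sin_add_two_pi]
  have hper' : Function.Periodic (deriv h) (2 * π) := fun s => by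
    rw [← deriv_comp_add_const]
    exact congrArg (fun g => deriv g s) (funext hper)
  have hac : u t < u (t + π) := hmono.lt_iff_lt.1 (by rw [hu, hu]; linarith [pi_pos])
  have hb : u (t + 2 * π) = u t + 2 * π := by
    rw [← hu' (u t + 2 * π), hφper, hu]
  have hcb : u (t + π) < u t + 2 * π := by
    rw [← hb]; exact hmono.lt_iff_lt.1 (by rw [hu, hu]; linarith [pi_pos])
  have hza : h (u t) = 0 := by simp [hsin, hu]
  have hzc : h (u (t + π)) = 0 := by simp [hsin, hu]
  have hzb : h (u t + 2 * π) = 0 := by rw [hper, hza]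
  generalize hA : u t = a at *
  generalize hCc : u (t + π) = c at *
  have i1 : ∀ x y, IntervalIntegrable (fun s => h s ^ 2) MeasureTheory.volume x y :=
    fun x y => (hC.continuous.pow 2).intervalIntegrable _ _
  have i2 : ∀ x y, IntervalIntegrable (fun s => deriv h s ^ 2) MeasureTheory.volume x y :=
    fun x y => (hc'.pow 2).intervalIntegrable _ _
  have e1 : (∫ s in (0:ℝ)..(2 * π), h s ^ 2)
      = (∫ s in a..c, h s ^ 2) + ∫ s in c..(a + 2 * π), h s ^ 2 := by
    rw [intervalIntegral.integral_add_adjacent_intervals (i1 _ _) (i1 _ _)]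
    simpa using (hper.comp (· ^ 2)).intervalIntegral_add_eq 0 a
  have e2 : (∫ s in (0:ℝ)..(2 * π), deriv h s ^ 2)
      = (∫ s in a..c, deriv h s ^ 2) + ∫ s in c..(a + 2 * π), deriv h s ^ 2 := by
    rw [intervalIntegral.integral_add_adjacent_intervals (i2 _ _) (i2 _ _)]
    simpa using (hper'.comp (· ^ 2)).intervalIntegral_add_eq 0 a
  have hp1 : 0 < ∫ s in a..c, h s ^ 2 := by
    refine intervalIntegral.intervalIntegral_pos_of_pos_on (i1 _ _) (fun s hs => ?_) hac
    have l1 : t < φ s := by have := hmono hs.1; rwa [← hA, hu] at this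
    have l2 : φ s < t + π := by have := hmono hs.2; rwa [← hCc, hu] at this
    have hneg : sin (t - φ s) < 0 := sin_neg_of_neg_of_neg_pi_lt (by linarith) (by linarith)
    have : h s ≠ 0 := by rw [hsin]; exact mul_ne_zero (hψpos s).ne' hneg.ne
    positivity
  have hp2 : 0 ≤ ∫ s in c..(a + 2 * π), h s ^ 2 :=
    intervalIntegral.integral_nonneg hcb.le fun s _ => sq_nonneg _
  have hK : 0 < 1 + 2 * |(a - c + π) / 2| / π := by positivity
  have hKπ : (1 + 2 * |(a - c + π) / 2| / π) * π = π + 2 * |(a - c + π) / 2| := by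
    field_simp
  have hle : ∀ L, L ≤ π + 2 * |(a - c + π) / 2| →
      (1 + 2 * |(a - c + π) / 2| / π)⁻¹ * L ≤ π := fun L hL => by
    rwa [inv_mul_le_iff₀ hK, hKπ]
  have w1 := wirtinger_dirichlet hac.le hd hc' hza hzc (inv_pos.2 hK)
    (hle _ (by linarith [neg_abs_le ((a - c + π) / 2)]))
  have w2 := wirtinger_dirichlet hcb.le hd hc' hzc hzb (inv_pos.2 hK)
    (hle _ (by linarith [le_abs_self ((a - c + π) / 2)]))
  rw [le_div_iff₀ (by rw [e1]; linarith), e1, e2, ← inv_pow, mul_add]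
  exact add_le_add w1 w2
end

section
/- Either the energy projection I is constant on ℝ, in which case E(x,y) = I(0) ≥ 1; or I is non-constant, in which case I is π-periodic and for every t₀ ∈ ℝ the set { t ∈ (t₀, t₀ + π] : I'(t) = 0 } has exactly two elements (one pair of maxima and one pair of minima of I per full period, with I strictly monotone between consecutive extrema). -/
open Real

open MeasureTheory intervalIntegral

/-- **Wirtinger's inequality** for periodic `C¹` functions with mean zero. -/
theorem integral_sq_le_integral_deriv_sq {f f' : ℝ → ℝ} (hf : ∀ x, HasDerivAt f (f' x) x)
    (hf' : Continuous f') (hper : f (2 * π) = f 0) (hmean : ∫ x in (0:ℝ)..(2 * π), f x = 0) :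
    ∫ x in (0:ℝ)..(2 * π), f x ^ 2 ≤ ∫ x in (0:ℝ)..(2 * π), f' x ^ 2 := by
  have hab : (0:ℝ) < 2 * π := by positivity
  have hfc : Continuous f := continuous_iff_continuousAt.2 fun x => (hf x).continuousAt
  have hL2 : ∀ g : ℝ → ℝ, Continuous g →
      MemLp (fun x => (g x : ℂ)) 2 (volume.restrict (Set.Ioc 0 (2 * π))) := fun g hg => by
    have hgc : Continuous fun x => (g x : ℂ) := Complex.continuous_ofReal.comp hg
    rw [memLp_two_iff_integrable_sq_norm hgc.aestronglyMeasurable]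
    exact (hgc.norm.pow 2).integrableOn_Ioc
  have h₁ := hasSum_sq_fourierCoeffOn hab (hL2 f hfc)
  have h₂ := hasSum_sq_fourierCoeffOn hab (hL2 f' hf')
  have hle : ∀ n : ℤ, ‖fourierCoeffOn hab (fun x => (f x : ℂ)) n‖ ^ 2 ≤
      ‖fourierCoeffOn hab (fun x => (f' x : ℂ)) n‖ ^ 2 := by
    intro n
    rcases eq_or_ne n 0 with rfl | hn
    · have : fourierCoeffOn hab (fun x => (f x : ℂ)) 0 = 0 := by
        rw [fourierCoeffOn_eq_integral]
        simp [intervalIntegral.integral_ofReal, hmean]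
      rw [this]
      simp
    · rw [fourierCoeffOn_of_hasDerivAt hab hn (fun x _ => (hf x).ofReal_comp)
        ((Complex.continuous_ofReal.comp hf').intervalIntegrable _ _), hper]
      have hn1 : (1:ℝ) ≤ |(n:ℝ)| := by exact_mod_cast Int.one_le_abs hn
      refine pow_le_pow_left₀ (norm_nonneg _) ?_ 2
      simp only [sub_self, mul_zero, zero_sub, norm_mul, norm_neg, norm_div, norm_one,
        Complex.norm_I, Complex.ofReal_zero, sub_zero, Complex.ofReal_mul, Complex.norm_real,
        Complex.ofReal_ofNat, Complex.norm_ofNat, Complex.norm_intCast, Real.norm_eq_abs,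
        abs_of_pos pi_pos, mul_one]
      rw [← mul_assoc, one_div_mul_eq_div, mul_comm (2 * π), div_mul_cancel_right₀ hab.ne']
      exact mul_le_of_le_one_left (norm_nonneg _) (inv_le_one_of_one_le₀ hn1)
  have h := hasSum_le hle h₁ h₂
  simp only [Complex.norm_real, Real.norm_eq_abs, sq_abs, smul_eq_mul] at h
  exact le_of_mul_le_mul_left h (by simpa using hab)

theorem integral_sq_mul_sin_sub_mul_cos {u v : ℝ → ℝ} (hu : Continuous u) (hv : Continuous v)
    (a b t : ℝ) :
    ∫ s in a..b, (u s * sin t - v s * cos t) ^ 2 =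
      (∫ s in a..b, u s ^ 2) * sin t ^ 2 - 2 * (∫ s in a..b, u s * v s) * (sin t * cos t)
        + (∫ s in a..b, v s ^ 2) * cos t ^ 2 := by
  have i₁ : IntervalIntegrable (fun s => u s ^ 2 * sin t ^ 2) volume a b :=
    Continuous.intervalIntegrable (by fun_prop) _ _
  have i₂ : IntervalIntegrable (fun s => u s * v s * (2 * (sin t * cos t))) volume a b :=
    Continuous.intervalIntegrable (by fun_prop) _ _
  have i₃ : IntervalIntegrable (fun s => v s ^ 2 * cos t ^ 2) volume a b :=
    Continuous.intervalIntegrable (by fun_prop) _ _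
  calc ∫ s in a..b, (u s * sin t - v s * cos t) ^ 2
      = ∫ s in a..b, (u s ^ 2 * sin t ^ 2 - u s * v s * (2 * (sin t * cos t))
          + v s ^ 2 * cos t ^ 2) := by congr 1; ext s; ring
    _ = _ := by
      rw [integral_add (i₁.sub i₂) i₃, integral_sub i₁ i₂]
      simp only [intervalIntegral.integral_mul_const]
      ring

/-- A nonzero binary quadratic form vanishes on at most two lines. -/
theorem binary_quadratic_form_eq_zero {u v w a₁ b₁ a₂ b₂ a₃ b₃ : ℝ}
    (h₁ : u * a₁ ^ 2 + v * (a₁ * b₁) + w * b₁ ^ 2 = 0)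
    (h₂ : u * a₂ ^ 2 + v * (a₂ * b₂) + w * b₂ ^ 2 = 0)
    (h₃ : u * a₃ ^ 2 + v * (a₃ * b₃) + w * b₃ ^ 2 = 0)
    (h₁₂ : a₁ * b₂ - b₁ * a₂ ≠ 0) (h₁₃ : a₁ * b₃ - b₁ * a₃ ≠ 0)
    (h₂₃ : a₂ * b₃ - b₂ * a₃ ≠ 0) : u = 0 ∧ v = 0 ∧ w = 0 := by
  have hD : (a₁ * b₂ - b₁ * a₂) * (a₁ * b₃ - b₁ * a₃) * (a₂ * b₃ - b₂ * a₃) ≠ 0 :=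
    mul_ne_zero (mul_ne_zero h₁₂ h₁₃) h₂₃
  refine ⟨?_, ?_, ?_⟩ <;> refine (mul_eq_zero.1 ?_).resolve_right hD
  · linear_combination b₂ * b₃ * (a₂ * b₃ - b₂ * a₃) * h₁ - b₁ * b₃ * (a₁ * b₃ - b₁ * a₃) * h₂
      + b₁ * b₂ * (a₁ * b₂ - b₁ * a₂) * h₃
  · linear_combination -(a₂ * b₃ + b₂ * a₃) * (a₂ * b₃ - b₂ * a₃) * h₁
      + (a₁ * b₃ + b₁ * a₃) * (a₁ * b₃ - b₁ * a₃) * h₂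
      - (a₁ * b₂ + b₁ * a₂) * (a₁ * b₂ - b₁ * a₂) * h₃
  · linear_combination a₂ * a₃ * (a₂ * b₃ - b₂ * a₃) * h₁ - a₁ * a₃ * (a₁ * b₃ - b₁ * a₃) * h₂
      + a₁ * a₂ * (a₁ * b₂ - b₁ * a₂) * h₃

theorem sin_sub_ne_zero_of_mem_Ioc {t₀ x y : ℝ} (hx : x ∈ Set.Ioc t₀ (t₀ + π))
    (hy : y ∈ Set.Ioc t₀ (t₀ + π)) (hxy : x ≠ y) : sin (x - y) ≠ 0 := by
  rw [Ne, sin_eq_zero_iff_of_lt_of_lt (by linarith [hx.1, hy.2]) (by linarith [hx.2, hy.1])]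
  exact sub_ne_zero.2 hxy

/-- Along the unit circle, a non-constant ratio of two binary quadratic forms has exactly two
critical points per half-turn. -/
theorem encard_deriv_eq_zero_of_quadratic_ratio {A B C a b c : ℝ} {I : ℝ → ℝ}
    (hQ : ∀ t, 0 < a * sin t ^ 2 - 2 * b * (sin t * cos t) + c * cos t ^ 2)
    (hI : ∀ t, I t = (A * sin t ^ 2 - 2 * B * (sin t * cos t) + C * cos t ^ 2) /
      (a * sin t ^ 2 - 2 * b * (sin t * cos t) + c * cos t ^ 2))
    (hne : ¬ ∀ t, I t = I 0) (t₀ : ℝ) :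
    Set.encard {t ∈ Set.Ioc t₀ (t₀ + π) | deriv I t = 0} = 2 := by
  have hform : ∀ A B C t : ℝ,
      HasDerivAt (fun t => A * sin t ^ 2 - 2 * B * (sin t * cos t) + C * cos t ^ 2)
        (2 * (A * (sin t * cos t)) - 2 * B * (cos t ^ 2 - sin t ^ 2)
          - 2 * (C * (sin t * cos t))) t := by
    intro A B C t
    have hs := hasDerivAt_sin t
    have hc := hasDerivAt_cos t
    refine ((((hs.pow 2).const_mul A).sub ((hs.mul hc).const_mul (2 * B))).add
      ((hc.pow 2).const_mul C)).congr_deriv ?_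
    simp
    ring
  have hderiv : ∀ t, HasDerivAt I
      (2 * ((B * a - A * b) * sin t ^ 2 + (A * c - C * a) * (sin t * cos t)
        + (C * b - B * c) * cos t ^ 2) /
        (a * sin t ^ 2 - 2 * b * (sin t * cos t) + c * cos t ^ 2) ^ 2) t := by
    intro t
    have h := (hform A B C t).div (hform a b c t) (hQ t).ne'
    rw [funext hI]
    refine h.congr_deriv ?_
    congr 1
    linear_combination 2 * ((B * a - A * b) * sin t ^ 2 + (A * c - C * a) * (sin t * cos t)
        + (C * b - B * c) * cos t ^ 2) * sin_sq_add_cos_sq t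
  have hzero : ∀ t, deriv I t = 0 ↔ (B * a - A * b) * sin t ^ 2 +
      (A * c - C * a) * (sin t * cos t) + (C * b - B * c) * cos t ^ 2 = 0 := by
    intro t
    rw [(hderiv t).deriv, div_eq_zero_iff, or_iff_left (pow_ne_zero 2 (hQ t).ne')]
    simp
  have hper : Function.Periodic I π := fun t => by simp [hI]
  have hcont : Continuous I := continuous_iff_continuousAt.2 fun t => (hderiv t).continuousAt
  have hnonempty : (Set.Icc t₀ (t₀ + π)).Nonempty := Set.nonempty_Icc.2 (by linarith [pi_pos])
  obtain ⟨M, -, hM⟩ := isCompact_Icc.exists_isMaxOn hnonempty hcont.continuousOn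
  obtain ⟨m, -, hm⟩ := isCompact_Icc.exists_isMinOn hnonempty hcont.continuousOn
  obtain ⟨x, hx, hMx⟩ := hper.exists_mem_Ioc pi_pos M t₀
  obtain ⟨y, hy, hmy⟩ := hper.exists_mem_Ioc pi_pos m t₀
  have hmax : ∀ t, I t ≤ I x := fun t => by
    obtain ⟨z, hz, htz⟩ := hper.exists_mem_Ioc pi_pos t t₀
    rw [htz, ← hMx]
    exact hM (Set.Ioc_subset_Icc_self hz)
  have hmin : ∀ t, I y ≤ I t := fun t => by
    obtain ⟨z, hz, htz⟩ := hper.exists_mem_Ioc pi_pos t t₀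
    rw [htz, ← hmy]
    exact hm (Set.Ioc_subset_Icc_self hz)
  have hxy : x ≠ y := by
    rintro rfl
    exact hne fun t => ((hmax t).antisymm (hmin t)).trans ((hmin 0).antisymm (hmax 0))
  have hx0 : deriv I x = 0 := IsLocalMax.deriv_eq_zero (Filter.Eventually.of_forall hmax)
  have hy0 : deriv I y = 0 := IsLocalMin.deriv_eq_zero (Filter.Eventually.of_forall hmin)
  refine Set.encard_eq_two.2 ⟨x, y, hxy, Set.Subset.antisymm ?_ ?_⟩
  · rintro z ⟨hz, hz0⟩
    by_contra hzxy
    simp only [Set.mem_insert_iff, Set.mem_singleton_iff, not_or] at hzxy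
    have hcross : ∀ {p q : ℝ}, p ∈ Set.Ioc t₀ (t₀ + π) → q ∈ Set.Ioc t₀ (t₀ + π) → p ≠ q →
        sin p * cos q - cos p * sin q ≠ 0 := fun hp hq hpq =>
      sin_sub _ _ ▸ sin_sub_ne_zero_of_mem_Ioc hp hq hpq
    obtain ⟨hu, hv, hw⟩ := binary_quadratic_form_eq_zero ((hzero z).1 hz0) ((hzero x).1 hx0)
      ((hzero y).1 hy0) (hcross hz hx hzxy.1) (hcross hz hy hzxy.2) (hcross hx hy hxy)
    refine hne fun t => is_const_of_deriv_eq_zero (fun t => (hderiv t).differentiableAt) ?_ t 0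
    intro t
    rw [hzero, hu, hv, hw]
    ring
  · rintro z (rfl | rfl)
    exacts [⟨hx, hx0⟩, ⟨hy, hy0⟩]

theorem exists_mul_sin_sub_mul_cos_eq_zero (p q : ℝ) : ∃ t, p * sin t - q * cos t = 0 := by
  have h : Continuous fun t => p * sin t - q * cos t := by fun_prop
  have h0 : ∀ t, p * sin (t + π) - q * cos (t + π) = -(p * sin t - q * cos t) := fun t => by
    simp only [sin_add_pi, cos_add_pi]
    ring
  rcases le_total (p * sin 0 - q * cos 0) 0 with h' | h'
  · exact mem_range_of_exists_le_of_exists_ge h ⟨0, h'⟩ ⟨0 + π, by rw [h0]; linarith⟩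
  · exact mem_range_of_exists_le_of_exists_ge h ⟨0 + π, by rw [h0]; linarith⟩ ⟨0, h'⟩

/-- Either the energy projection `I` is constant (and then `E(x,y) = I(0) ≥ 1`), or `I` is
non-constant, `π`-periodic, and has exactly two critical points in every half-open interval
of length `π`. -/
theorem energy_projection_dichotomy (φ ψ : ℝ → ℝ) (I : ℝ → ℝ)
    (hφ : ContDiff ℝ (⊤ : ℕ∞) φ)
    (hφ' : ∀ s, 0 < deriv φ s)
    (hφper : ∀ s, φ (s + 2 * π) = φ s + 2 * π)
    (hclose_cos : (∫ s in (0:ℝ)..(2 * π), Real.cos (φ s)) = 0)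
    (hclose_sin : (∫ s in (0:ℝ)..(2 * π), Real.sin (φ s)) = 0)
    (hψ : ContDiff ℝ 1 ψ)
    (hψper : ∀ s, ψ (s + 2 * π) = ψ s)
    (hψpos : ∀ s, 0 < ψ s)
    (hI : ∀ t, I t =
      (∫ s in (0:ℝ)..(2 * π),
          (deriv (fun s => ψ s * Real.cos (φ s) * Real.sin t
            - ψ s * Real.sin (φ s) * Real.cos t) s) ^ 2) /
        (∫ s in (0:ℝ)..(2 * π),
          (ψ s * Real.cos (φ s) * Real.sin t - ψ s * Real.sin (φ s) * Real.cos t) ^ 2)) :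
    ((∀ t, I t = I 0) ∧
      (∫ s in (0:ℝ)..(2 * π),
          ((deriv (fun s => ψ s * Real.cos (φ s)) s) ^ 2
            + (deriv (fun s => ψ s * Real.sin (φ s)) s) ^ 2)) /
        (∫ s in (0:ℝ)..(2 * π),
          ((ψ s * Real.cos (φ s)) ^ 2 + (ψ s * Real.sin (φ s)) ^ 2)) = I 0 ∧
      1 ≤ I 0) ∨
    ((¬ ∀ t, I t = I 0) ∧ (∀ t, I (t + π) = I t) ∧
      ∀ t₀ : ℝ, Set.encard {t ∈ Set.Ioc t₀ (t₀ + π) | deriv I t = 0} = 2) := by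
  have hφd : ∀ s, HasDerivAt φ (deriv φ s) s := fun s =>
    (hφ.differentiable (by simp)).differentiableAt.hasDerivAt
  have hφ1 : ContDiff ℝ 1 φ := hφ.of_le (by exact_mod_cast le_top)
  set x : ℝ → ℝ := fun s => ψ s * cos (φ s) with hx
  set y : ℝ → ℝ := fun s => ψ s * sin (φ s) with hy
  have hxC : ContDiff ℝ 1 x := hψ.mul hφ1.cos
  have hyC : ContDiff ℝ 1 y := hψ.mul hφ1.sin
  have hxd : ∀ s, HasDerivAt x (deriv x s) s := fun s =>
    (hxC.differentiable (by simp)).differentiableAt.hasDerivAt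
  have hyd : ∀ s, HasDerivAt y (deriv y s) s := fun s =>
    (hyC.differentiable (by simp)).differentiableAt.hasDerivAt
  have hx'c : Continuous (deriv x) := hxC.continuous_deriv (by simp)
  have hy'c : Continuous (deriv y) := hyC.continuous_deriv (by simp)
  have hxc := hxC.continuous
  have hyc := hyC.continuous
  have hhd : ∀ t s, HasDerivAt (fun s => x s * sin t - y s * cos t)
      (deriv x s * sin t - deriv y s * cos t) s := fun t s =>
    ((hxd s).mul_const _).sub ((hyd s).mul_const _)
  have hden : ∀ t, 0 < ∫ s in (0:ℝ)..(2 * π), (x s * sin t - y s * cos t) ^ 2 := by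
    intro t
    refine integral_pos (by positivity) (by fun_prop) (fun _ _ => sq_nonneg _) ?_
    by_contra! hcon
    have hsin : ∀ s ∈ Set.Icc 0 (2 * π), sin (t - φ s) = 0 := by
      intro s hs
      have h1 : ψ s * sin (t - φ s) = 0 := by
        rw [← sq_eq_zero_iff]
        refine le_antisymm (le_trans (le_of_eq ?_) (hcon s hs)) (sq_nonneg _)
        rw [sin_sub]
        ring
      exact (mul_eq_zero.1 h1).resolve_left (hψpos s).ne'
    have hπ : π ∈ Set.Ioo 0 (2 * π) := ⟨pi_pos, by linarith [pi_pos]⟩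
    have hev : (fun s => sin (t - φ s)) =ᶠ[nhds π] fun _ => 0 :=
      Filter.eventually_of_mem (Icc_mem_nhds hπ.1 hπ.2) hsin
    have hd := (((hφd π).const_sub t).sin.congr_of_eventuallyEq hev.symm).unique
      (hasDerivAt_const π (0:ℝ))
    have hcos : cos (t - φ π) = 0 := by
      simpa [(hφ' π).ne'] using hd
    have := sin_sq_add_cos_sq (t - φ π)
    rw [hcos, hsin π (Set.Ioo_subset_Icc_self hπ)] at this
    norm_num at this
  have hI' : ∀ t, I t = (∫ s in (0:ℝ)..(2 * π), (deriv x s * sin t - deriv y s * cos t) ^ 2) /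
      ∫ s in (0:ℝ)..(2 * π), (x s * sin t - y s * cos t) ^ 2 := by
    intro t
    rw [hI t]
    congr 1
    exact integral_congr fun s _ => congrArg (· ^ 2) (hhd t s).deriv
  have hnum_eq := integral_sq_mul_sin_sub_mul_cos hx'c hy'c 0 (2 * π)
  have hden_eq := integral_sq_mul_sin_sub_mul_cos hxc hyc 0 (2 * π)
  by_cases hconst : ∀ t, I t = I 0
  · refine Or.inl ⟨hconst, ?_, ?_⟩
    · have hmul : ∀ t, (∫ s in (0:ℝ)..(2 * π), (deriv x s * sin t - deriv y s * cos t) ^ 2) =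
          I 0 * ∫ s in (0:ℝ)..(2 * π), (x s * sin t - y s * cos t) ^ 2 := fun t =>
        (div_eq_iff (hden t).ne').1 ((hI' t).symm.trans (hconst t))
      have h0 := hmul 0
      have h1 := hmul (π / 2)
      have d0 := hden 0
      have d1 := hden (π / 2)
      simp only [sin_zero, cos_zero, sin_pi_div_two, cos_pi_div_two, mul_zero, mul_one, zero_sub,
        sub_zero, neg_sq] at h0 h1 d0 d1
      have hadd : ∀ {u v : ℝ → ℝ}, Continuous u → Continuous v →
          ∫ s in (0:ℝ)..(2 * π), (u s ^ 2 + v s ^ 2) =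
            (∫ s in (0:ℝ)..(2 * π), u s ^ 2) + ∫ s in (0:ℝ)..(2 * π), v s ^ 2 := fun hu hv =>
        integral_add ((hu.pow 2).intervalIntegrable _ _) ((hv.pow 2).intervalIntegrable _ _)
      rw [hadd hx'c hy'c, hadd hxc hyc, div_eq_iff (add_pos d1 d0).ne']
      linear_combination h0 + h1
    · obtain ⟨t, ht⟩ := exists_mul_sin_sub_mul_cos_eq_zero
        (∫ s in (0:ℝ)..(2 * π), x s) (∫ s in (0:ℝ)..(2 * π), y s)
      rw [← hconst t, hI', one_le_div (hden t)]
      refine integral_sq_le_integral_deriv_sq (hhd t) (by fun_prop) ?_ ?_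
      · have h1 := hφper 0
        have h2 := hψper 0
        rw [zero_add] at h1 h2
        simp only [hx, hy, h1, h2, cos_add_two_pi, sin_add_two_pi]
      · rw [integral_sub ((hxc.mul_const _).intervalIntegrable _ _)
          ((hyc.mul_const _).intervalIntegrable _ _)]
        simpa only [intervalIntegral.integral_mul_const] using ht
  · have hratio := fun t => (hI' t).trans (by rw [hnum_eq, hden_eq])
    refine Or.inr ⟨hconst, fun t => ?_, encard_deriv_eq_zero_of_quadratic_ratio
      (fun t => hden_eq t ▸ hden t) hratio hconst⟩
    rw [hratio, hratio]
    simp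
end

section
/- Let α, β, γ ∈ ℝ be angles no two of which are congruent modulo π, and set a = cos(β − γ)/(sin(α − β) sin(α − γ)), b = cos(α − γ)/(sin(β − α) sin(β − γ)), c = cos(α − β)/(sin(γ − α) sin(γ − β)). Then E(x,y) = (a·I(α)·(X·V_α) + b·I(β)·(X·V_β) + c·I(γ)·(X·V_γ)) / (a·(X·V_α) + b·(X·V_β) + c·(X·V_γ)). -/
open Real Matrix

/-- `X = (∫ x², −2∫ xy, ∫ y²) ∈ ℝ³`. -/
noncomputable def Xvec (x y : ℝ → ℝ) : Fin 3 → ℝ :=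
  ![∫ s in (0:ℝ)..(2 * π), x s ^ 2,
    -2 * ∫ s in (0:ℝ)..(2 * π), x s * y s,
    ∫ s in (0:ℝ)..(2 * π), y s ^ 2]

/-- `V_t = (sin² t, sin t cos t, cos² t) ∈ ℝ³`. -/
noncomputable def Vvec (t : ℝ) : Fin 3 → ℝ :=
  ![Real.sin t ^ 2, Real.sin t * Real.cos t, Real.cos t ^ 2]

/-- The integral of the square of a projection is a quadratic form in `(sin t, cos t)`. -/
theorem integral_sq_mul_sin_sub_mul_cos_s11 {f g : ℝ → ℝ} (hf : Continuous f) (hg : Continuous g)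
    (u v t : ℝ) :
    ∫ s in u..v, (f s * Real.sin t - g s * Real.cos t) ^ 2 =
      (∫ s in u..v, f s ^ 2) * Real.sin t ^ 2
        - 2 * (∫ s in u..v, f s * g s) * (Real.sin t * Real.cos t)
        + (∫ s in u..v, g s ^ 2) * Real.cos t ^ 2 := by
  have expand : ∀ s, (f s * Real.sin t - g s * Real.cos t) ^ 2 =
      f s ^ 2 * Real.sin t ^ 2 - f s * g s * (2 * (Real.sin t * Real.cos t))
        + g s ^ 2 * Real.cos t ^ 2 := fun s => by ring
  simp only [expand]
  rw [intervalIntegral.integral_add, intervalIntegral.integral_sub]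
  · simp only [intervalIntegral.integral_mul_const]
    ring
  all_goals exact Continuous.intervalIntegrable (by fun_prop) _ _

/-- The trace of a binary quadratic form as a combination of its values at three angles. -/
theorem three_angles_trace {α β γ : ℝ} (hαβ : Real.sin (α - β) ≠ 0)
    (hαγ : Real.sin (α - γ) ≠ 0) (hβγ : Real.sin (β - γ) ≠ 0) (p q r : ℝ) :
    Real.cos (β - γ) / (Real.sin (α - β) * Real.sin (α - γ)) *
        (p * Real.sin α ^ 2 - 2 * q * (Real.sin α * Real.cos α) + r * Real.cos α ^ 2)
      + Real.cos (α - γ) / (Real.sin (β - α) * Real.sin (β - γ)) *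
        (p * Real.sin β ^ 2 - 2 * q * (Real.sin β * Real.cos β) + r * Real.cos β ^ 2)
      + Real.cos (α - β) / (Real.sin (γ - α) * Real.sin (γ - β)) *
        (p * Real.sin γ ^ 2 - 2 * q * (Real.sin γ * Real.cos γ) + r * Real.cos γ ^ 2) =
      p + r := by
  rw [← neg_sub α β, ← neg_sub α γ, ← neg_sub β γ]
  simp only [Real.sin_neg]
  field_simp
  simp only [Real.sin_sub, Real.cos_sub]
  ring

theorem sin_ne_zero_of_ne_int_mul_pi {θ : ℝ} (h : ∀ k : ℤ, θ ≠ k * π) : Real.sin θ ≠ 0 :=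
  Real.sin_ne_zero_iff.mpr fun k => (h k).symm

/-- The Three Angles Lemma: `E(x,y)` is a weighted average of `I(α), I(β), I(γ)` with
weights `a X·V_α`, `b X·V_β`, `c X·V_γ`. -/
theorem three_angles_lemma (x y : ℝ → ℝ)
    (hx : ContDiff ℝ 1 x) (hy : ContDiff ℝ 1 y)
    (hxper : ∀ s, x (s + 2 * π) = x s) (hyper : ∀ s, y (s + 2 * π) = y s)
    (hpos : 0 < ∫ s in (0:ℝ)..(2 * π), (x s ^ 2 + y s ^ 2))
    (hproj : ∀ t : ℝ, 0 < ∫ s in (0:ℝ)..(2 * π), (x s * Real.sin t - y s * Real.cos t) ^ 2)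
    (I : ℝ → ℝ)
    (hI : ∀ t, I t =
      (∫ s in (0:ℝ)..(2 * π), (deriv (fun s => x s * Real.sin t - y s * Real.cos t) s) ^ 2) /
        (∫ s in (0:ℝ)..(2 * π), (x s * Real.sin t - y s * Real.cos t) ^ 2))
    (α β γ a b c : ℝ)
    (hαβ : ∀ k : ℤ, α - β ≠ k * π)
    (hαγ : ∀ k : ℤ, α - γ ≠ k * π)
    (hβγ : ∀ k : ℤ, β - γ ≠ k * π)
    (ha : a = Real.cos (β - γ) / (Real.sin (α - β) * Real.sin (α - γ)))
    (hb : b = Real.cos (α - γ) / (Real.sin (β - α) * Real.sin (β - γ)))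
    (hc : c = Real.cos (α - β) / (Real.sin (γ - α) * Real.sin (γ - β))) :
    (∫ s in (0:ℝ)..(2 * π), ((deriv x s) ^ 2 + (deriv y s) ^ 2)) /
        (∫ s in (0:ℝ)..(2 * π), (x s ^ 2 + y s ^ 2)) =
      (a * I α * (Xvec x y ⬝ᵥ Vvec α) + b * I β * (Xvec x y ⬝ᵥ Vvec β)
          + c * I γ * (Xvec x y ⬝ᵥ Vvec γ)) /
        (a * (Xvec x y ⬝ᵥ Vvec α) + b * (Xvec x y ⬝ᵥ Vvec β)
          + c * (Xvec x y ⬝ᵥ Vvec γ)) := by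
  have hsαβ := sin_ne_zero_of_ne_int_mul_pi hαβ
  have hsαγ := sin_ne_zero_of_ne_int_mul_pi hαγ
  have hsβγ := sin_ne_zero_of_ne_int_mul_pi hβγ
  have hx' : Continuous (deriv x) := hx.continuous_deriv le_rfl
  have hy' : Continuous (deriv y) := hy.continuous_deriv le_rfl
  have hXV : ∀ t, Xvec x y ⬝ᵥ Vvec t =
      ∫ s in (0:ℝ)..(2 * π), (x s * Real.sin t - y s * Real.cos t) ^ 2 := fun t => by
    rw [integral_sq_mul_sin_sub_mul_cos_s11 hx.continuous hy.continuous]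
    simp [Xvec, Vvec, dotProduct, Fin.sum_univ_three]
    ring
  have hderiv : ∀ t s, deriv (fun s => x s * Real.sin t - y s * Real.cos t) s =
      deriv x s * Real.sin t - deriv y s * Real.cos t := fun t s =>
    (((hx.differentiable one_ne_zero s).hasDerivAt.mul_const _).sub
      ((hy.differentiable one_ne_zero s).hasDerivAt.mul_const _)).deriv
  have hIXV : ∀ t, I t * (Xvec x y ⬝ᵥ Vvec t) =
      ∫ s in (0:ℝ)..(2 * π), (deriv x s * Real.sin t - deriv y s * Real.cos t) ^ 2 := fun t => by
    rw [hXV, hI, div_mul_cancel₀ _ (hproj t).ne']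
    simp only [hderiv]
  have hsum : ∀ {f g : ℝ → ℝ}, Continuous f → Continuous g →
      ∫ s in (0:ℝ)..(2 * π), (f s ^ 2 + g s ^ 2) =
        (∫ s in (0:ℝ)..(2 * π), f s ^ 2) + ∫ s in (0:ℝ)..(2 * π), g s ^ 2 := fun hf hg =>
    intervalIntegral.integral_add ((hf.pow 2).intervalIntegrable _ _)
      ((hg.pow 2).intervalIntegrable _ _)
  simp only [mul_assoc, hIXV]
  simp only [hXV, integral_sq_mul_sin_sub_mul_cos_s11 hx' hy',
    integral_sq_mul_sin_sub_mul_cos_s11 hx.continuous hy.continuous]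
  rw [ha, hb, hc, three_angles_trace hsαβ hsαγ hsβγ, three_angles_trace hsαβ hsαγ hsβγ,
    hsum hx' hy', hsum hx.continuous hy.continuous]
end
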